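/- Let Ω be homogeneous of degree zero on ℝⁿ \ {0}, integrable on S^{n-1} with mean value zero, and suppose Ω satisfies the L¹-Dini condition. Let f ∈ L¹(ℝⁿ) with f ≥ 0. Then lim_{λ→0⁺} λ · m({x ∈ ℝⁿ : |T_Ω f(x)| > λ}) = (1/n) ‖Ω‖_{L¹(S^{n-1})} ‖f‖_{L¹(ℝⁿ)}. -/

import Mathlib

open MeasureTheory Filter Set

noncomputable section

/-- The unit sphere `S^{n-1}` in `ℝⁿ`. -/
abbrev unitSphere (n : ℕ) := Metric.sphere (0 : EuclideanSpace ℝ (Fin n)) 1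

/-- The surface (area) measure `σ` on the unit sphere `S^{n-1}`. -/
def sphereMeasure (n : ℕ) : Measure (unitSphere n) :=
  (volume : Measure (EuclideanSpace ℝ (Fin n))).toSphere

/-- `Ω` is homogeneous of degree zero on `ℝⁿ \ {0}`. -/
def HomogeneousZero {n : ℕ} (Ω : EuclideanSpace ℝ (Fin n) → ℝ) : Prop :=
  ∀ c : ℝ, 0 < c → ∀ x : EuclideanSpace ℝ (Fin n), x ≠ 0 → Ω (c • x) = Ω x

/-- The `L¹` integral modulus of continuity of `Ω`, defined via rotations:
`ω₁(δ) = sup_{‖ρ‖ ≤ δ} ∫_{S^{n-1}} |Ω(ρθ) - Ω(θ)| dσ(θ)`, where `ρ` ranges over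
rotations of `ℝⁿ` (linear isometries of determinant `1`) and
`‖ρ‖ = sup{ |ρx' - x'| : x' ∈ S^{n-1} }`. -/
def omegaRot (n : ℕ) (Ω : EuclideanSpace ℝ (Fin n) → ℝ) (δ : ℝ) : ℝ :=
  sSup {I : ℝ | ∃ ρ : EuclideanSpace ℝ (Fin n) ≃ₗᵢ[ℝ] EuclideanSpace ℝ (Fin n),
    LinearMap.det (ρ.toLinearEquiv : EuclideanSpace ℝ (Fin n) →ₗ[ℝ] EuclideanSpace ℝ (Fin n)) = 1 ∧
    (∀ x : EuclideanSpace ℝ (Fin n), ‖x‖ = 1 → ‖ρ x - x‖ ≤ δ) ∧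
    I = ∫ θ : unitSphere n, |Ω (ρ (θ : EuclideanSpace ℝ (Fin n))) - Ω (θ : EuclideanSpace ℝ (Fin n))| ∂(sphereMeasure n)}

/-- The `L¹` integral modulus of continuity of `Ω`, defined via translations:
`ω̃₁(δ) = sup_{|h| ≤ δ} ∫_{S^{n-1}} |Ω(θ + h) - Ω(θ)| dσ(θ)`, where `Ω` is evaluated
off the sphere via its degree-zero homogeneous extension. -/
def omegaTrans (n : ℕ) (Ω : EuclideanSpace ℝ (Fin n) → ℝ) (δ : ℝ) : ℝ :=
  sSup {I : ℝ | ∃ h : EuclideanSpace ℝ (Fin n), ‖h‖ ≤ δ ∧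
    I = ∫ θ : unitSphere n, |Ω ((θ : EuclideanSpace ℝ (Fin n)) + h) - Ω (θ : EuclideanSpace ℝ (Fin n))| ∂(sphereMeasure n)}

/-- `Ω` satisfies the `L¹`-Dini condition. -/
def L1Dini (n : ℕ) (Ω : EuclideanSpace ℝ (Fin n) → ℝ) : Prop :=
  Integrable (fun θ : unitSphere n => Ω (θ : EuclideanSpace ℝ (Fin n))) (sphereMeasure n) ∧
  ∫⁻ δ in Ioo (0 : ℝ) 1, ENNReal.ofReal (omegaRot n Ω δ / δ) < ⊤

/-- The truncated singular integral `∫_{|x-y| > ε} Ω(x-y)|x-y|^{-n} dμ(y)` of a signed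
measure `μ`, where integration against `μ` is via its Jordan decomposition. -/
def truncT (n : ℕ) (Ω : EuclideanSpace ℝ (Fin n) → ℝ)
    (μ : SignedMeasure (EuclideanSpace ℝ (Fin n))) (x : EuclideanSpace ℝ (Fin n)) (ε : ℝ) : ℝ :=
  (∫ y in {y | ε < ‖x - y‖}, Ω (x - y) / ‖x - y‖ ^ n ∂μ.toJordanDecomposition.posPart) -
  (∫ y in {y | ε < ‖x - y‖}, Ω (x - y) / ‖x - y‖ ^ n ∂μ.toJordanDecomposition.negPart)

/-- The principal-value singular integral `T_Ω μ(x) = p.v. ∫ Ω(x-y)|x-y|^{-n} dμ(y)`. -/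
def TOmega (n : ℕ) (Ω : EuclideanSpace ℝ (Fin n) → ℝ)
    (μ : SignedMeasure (EuclideanSpace ℝ (Fin n))) (x : EuclideanSpace ℝ (Fin n)) : ℝ :=
  limUnder (nhdsWithin (0 : ℝ) (Ioi 0)) (truncT n Ω μ x)

/-- The principal-value singular integral of a function:
`T_Ω f(x) = p.v. ∫ Ω(x-y)|x-y|^{-n} f(y) dy`. -/
def TOmegaFun (n : ℕ) (Ω f : EuclideanSpace ℝ (Fin n) → ℝ) (x : EuclideanSpace ℝ (Fin n)) : ℝ :=
  limUnder (nhdsWithin (0 : ℝ) (Ioi 0))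
    (fun ε => ∫ y in {y : EuclideanSpace ℝ (Fin n) | ε < ‖x - y‖},
      Ω (x - y) / ‖x - y‖ ^ n * f y)

set_option linter.unusedSectionVars false

namespace RoughKernel

open scoped Topology ENNReal NNReal

section DiniKernels

variable {E : Type*} [NormedAddCommGroup E] [InnerProductSpace ℝ E] [FiniteDimensional ℝ E]
  [MeasurableSpace E] [BorelSpace E]

/-- The half-open annulus `{x | a < ‖x‖ ≤ b}`. -/
def annulus (E : Type*) [NormedAddCommGroup E] (a b : ℝ) : Set E := {x | a < ‖x‖ ∧ ‖x‖ ≤ b}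

/-- The restriction of `K` to the dyadic annulus `{x | 2 ^ j < ‖x‖ ≤ 2 ^ (j + 1)}`. -/
def piece (K : E → ℝ) (j : ℤ) : E → ℝ := (annulus E ((2 : ℝ) ^ j) (2 ^ (j + 1))).indicator K

/-- The `L¹` distance between `k` and its translate by `t`. -/
def shiftDiff (k : E → ℝ) (t : E) : ℝ≥0∞ := ∫⁻ x, ‖k (x - t) - k x‖ₑ

/-- The `L¹` modulus of continuity of the unit dyadic piece of `K`, at scale `2 ^ (-m)`. -/
def modulus (K : E → ℝ) (m : ℕ) : ℝ≥0∞ :=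
  ⨆ t : E, ⨆ _ : ‖t‖ ≤ (2 : ℝ) ^ (-(m : ℤ)), shiftDiff (piece K 0) t

/-- Homogeneous kernels of critical degree with mean value zero and an `L¹`-Dini condition. -/
structure DiniKernel (K : E → ℝ) : Prop where
  measurable : Measurable K
  homog : ∀ s : ℝ, 0 < s → ∀ x, K (s • x) = (s ^ Module.finrank ℝ E)⁻¹ * K x
  integrable : Integrable (piece K 0)
  mean_zero : ∀ a b : ℝ, 0 < a → ∫ x in annulus E a b, K x = 0
  dini : ∑' m, modulus K m < ∞

lemma measurableSet_annulus (a b : ℝ) : MeasurableSet (annulus E a b) := by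
  unfold annulus
  exact (measurableSet_lt measurable_const measurable_norm).inter
    (measurableSet_le measurable_norm measurable_const)

lemma DiniKernel.measurable_piece {K : E → ℝ} (hK : DiniKernel K) (j : ℤ) :
    Measurable (piece K j) := hK.measurable.indicator (measurableSet_annulus _ _)

/-- Change of variables for dilations. -/
lemma lintegral_comp_smul (f : E → ℝ≥0∞) {s : ℝ} (hs : 0 < s) :
    ∫⁻ x, f x = ENNReal.ofReal (s ^ Module.finrank ℝ E) * ∫⁻ x, f (s • x) := by
  have h := Measure.map_addHaar_smul (volume : Measure E) hs.ne'
  have h2 : ∫⁻ x, f (s • x) = ∫⁻ x, f x ∂(Measure.map (s • ·) volume) :=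
    ((Homeomorph.smulOfNeZero s hs.ne').measurableEmbedding.lintegral_map f).symm
  rw [h2, h, lintegral_smul_measure, smul_eq_mul, ← mul_assoc, ← ENNReal.ofReal_mul (by positivity),
    abs_of_pos (by positivity), mul_inv_cancel₀ (by positivity)]
  simp

lemma annulus_smul_mem {s : ℝ} (hs : 0 < s) (a b : ℝ) (x : E) :
    s • x ∈ annulus E (s * a) (s * b) ↔ x ∈ annulus E a b := by
  simp [annulus, norm_smul, abs_of_pos hs, hs]

lemma DiniKernel.lintegral_annulus_scale {K : E → ℝ} (hK : DiniKernel K) (a b : ℝ) {s : ℝ}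
    (hs : 0 < s) :
    ∫⁻ x in annulus E (s * a) (s * b), ‖K x‖ₑ = ∫⁻ x in annulus E a b, ‖K x‖ₑ := by
  rw [← lintegral_indicator (measurableSet_annulus _ _),
    ← lintegral_indicator (measurableSet_annulus _ _), lintegral_comp_smul _ hs,
    ← lintegral_const_mul' _ _ ENNReal.ofReal_ne_top]
  congr 1 with x
  by_cases hx : x ∈ annulus E a b
  · rw [indicator_of_mem ((annulus_smul_mem hs a b x).2 hx), indicator_of_mem hx, hK.homog s hs,
      enorm_mul, ← mul_assoc]
    have : ‖(s ^ Module.finrank ℝ E)⁻¹‖ₑ = ENNReal.ofReal ((s ^ Module.finrank ℝ E)⁻¹) :=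
      Real.enorm_eq_ofReal (by positivity)
    rw [this, ← ENNReal.ofReal_mul (by positivity), mul_inv_cancel₀ (by positivity)]
    simp
  · rw [indicator_of_notMem (fun h => hx ((annulus_smul_mem hs a b x).1 h)),
      indicator_of_notMem hx, mul_zero]

lemma piece_smul {K : E → ℝ} (hK : DiniKernel K) (i j : ℤ) (x : E) :
    piece K (i + j) ((2 : ℝ) ^ i • x) = (((2 : ℝ) ^ i) ^ Module.finrank ℝ E)⁻¹ * piece K j x := by
  have h2 : (0 : ℝ) < 2 ^ i := by positivity
  have key := annulus_smul_mem h2 ((2 : ℝ) ^ j) (2 ^ (j + 1)) x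
  rw [← zpow_add₀ two_ne_zero, ← zpow_add₀ two_ne_zero, ← add_assoc] at key
  unfold piece
  by_cases hx : x ∈ annulus E ((2 : ℝ) ^ j) (2 ^ (j + 1))
  · rw [indicator_of_mem (key.2 hx), indicator_of_mem hx, hK.homog _ h2]
  · rw [indicator_of_notMem (fun h => hx (key.1 h)), indicator_of_notMem hx, mul_zero]

lemma DiniKernel.lintegral_piece {K : E → ℝ} (hK : DiniKernel K) (j : ℤ) :
    ∫⁻ x, ‖piece K j x‖ₑ = ∫⁻ x, ‖piece K 0 x‖ₑ := by
  have h2 : (0 : ℝ) < 2 ^ j := by positivity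
  have := hK.lintegral_annulus_scale ((2 : ℝ) ^ (0 : ℤ)) (2 ^ ((0 : ℤ) + 1)) h2
  rw [← zpow_add₀ two_ne_zero, ← zpow_add₀ two_ne_zero, ← add_assoc, add_zero] at this
  simpa only [piece, enorm_indicator_eq_indicator_enorm,
    lintegral_indicator (measurableSet_annulus _ _)] using this

lemma DiniKernel.integrable_piece {K : E → ℝ} (hK : DiniKernel K) (j : ℤ) :
    Integrable (piece K j) := by
  refine ⟨(hK.measurable_piece j).aestronglyMeasurable, ?_⟩
  rw [hasFiniteIntegral_iff_enorm, hK.lintegral_piece j]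
  exact hK.integrable.2

lemma DiniKernel.integral_piece {K : E → ℝ} (hK : DiniKernel K) (j : ℤ) :
    ∫ x, piece K j x = 0 := by
  unfold piece
  rw [integral_indicator (measurableSet_annulus _ _)]
  exact hK.mean_zero _ _ (by positivity)

lemma DiniKernel.shiftDiff_piece {K : E → ℝ} (hK : DiniKernel K) (j : ℤ) (t : E) :
    shiftDiff (piece K j) t = shiftDiff (piece K 0) ((2 : ℝ) ^ (-j) • t) := by
  have h2 : (0 : ℝ) < 2 ^ j := by positivity
  unfold shiftDiff
  rw [lintegral_comp_smul _ h2, ← lintegral_const_mul' _ _ ENNReal.ofReal_ne_top]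
  congr 1 with x
  have e : (2 : ℝ) ^ j • x - t = (2 : ℝ) ^ j • (x - (2 : ℝ) ^ (-j) • t) := by
    rw [smul_sub, smul_smul, ← zpow_add₀ two_ne_zero]; simp
  have := piece_smul hK j 0 (x - (2 : ℝ) ^ (-j) • t)
  have h' := piece_smul hK j 0 x
  rw [add_zero] at this h'
  rw [e, this, h', ← mul_sub, enorm_mul, ← mul_assoc, Real.enorm_eq_ofReal (by positivity),
    ← ENNReal.ofReal_mul (by positivity), mul_inv_cancel₀ (by positivity)]
  simp

lemma shiftDiff_le_modulus {K : E → ℝ} (m : ℕ) {t : E} (ht : ‖t‖ ≤ (2 : ℝ) ^ (-(m : ℤ))) :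
    shiftDiff (piece K 0) t ≤ modulus K m := by
  unfold modulus
  exact le_iSup₂_of_le t ht le_rfl

lemma DiniKernel.shiftDiff_piece_le {K : E → ℝ} (hK : DiniKernel K) (j : ℤ) (m : ℕ) {t : E}
    (ht : ‖t‖ ≤ (2 : ℝ) ^ (j - m)) : shiftDiff (piece K j) t ≤ modulus K m := by
  rw [hK.shiftDiff_piece]
  apply shiftDiff_le_modulus
  rw [norm_smul, Real.norm_of_nonneg (by positivity)]
  calc (2 : ℝ) ^ (-j) * ‖t‖ ≤ 2 ^ (-j) * 2 ^ (j - m) := by gcongr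
    _ = 2 ^ (-(m : ℤ)) := by rw [← zpow_add₀ two_ne_zero]; congr 1; ring

/-- The tail of the Dini sum. -/
def diniTail (K : E → ℝ) (p : ℕ) : ℝ≥0∞ := ∑' m, modulus K (m + p)

lemma DiniKernel.tendsto_diniTail {K : E → ℝ} (hK : DiniKernel K) :
    Tendsto (diniTail K) atTop (𝓝 0) := ENNReal.tendsto_sum_nat_add _ hK.dini.ne

lemma diniTail_le (K : E → ℝ) (p : ℕ) : diniTail K p ≤ diniTail K 0 := by
  unfold diniTail
  exact ENNReal.tsum_comp_le_tsum_of_injective (add_left_injective p) (fun m => modulus K (m + 0))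

lemma DiniKernel.diniTail_lt_top {K : E → ℝ} (hK : DiniKernel K) (p : ℕ) : diniTail K p < ∞ :=
  (diniTail_le K p).trans_lt (by simpa [diniTail] using hK.dini)

/-- Every nonzero vector lies in exactly one dyadic annulus. -/
lemma exists_mem_annulus {r : ℝ} (hr : 0 < r) : ∃ j : ℤ, (2 : ℝ) ^ j < r ∧ r ≤ 2 ^ (j + 1) :=
  exists_mem_Ioc_zpow hr one_lt_two

lemma piece_eq_zero_of_ne {K : E → ℝ} {i j : ℤ} {x : E} (hij : i ≠ j)
    (hx : (2 : ℝ) ^ i < ‖x‖ ∧ ‖x‖ ≤ 2 ^ (i + 1)) : piece K j x = 0 := by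
  unfold piece annulus
  refine indicator_of_notMem ?_ _
  rintro ⟨h1, h2⟩
  rcases lt_or_gt_of_ne hij with h | h
  · have : (2 : ℝ) ^ (i + 1) ≤ 2 ^ j := zpow_le_zpow_right₀ one_le_two h
    linarith [hx.2]
  · have : (2 : ℝ) ^ (j + 1) ≤ 2 ^ i := zpow_le_zpow_right₀ one_le_two h
    linarith [hx.1]

lemma piece_eq_self {K : E → ℝ} {i : ℤ} {x : E}
    (hx : (2 : ℝ) ^ i < ‖x‖ ∧ ‖x‖ ≤ 2 ^ (i + 1)) : piece K i x = K x :=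
  indicator_of_mem (s := annulus E _ _) hx _

/-- Hörmander's condition, with decaying tails. -/
lemma DiniKernel.hormander {K : E → ℝ} (hK : DiniKernel K) (p : ℕ) (y : E) :
    ∫⁻ x in {x | (2 : ℝ) ^ (p + 2) * ‖y‖ ≤ ‖x‖}, ‖K (x - y) - K x‖ₑ ≤ diniTail K p := by
  rcases eq_or_ne y 0 with rfl | hy
  · simp
  obtain ⟨i, hi1, hi2⟩ := exists_mem_annulus (norm_pos_iff.2 hy)
  have hmeas : MeasurableSet {x : E | (2 : ℝ) ^ (p + 2) * ‖y‖ ≤ ‖x‖} :=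
    measurableSet_le measurable_const measurable_norm
  calc ∫⁻ x in {x | (2 : ℝ) ^ (p + 2) * ‖y‖ ≤ ‖x‖}, ‖K (x - y) - K x‖ₑ
      ≤ ∫⁻ x in {x | (2 : ℝ) ^ (p + 2) * ‖y‖ ≤ ‖x‖},
        ∑' m : ℕ, ‖piece K (m + p + i + 1) (x - y) - piece K (m + p + i + 1) x‖ₑ := by
        refine setLIntegral_mono' hmeas fun x hx => ?_
        have hx : (2 : ℝ) ^ (p + 2) * ‖y‖ ≤ ‖x‖ := hx
        have hpi : (2 : ℝ) ^ ((p : ℤ) + i + 2) < ‖x‖ := by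
          refine lt_of_lt_of_le ?_ hx
          have : (2 : ℝ) ^ ((p : ℤ) + i + 2) = 2 ^ (p + 2) * 2 ^ i := by
            rw [← zpow_natCast, ← zpow_add₀ two_ne_zero]; congr 1; push_cast; ring
          rw [this]; gcongr
        have hbig : (2 : ℝ) ^ ((p : ℤ) + i + 1) < ‖x - y‖ := by
          have h1 : ‖x‖ - ‖y‖ ≤ ‖x - y‖ := norm_sub_norm_le x y
          have h2 : (2 : ℝ) ^ ((p : ℤ) + i + 2) = 2 * 2 ^ ((p : ℤ) + i + 1) := by
            rw [show (p : ℤ) + i + 2 = (p + i + 1) + 1 by ring, zpow_add_one₀ two_ne_zero]; ring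
          have h3 : (2 : ℝ) ^ (i + 1) ≤ 2 ^ ((p : ℤ) + i + 1) :=
            zpow_le_zpow_right₀ one_le_two (by omega)
          linarith
        have hbig' : (2 : ℝ) ^ ((p : ℤ) + i + 1) < ‖x‖ :=
          (zpow_lt_zpow_right₀ one_lt_two (by omega)).trans hpi
        have expand : ∀ u : E, (2 : ℝ) ^ ((p : ℤ) + i + 1) < ‖u‖ →
            ∃ m : ℕ, (2 : ℝ) ^ ((m : ℤ) + p + i + 1) < ‖u‖ ∧
                ‖u‖ ≤ 2 ^ ((m : ℤ) + p + i + 1 + 1) := by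
          intro u hu
          obtain ⟨j, hj1, hj2⟩ := exists_mem_annulus (r := ‖u‖) (lt_trans (by positivity) hu)
          have : (p : ℤ) + i + 1 < j + 1 :=
            (zpow_lt_zpow_iff_right₀ (one_lt_two (α := ℝ))).1 (hu.trans_le hj2)
          refine ⟨(j - p - i - 1).toNat, ?_⟩
          rw [Int.toNat_of_nonneg (by omega)]
          ring_nf at hj1 hj2 ⊢
          exact ⟨hj1, hj2⟩
        obtain ⟨m₁, hm₁⟩ := expand _ hbig
        obtain ⟨m₂, hm₂⟩ := expand _ hbig'
        by_cases hm : m₁ = m₂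
        · subst hm
          refine le_trans ?_ (ENNReal.le_tsum m₁)
          rw [piece_eq_self hm₁, piece_eq_self hm₂]
        · refine le_trans ?_ (ENNReal.sum_le_tsum {m₁, m₂})
          rw [Finset.sum_pair hm, piece_eq_self hm₁, piece_eq_self hm₂,
            piece_eq_zero_of_ne (j := (m₁ : ℤ) + p + i + 1) (by omega) hm₂,
            piece_eq_zero_of_ne (j := (m₂ : ℤ) + p + i + 1) (by omega) hm₁]
          simpa using enorm_sub_le (a := K (x - y)) (b := K x)
    _ ≤ ∫⁻ x, ∑' m : ℕ, ‖piece K (m + p + i + 1) (x - y) - piece K (m + p + i + 1) x‖ₑ :=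
        setLIntegral_le_lintegral _ _
    _ = ∑' m : ℕ, shiftDiff (piece K (m + p + i + 1)) y := by
        rw [lintegral_tsum]
        · rfl
        · intro m
          exact ((((hK.measurable_piece _).comp (measurable_id.sub_const y)).sub
            (hK.measurable_piece _)).enorm).aemeasurable
    _ ≤ diniTail K p := by
        refine ENNReal.tsum_le_tsum fun m => hK.shiftDiff_piece_le _ _ ?_
        convert hi2 using 2
        push_cast; ring

lemma DiniKernel.lintegral_annulus_lt_top {K : E → ℝ} (hK : DiniKernel K) {a : ℝ} (ha : 0 < a)
    (b : ℝ) : ∫⁻ x in annulus E a b, ‖K x‖ₑ < ∞ := by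
  obtain ⟨i, hi1, hi2⟩ := exists_mem_annulus ha
  obtain ⟨N, hN⟩ := pow_unbounded_of_one_lt (b / 2 ^ i) one_lt_two
  have hsub : annulus E a b ⊆
      ⋃ m ∈ Finset.range N, annulus E ((2 : ℝ) ^ (i + m)) (2 ^ (i + m + 1)) := by
    intro x hx
    obtain ⟨j, hj1, hj2⟩ := exists_mem_annulus (ha.trans hx.1)
    have h1 : i < j + 1 := (zpow_lt_zpow_iff_right₀ (one_lt_two (α := ℝ))).1
      (hi1.trans (hx.1.trans_le hj2))
    have h2 : j < i + N := by
      apply (zpow_lt_zpow_iff_right₀ (one_lt_two (α := ℝ))).1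
      rw [zpow_add₀ two_ne_zero, zpow_natCast]
      rw [div_lt_iff₀ (by positivity)] at hN
      linarith [hx.2]
    simp only [mem_iUnion, Finset.mem_range]
    refine ⟨(j - i).toNat, by omega, ?_⟩
    rw [Int.toNat_of_nonneg (by omega)]
    ring_nf
    ring_nf at hj2
    exact ⟨hj1, hj2⟩
  have hint : IntegrableOn K
      (⋃ m ∈ Finset.range N, annulus E ((2 : ℝ) ^ (i + m)) (2 ^ (i + m + 1))) := by
    refine integrableOn_finset_iUnion.2 fun m _ => ?_
    have := hK.integrable_piece (i + m)
    unfold piece at this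
    rwa [integrable_indicator_iff (measurableSet_annulus _ _)] at this
  have := (hint.mono_set hsub).2
  rwa [hasFiniteIntegral_iff_enorm] at this

lemma DiniKernel.integrableOn_annulus {K : E → ℝ} (hK : DiniKernel K) {a : ℝ} (ha : 0 < a)
    (b : ℝ) : IntegrableOn K (annulus E a b) :=
  ⟨hK.measurable.aestronglyMeasurable, by
    rw [hasFiniteIntegral_iff_enorm]; exact hK.lintegral_annulus_lt_top ha b⟩

lemma DiniKernel.lintegral_translate_le {K : E → ℝ} (hK : DiniKernel K) {ε ρ : ℝ}
    (hρ : 0 < ρ) (y : E) :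
    ∫⁻ x in Metric.ball 0 ρ, {x : E | ε < ‖x - y‖}.indicator (fun x => ‖K (x - y)‖ₑ) x ≤
      (∫⁻ x in annulus E (1 / 4) 2, ‖K x‖ₑ) + ∫⁻ x in annulus E ε (3 * ρ), ‖K x‖ₑ := by
  have trans : ∀ a b : ℝ, ∫⁻ x, (annulus E a b).indicator (fun x => ‖K x‖ₑ) (x - y) =
      ∫⁻ x in annulus E a b, ‖K x‖ₑ := by
    intro a b
    rw [lintegral_sub_right_eq_self (fun x => (annulus E a b).indicator (fun x => ‖K x‖ₑ) x) y,
      lintegral_indicator (measurableSet_annulus _ _)]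
  rcases le_or_gt (2 * ρ) ‖y‖ with h | h
  · refine le_trans ?_ le_self_add
    have hy : 0 < ‖y‖ := by linarith
    have h1 := hK.lintegral_annulus_scale (1 / 4) 2 hy
    rw [← h1, ← trans, ← lintegral_indicator Metric.isOpen_ball.measurableSet]
    refine lintegral_mono fun x => ?_
    by_cases hx : x ∈ Metric.ball (0 : E) ρ
    · rw [indicator_of_mem hx]
      rw [mem_ball_zero_iff] at hx
      have h3 : ‖x - y‖ ≤ ‖x‖ + ‖y‖ := norm_sub_le x y
      have h4 : ‖y‖ - ‖x‖ ≤ ‖x - y‖ := by rw [norm_sub_rev]; exact norm_sub_norm_le y x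
      have : x - y ∈ annulus E (‖y‖ * (1 / 4)) (‖y‖ * 2) := ⟨by linarith, by linarith⟩
      rw [indicator_of_mem this]
      exact indicator_le_self' (fun _ _ => zero_le) x
    · rw [indicator_of_notMem hx]; exact zero_le
  · refine le_trans ?_ le_add_self
    rw [← trans, ← lintegral_indicator Metric.isOpen_ball.measurableSet]
    refine lintegral_mono fun x => ?_
    by_cases hx : x ∈ Metric.ball (0 : E) ρ
    · rw [indicator_of_mem hx]
      rw [mem_ball_zero_iff] at hx
      have h3 : ‖x - y‖ ≤ ‖x‖ + ‖y‖ := norm_sub_le x y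
      by_cases hx2 : ε < ‖x - y‖
      · have : x - y ∈ annulus E ε (3 * ρ) := ⟨hx2, by linarith⟩
        rw [indicator_of_mem this]
        exact indicator_le_self' (fun _ _ => zero_le) x
      · rw [indicator_of_notMem (s := {x : E | ε < ‖x - y‖}) hx2]; exact zero_le
    · rw [indicator_of_notMem hx]; exact zero_le

lemma measurableSet_dist_gt (x : E) (ε : ℝ) : MeasurableSet {y : E | ε < ‖x - y‖} :=
  measurableSet_lt measurable_const (measurable_id.const_sub x).norm

/-- The truncated integrals of an integrable function converge absolutely almost everywhere. -/
lemma DiniKernel.ae_integrableOn {K : E → ℝ} (hK : DiniKernel K) {f : E → ℝ}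
    (hf : Integrable f) (hfm : Measurable f) :
    ∀ᵐ x, ∀ ε > 0, IntegrableOn (fun y => K (x - y) * f y) {y | ε < ‖x - y‖} := by
  have main : ∀ m k : ℕ, ∀ᵐ x : E, x ∈ Metric.ball (0 : E) (k + 1) →
      IntegrableOn (fun y => K (x - y) * f y) {y | 1 / ((m : ℝ) + 1) < ‖x - y‖} := by
    intro m k
    set ε : ℝ := 1 / ((m : ℝ) + 1) with hε
    have hεpos : 0 < ε := by positivity
    set S : Set (E × E) := {q | ε < ‖q.1 - q.2‖} with hS
    have hSm : MeasurableSet S :=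
      measurableSet_lt measurable_const (measurable_fst.sub measurable_snd).norm
    set G : E × E → ℝ≥0∞ := fun q => S.indicator (fun q => ‖K (q.1 - q.2)‖ₑ) q * ‖f q.2‖ₑ with hG
    have hGm : Measurable G :=
      ((hK.measurable.comp (measurable_fst.sub measurable_snd)).enorm.indicator hSm).mul
        (hfm.comp measurable_snd).enorm
    have hfin : ∫⁻ x in Metric.ball (0 : E) (k + 1), ∫⁻ y, G (x, y) < ∞ := by
      rw [lintegral_lintegral_swap hGm.aemeasurable]
      have hpos : (0 : ℝ) < k + 1 := by positivity
      calc ∫⁻ y, ∫⁻ x in Metric.ball (0 : E) (k + 1), G (x, y)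
          ≤ ∫⁻ y, ((∫⁻ x in annulus E (1 / 4) 2, ‖K x‖ₑ) +
              ∫⁻ x in annulus E ε (3 * (k + 1)), ‖K x‖ₑ) * ‖f y‖ₑ := by
            refine lintegral_mono fun y => ?_
            simp only [hG]
            rw [lintegral_mul_const' _ _ enorm_ne_top]
            gcongr
            exact hK.lintegral_translate_le hpos y
        _ = ((∫⁻ x in annulus E (1 / 4) 2, ‖K x‖ₑ) +
              ∫⁻ x in annulus E ε (3 * (k + 1)), ‖K x‖ₑ) * ∫⁻ y, ‖f y‖ₑ :=
            lintegral_const_mul _ hfm.enorm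
        _ < ∞ := ENNReal.mul_lt_top (ENNReal.add_lt_top.2
            ⟨hK.lintegral_annulus_lt_top (by norm_num) _, hK.lintegral_annulus_lt_top hεpos _⟩) hf.2
    have := ae_lt_top hGm.lintegral_prod_right' hfin.ne
    rw [ae_restrict_iff' Metric.isOpen_ball.measurableSet] at this
    filter_upwards [this] with x hx hxb
    refine ⟨((hK.measurable.comp (measurable_id.const_sub x)).mul hfm).aestronglyMeasurable, ?_⟩
    rw [hasFiniteIntegral_iff_enorm, ← lintegral_indicator (measurableSet_dist_gt _ _)]
    refine lt_of_le_of_lt (lintegral_mono fun y => ?_) (hx hxb)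
    by_cases hy : ε < ‖x - y‖
    · rw [indicator_of_mem (show y ∈ {y : E | ε < ‖x - y‖} from hy)]
      simp only [hG]
      rw [indicator_of_mem (show (x, y) ∈ S from hy), enorm_mul]
    · rw [indicator_of_notMem (show y ∉ {y : E | ε < ‖x - y‖} from hy)]; exact zero_le
  have main3 := ae_all_iff.2 fun m => ae_all_iff.2 (main m)
  filter_upwards [main3] with x hx ε hε
  obtain ⟨m, hm⟩ := exists_nat_one_div_lt hε
  obtain ⟨k, hk⟩ := exists_nat_gt ‖x‖
  refine (hx m k ?_).mono_set fun y hy => hm.trans hy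
  rw [mem_ball_zero_iff]; linarith

end DiniKernels

section Plancherel

open scoped FourierTransform SchwartzMap ContDiff

variable {E : Type*} [NormedAddCommGroup E] [InnerProductSpace ℝ E] [FiniteDimensional ℝ E]
  [MeasurableSpace E] [BorelSpace E]

lemma continuous_fourier {u : E → ℂ} (hu : Integrable u) : Continuous (𝓕 u) :=
  VectorFourier.fourierIntegral_continuous Real.continuous_fourierChar
    (innerSL ℝ).continuous₂ hu

lemma fourier_toLp_ae_eq {u : E → ℂ} (hu : Integrable u) (h2 : MemLp u 2) :
    (𝓕 h2.toLp : Lp (α := E) ℂ 2) =ᵐ[volume] 𝓕 u := by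
  apply ae_eq_of_integral_contDiff_smul_eq
  · exact (Lp.memLp _).locallyIntegrable (by norm_num)
  · exact (continuous_fourier hu).locallyIntegrable
  · intro g g_smooth g_cpt
    have hg₁ : HasCompactSupport (Complex.ofRealCLM ∘ g) := g_cpt.comp_left rfl
    have hg₂ : ContDiff ℝ ∞ (Complex.ofRealCLM ∘ g) := by fun_prop
    set φ : 𝓢(E, ℂ) := hg₁.toSchwartzMap hg₂ with hφ
    have h1 := DFunLike.congr_fun (Lp.fourier_toTemperedDistribution_eq (h2.toLp)) φ
    rw [TemperedDistribution.fourier_apply, Lp.toTemperedDistribution_apply,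
      Lp.toTemperedDistribution_apply] at h1
    have h3 : ∫ x, (𝓕 φ) x • (h2.toLp : E → ℂ) x = ∫ x, φ x • 𝓕 u x := by
      have : ∫ x, (𝓕 φ) x • (h2.toLp : E → ℂ) x = ∫ x, (𝓕 (φ : E → ℂ)) x • u x := by
        apply integral_congr_ae
        filter_upwards [h2.coeFn_toLp] with x hx
        rw [hx, SchwartzMap.fourier_coe]
      rw [this]
      have := VectorFourier.integral_fourierIntegral_smul_eq_flip (μ := (volume : Measure E))
        (ν := (volume : Measure E)) (L := innerₗ E) (f := (φ : E → ℂ)) (g := u)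
        Real.continuous_fourierChar continuous_inner φ.integrable hu
      rw [flip_innerₗ] at this
      exact this
    rw [h3] at h1
    have e : ∀ x, φ x = (g x : ℂ) := fun x => rfl
    simp only [e] at h1
    simpa using h1.symm

lemma eLpNorm_fourier {u : E → ℂ} (hu : Integrable u) (h2 : MemLp u 2) :
    eLpNorm (𝓕 u) 2 volume = eLpNorm u 2 volume := by
  rw [← eLpNorm_congr_ae (fourier_toLp_ae_eq hu h2), ← eLpNorm_congr_ae h2.coeFn_toLp,
    ← Lp.enorm_def, ← Lp.enorm_def]
  have := Lp.norm_fourier_eq h2.toLp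
  rw [← ofReal_norm, ← ofReal_norm, this]

end Plancherel

section Multiplier

open scoped FourierTransform RealInnerProductSpace Convolution

variable {E : Type*} [NormedAddCommGroup E] [InnerProductSpace ℝ E] [FiniteDimensional ℝ E]
  [MeasurableSpace E] [BorelSpace E]

lemma enorm_fourier_le_shiftDiff {k : E → ℝ} (hk : Integrable k) {ξ : E} (hξ : ξ ≠ 0) :
    ‖𝓕 (fun x => (k x : ℂ)) ξ‖ₑ ≤ shiftDiff k (-((1 / (2 * ‖ξ‖ ^ 2) : ℝ) • ξ)) := by
  rw [Real.fourier_eq, fourierIntegral_eq_half_sub_half_period_translate hξ hk.ofReal]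
  rw [enorm_smul]
  have h2 : ‖(1 / (2 : ℂ))‖ₑ ≤ 1 := by
    rw [← ofReal_norm, ← ENNReal.ofReal_one]
    exact ENNReal.ofReal_le_ofReal (by norm_num)
  calc _ ≤ 1 * ∫⁻ v : E, ‖k (v - -((1 / (2 * ‖ξ‖ ^ 2) : ℝ) • ξ)) - k v‖ₑ := by
        gcongr
        refine (enorm_integral_le_lintegral_enorm _).trans_eq ?_
        congr 1; ext v
        rw [sub_neg_eq_add, ← ofReal_norm, Circle.norm_smul, ← Complex.ofReal_sub,
          Complex.norm_real, ofReal_norm, enorm_sub_rev]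
    _ = _ := by rw [one_mul]; rfl

lemma enorm_fourier_le_of_integral_eq_zero {k : E → ℝ} (hk : Integrable k) (h0 : ∫ x, k x = 0)
    {R : ℝ} (hR : ∀ x, k x ≠ 0 → ‖x‖ ≤ R) (ξ : E) :
    ‖𝓕 (fun x => (k x : ℂ)) ξ‖ₑ ≤ ENNReal.ofReal (2 * Real.pi * R * ‖ξ‖) * ∫⁻ x, ‖k x‖ₑ := by
  have hc : ∫ x, ((k x : ℂ)) = 0 := by rw [integral_complex_ofReal, h0]; simp
  have : 𝓕 (fun x => (k x : ℂ)) ξ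
      = ∫ v, (Real.fourierChar (-⟪v, ξ⟫) • (k v : ℂ) - (k v : ℂ)) := by
    rw [integral_sub _ hk.ofReal]
    · rw [Real.fourier_eq]; erw [hc]; simp
    · exact (Real.fourierIntegral_convergent_iff ξ).2 hk.ofReal
  rw [this]
  refine (enorm_integral_le_lintegral_enorm _).trans ?_
  rw [← lintegral_const_mul' _ _ ENNReal.ofReal_ne_top]
  refine lintegral_mono fun v => ?_
  by_cases hv : k v = 0
  · simp [hv]
  have hb : ‖(Real.fourierChar (-⟪v, ξ⟫) : ℂ) - 1‖ ≤ 2 * Real.pi * R * ‖ξ‖ := by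
    rw [Real.fourierChar_apply]
    have e : (((2 * Real.pi * -⟪v, ξ⟫ : ℝ) : ℂ) * Complex.I)
        = Complex.I * ((2 * Real.pi * -⟪v, ξ⟫ : ℝ) : ℂ) := by ring
    rw [e]
    refine (Real.norm_exp_I_mul_ofReal_sub_one_le).trans ?_
    rw [Real.norm_eq_abs, abs_mul, abs_neg, abs_of_pos Real.two_pi_pos, mul_assoc _ R]
    gcongr
    exact (abs_real_inner_le_norm _ _).trans (by gcongr; exact hR v hv)
  have e2 : Real.fourierChar (-⟪v, ξ⟫) • (k v : ℂ) - (k v : ℂ)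
      = ((Real.fourierChar (-⟪v, ξ⟫) : ℂ) - 1) * (k v : ℂ) := by
    rw [Circle.smul_def, smul_eq_mul]; ring
  rw [e2, enorm_mul]
  gcongr
  · rw [← ofReal_norm]; exact ENNReal.ofReal_le_ofReal hb
  · rw [← ofReal_norm, Complex.norm_real, ofReal_norm]

/-- A bound for the Fourier multiplier of a Dini kernel. -/
def multBound (K : E → ℝ) : ℝ≥0∞ :=
  diniTail K 0 + ENNReal.ofReal (8 * Real.pi) * ∫⁻ x, ‖piece K 0 x‖ₑ

lemma DiniKernel.multBound_lt_top {K : E → ℝ} (hK : DiniKernel K) : multBound K < ∞ := by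
  unfold multBound
  refine ENNReal.add_lt_top.2 ⟨hK.diniTail_lt_top 0, ENNReal.mul_lt_top ENNReal.ofReal_lt_top ?_⟩
  exact hK.integrable.2

lemma piece_ne_zero {K : E → ℝ} {j : ℤ} {x : E} (h : piece K j x ≠ 0) :
    (2 : ℝ) ^ j < ‖x‖ ∧ ‖x‖ ≤ 2 ^ (j + 1) := by
  by_contra hx
  exact h (indicator_of_notMem (s := annulus E (2 ^ j) (2 ^ (j + 1))) hx _)

lemma DiniKernel.tsum_enorm_fourier_le {K : E → ℝ} (hK : DiniKernel K) {ξ : E} (hξ : ξ ≠ 0) :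
    ∑' j : ℤ, ‖𝓕 (fun x => (piece K j x : ℂ)) ξ‖ₑ ≤ multBound K := by
  obtain ⟨i, hi1, hi2⟩ := exists_mem_annulus (norm_pos_iff.2 hξ)
  set F : ℤ → ℝ≥0∞ := fun j => ‖𝓕 (fun x => (piece K j x : ℂ)) ξ‖ₑ with hF
  have h1 : ∀ m : ℕ, F (m - i) ≤ modulus K m := by
    intro m
    refine (enorm_fourier_le_shiftDiff (hK.integrable_piece _) hξ).trans ?_
    apply hK.shiftDiff_piece_le
    rw [norm_neg, norm_smul, Real.norm_of_nonneg (by positivity)]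
    have : (m : ℤ) - i - m = -i := by ring
    rw [this, zpow_neg]
    have hp : (0 : ℝ) < 2 ^ i := by positivity
    have hq : 0 < ‖ξ‖ := norm_pos_iff.2 hξ
    have : 1 / (2 * ‖ξ‖ ^ 2) * ‖ξ‖ = (2 * ‖ξ‖)⁻¹ := by field_simp
    rw [this]
    gcongr
    linarith
  have h2 : ∀ m : ℕ, F (-(m + 1 : ℤ) - i) ≤
      ENNReal.ofReal (8 * Real.pi) * (∫⁻ x, ‖piece K 0 x‖ₑ) * (2⁻¹ : ℝ≥0∞) ^ (m + 1) := by
    intro m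
    refine (enorm_fourier_le_of_integral_eq_zero (hK.integrable_piece _) (hK.integral_piece _)
      (R := 2 ^ ((-(m + 1 : ℤ) - i) + 1)) (fun x hx => (piece_ne_zero hx).2) ξ).trans ?_
    rw [hK.lintegral_piece, mul_right_comm (ENNReal.ofReal (8 * Real.pi))]
    refine mul_le_mul_left ?_ _
    rw [← ENNReal.ofReal_ofNat, ← ENNReal.ofReal_inv_of_pos (by norm_num),
      ← ENNReal.ofReal_pow (by positivity), ← ENNReal.ofReal_mul (by positivity)]
    apply ENNReal.ofReal_le_ofReal
    calc 2 * Real.pi * 2 ^ ((-(m + 1 : ℤ) - i) + 1) * ‖ξ‖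
        ≤ 2 * Real.pi * 2 ^ ((-(m + 1 : ℤ) - i) + 1) * 2 ^ (i + 1) := by gcongr
      _ = 8 * Real.pi * (2 ^ (-(m + 1 : ℤ)) : ℝ) := by
        rw [mul_assoc (2 * Real.pi), ← zpow_add₀ (by norm_num)]
        have : (-(m + 1 : ℤ) - i) + 1 + (i + 1) = -(m + 1 : ℤ) + 2 := by ring
        rw [this, zpow_add₀ (by norm_num)]; norm_num; ring
      _ = _ := by rw [zpow_neg, inv_pow]; norm_cast
  rw [← (Equiv.subRight i).tsum_eq F]
  simp only [Equiv.subRight_apply]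
  rw [tsum_of_nat_of_neg_add_one ENNReal.summable ENNReal.summable]
  unfold multBound diniTail
  gcongr with m
  · exact h1 m
  · refine (ENNReal.tsum_le_tsum h2).trans ?_
    rw [ENNReal.tsum_mul_left]
    have : ∑' m : ℕ, (2⁻¹ : ℝ≥0∞) ^ (m + 1) = 1 := by
      simp_rw [pow_succ]
      rw [ENNReal.tsum_mul_right, ENNReal.tsum_geometric]
      rw [ENNReal.one_sub_inv_two, inv_inv]
      exact ENNReal.mul_inv_cancel (by norm_num) (by norm_num)
    rw [this, mul_one]

/-- The kernel truncated to the annulus `2 ^ k < ‖x‖ ≤ 2 ^ N`. -/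
def shell (K : E → ℝ) (k N : ℤ) : E → ℝ := (annulus E (2 ^ k) (2 ^ N)).indicator K

lemma shell_eq_sum (K : E → ℝ) (k N : ℤ) (x : E) :
    shell K k N x = ∑ j ∈ Finset.Ico k N, piece K j x := by
  rcases eq_or_ne x 0 with rfl | hx
  · have h1 : shell K k N 0 = 0 := by
      apply indicator_of_notMem
      intro h
      have := h.1
      rw [norm_zero] at this
      exact absurd this (not_lt.2 (by positivity))
    rw [h1, Finset.sum_eq_zero]
    intro j _
    by_contra h
    have := (piece_ne_zero h).1
    rw [norm_zero] at this
    exact absurd this (not_lt.2 (by positivity))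
  obtain ⟨i, hi1, hi2⟩ := exists_mem_annulus (norm_pos_iff.2 hx)
  have hs : ∀ j, j ≠ i → piece K j x = 0 := by
    intro j hj
    by_contra h
    obtain ⟨h1, h2⟩ := piece_ne_zero h
    have a1 : i < j + 1 := (zpow_lt_zpow_iff_right₀ (by norm_num : (1 : ℝ) < 2)).1 (hi1.trans_le h2)
    have a2 : j < i + 1 := (zpow_lt_zpow_iff_right₀ (by norm_num : (1 : ℝ) < 2)).1 (h1.trans_le hi2)
    omega
  have hi : piece K i x = K x :=
      indicator_of_mem (s := annulus E (2 ^ i) (2 ^ (i + 1))) ⟨hi1, hi2⟩ _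
  by_cases hm : i ∈ Finset.Ico k N
  · rw [Finset.sum_eq_single i (fun j _ hj => hs j hj) (fun h => absurd hm h), hi]
    apply indicator_of_mem
    rw [Finset.mem_Ico] at hm
    exact ⟨lt_of_le_of_lt (zpow_le_zpow_right₀ (by norm_num) hm.1) hi1,
      hi2.trans (zpow_le_zpow_right₀ (by norm_num) (by omega))⟩
  · rw [Finset.sum_eq_zero (fun j hj => hs j (fun h => hm (h ▸ hj)))]
    apply indicator_of_notMem
    rintro ⟨h1, h2⟩
    apply hm
    rw [Finset.mem_Ico]
    have a1 : k < i + 1 := (zpow_lt_zpow_iff_right₀ (by norm_num : (1 : ℝ) < 2)).1 (h1.trans_le hi2)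
    have a2 : i < N := (zpow_lt_zpow_iff_right₀ (by norm_num : (1 : ℝ) < 2)).1 (hi1.trans_le h2)
    omega

lemma DiniKernel.integrable_shell {K : E → ℝ} (hK : DiniKernel K) (k N : ℤ) :
    Integrable (shell K k N) := by
  have : shell K k N = fun x => ∑ j ∈ Finset.Ico k N, piece K j x := by
    ext x; exact shell_eq_sum K k N x
  rw [this]
  exact integrable_finsetSum _ fun j _ => hK.integrable_piece j

lemma DiniKernel.measurable_shell {K : E → ℝ} (hK : DiniKernel K) (k N : ℤ) :
    Measurable (shell K k N) := hK.measurable.indicator (measurableSet_annulus _ _)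

lemma DiniKernel.fourier_shell {K : E → ℝ} (hK : DiniKernel K) (k N : ℤ) (ξ : E) :
    𝓕 (fun x => (shell K k N x : ℂ)) ξ
      = ∑ j ∈ Finset.Ico k N, 𝓕 (fun x => (piece K j x : ℂ)) ξ := by
  simp_rw [Real.fourier_eq]
  rw [← integral_finsetSum]
  · congr 1; ext v
    rw [shell_eq_sum, Complex.ofReal_sum, Finset.smul_sum]
  · intro j _
    exact (Real.fourierIntegral_convergent_iff ξ).2 (hK.integrable_piece j).ofReal

lemma tendsto_Ico_neg_atTop : Tendsto (fun N : ℕ => Finset.Ico (-(N : ℤ)) N) atTop atTop := by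
  apply tendsto_atTop_finset_of_monotone
  · intro a b hab
    apply Finset.Ico_subset_Ico <;> simpa using hab
  · intro x
    refine ⟨x.natAbs + 1, ?_⟩
    simp only [Finset.mem_Ico]
    omega

lemma DiniKernel.exists_multiplier {K : E → ℝ} (hK : DiniKernel K) :
    ∃ m : E → ℂ, (∀ᵐ ξ : E, ‖m ξ‖ₑ ≤ multBound K) ∧
      (∀ᵐ ξ : E, ∀ k N, ‖𝓕 (fun x => (shell K k N x : ℂ)) ξ‖ₑ ≤ multBound K) ∧
      ∀ᵐ ξ : E, Tendsto (fun N : ℕ => 𝓕 (fun x => (shell K (-N) N x : ℂ)) ξ) atTop (𝓝 (m ξ)) := by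
  rcases subsingleton_or_nontrivial E with hE | hE
  · have hz : ∀ k N, shell K k N = 0 := by
      intro k N
      ext x
      apply indicator_of_notMem
      intro h
      have := h.1
      rw [Subsingleton.elim x 0, norm_zero] at this
      exact absurd this (not_lt.2 (by positivity))
    refine ⟨0, by simp, ?_, ?_⟩
    · refine ae_of_all _ fun ξ k N => ?_
      rw [hz]
      simp [Real.fourier_eq]
    · refine ae_of_all _ fun ξ => ?_
      simp_rw [hz]
      simp [Real.fourier_eq]
  have h0 : ∀ᵐ ξ : E, ξ ≠ 0 := by
    rw [ae_iff]; simp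
  have hle : ∀ ξ : E, ξ ≠ 0 → ∀ k N, ‖𝓕 (fun x => (shell K k N x : ℂ)) ξ‖ₑ ≤ multBound K := by
    intro ξ hξ k N
    rw [hK.fourier_shell]
    exact (enorm_sum_le _ _).trans ((ENNReal.sum_le_tsum _).trans (hK.tsum_enorm_fourier_le hξ))
  have ht : ∀ ξ : E, ξ ≠ 0 → Tendsto (fun N : ℕ => 𝓕 (fun x => (shell K (-N) N x : ℂ)) ξ) atTop
      (𝓝 (∑' j : ℤ, 𝓕 (fun x => (piece K j x : ℂ)) ξ)) := by
    intro ξ hξ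
    have hs : Summable fun j : ℤ => 𝓕 (fun x => (piece K j x : ℂ)) ξ := by
      apply Summable.of_norm
      rw [← summable_norm_iff]
      have := ENNReal.summable_toReal
        ((hK.tsum_enorm_fourier_le hξ).trans_lt hK.multBound_lt_top).ne
      simpa using this
    have := hs.hasSum.comp tendsto_Ico_neg_atTop
    refine this.congr fun N => ?_
    rw [hK.fourier_shell]; rfl
  refine ⟨fun ξ => ∑' j : ℤ, 𝓕 (fun x => (piece K j x : ℂ)) ξ, ?_, ?_, ?_⟩
  · filter_upwards [h0] with ξ hξ
    exact le_of_tendsto ((continuous_enorm.tendsto _).comp (ht ξ hξ))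
      (Eventually.of_forall fun N => hle ξ hξ _ _)
  · filter_upwards [h0] with ξ hξ using hle ξ hξ
  · filter_upwards [h0] with ξ hξ using ht ξ hξ

/-- Dominated convergence in `L²`. -/
lemma tendsto_eLpNorm_two_of_dominated {α : Type*} {mα : MeasurableSpace α} {μ : Measure α}
    {F : ℕ → α → ℂ} {G : α → ℂ} {b : α → ℝ≥0∞}
    (hF : ∀ N, AEStronglyMeasurable (F N) μ) (hG : AEStronglyMeasurable G μ)
    (hb : ∫⁻ x, b x ^ 2 ∂μ ≠ ∞)
    (hle : ∀ N, ∀ᵐ x ∂μ, ‖F N x‖ₑ ≤ b x)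
    (hlim : ∀ᵐ x ∂μ, Tendsto (fun N => F N x) atTop (𝓝 (G x))) :
    Tendsto (fun N => eLpNorm (fun x => F N x - G x) 2 μ) atTop (𝓝 0) := by
  have h2 : Tendsto (fun N => ∫⁻ x, ‖F N x - G x‖ₑ ^ 2 ∂μ) atTop (𝓝 (∫⁻ _, 0 ∂μ)) := by
    apply tendsto_lintegral_of_dominated_convergence' (fun x => (2 * b x) ^ 2)
    · intro N
      exact ((hF N).sub hG).enorm.pow_const _
    · intro N
      filter_upwards [ae_all_iff.2 hle, hlim] with x h1 h2
      have h3 : ‖G x‖ₑ ≤ b x :=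
        le_of_tendsto ((continuous_enorm.tendsto _).comp h2) (Eventually.of_forall h1)
      gcongr
      exact (enorm_sub_le).trans (by rw [two_mul]; exact add_le_add (h1 N) h3)
    · simp_rw [mul_pow]
      rw [lintegral_const_mul' _ _ (by norm_num)]
      exact ENNReal.mul_ne_top (by norm_num) hb
    · filter_upwards [hlim] with x h2
      have : Tendsto (fun N => F N x - G x) atTop (𝓝 (G x - G x)) := h2.sub_const _
      rw [sub_self] at this
      have h3 := ((ENNReal.continuous_pow 2).tendsto _).comp
          ((continuous_enorm.tendsto _).comp this)
      simpa [Function.comp_def] using h3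
  have h4 := ((ENNReal.continuous_rpow_const (y := 1 / 2)).tendsto _).comp h2
  simp only [lintegral_zero] at h4
  rw [ENNReal.zero_rpow_of_pos (by norm_num)] at h4
  refine h4.congr fun N => ?_
  rw [eLpNorm_eq_lintegral_rpow_enorm_toReal (by norm_num) (by norm_num)]
  simp

/-- Convolution with the kernel truncated to the annulus `2 ^ k < ‖x‖ ≤ 2 ^ N`. -/
def shellConv (K g : E → ℝ) (k N : ℤ) (x : E) : ℝ := ∫ z, shell K k N z * g (x - z)

lemma memLp_two_of_bound {F : Type*} [NormedAddCommGroup F] {u : E → F} (hu : Integrable u) {M : ℝ}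
    (hM : ∀ x, ‖u x‖ ≤ M) : MemLp u 2 := by
  rw [memLp_two_iff_integrable_sq_norm hu.1]
  refine (hu.norm.const_mul M).mono' (hu.1.norm.pow 2) (ae_of_all _ fun x => ?_)
  rw [norm_pow, norm_norm, sq]
  exact mul_le_mul_of_nonneg_right (hM x) (norm_nonneg _)

lemma DiniKernel.integrable_shell_mul {K : E → ℝ} (hK : DiniKernel K) {g : E → ℝ}
    (hgm : Measurable g) {M : ℝ} (hM : ∀ x, |g x| ≤ M) (k N : ℤ) (x : E) :
    Integrable (fun z => shell K k N z * g (x - z)) :=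
  (hK.integrable_shell k N).mul_bdd (c := M)
    ((hgm.comp (measurable_const.sub measurable_id)).aestronglyMeasurable)
    (ae_of_all _ fun _ => hM _)

lemma shellConv_ofReal (K g : E → ℝ) (k N : ℤ) (x : E) :
    ((fun x => (shell K k N x : ℂ)) ⋆[ContinuousLinearMap.mul ℂ ℂ] (fun x => (g x : ℂ))) x
      = (shellConv K g k N x : ℂ) := by
  rw [shellConv, convolution_def, ← integral_complex_ofReal]
  simp

theorem DiniKernel.exists_L2_limit {K : E → ℝ} (hK : DiniKernel K) {g : E → ℝ}
    (hg : Integrable g) {M : ℝ} (hM : ∀ x, |g x| ≤ M) :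
    ∃ h : E → ℝ, MemLp h 2 ∧ eLpNorm h 2 ≤ multBound K * eLpNorm g 2 ∧
      (∀ N : ℕ, MemLp (shellConv K g (-N) N) 2) ∧
      Tendsto (fun N : ℕ => eLpNorm (fun x => shellConv K g (-N) N x - h x) 2) atTop (𝓝 0) := by
  obtain ⟨m, hm1, hm2, hm3⟩ := hK.exists_multiplier
  set gc : E → ℂ := fun x => (g x : ℂ) with hgc
  have hgi : Integrable gc := hg.ofReal
  have hg2 : MemLp g 2 := memLp_two_of_bound hg (M := M) hM
  have hgc2 : MemLp gc 2 := hg2.ofReal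
  set G := 𝓕 gc with hG
  have hGc : Continuous G := continuous_fourier hgi
  have hGn : eLpNorm G 2 = eLpNorm gc 2 := eLpNorm_fourier hgi hgc2
  have hgcn : eLpNorm gc 2 = eLpNorm g 2 := by
    apply eLpNorm_congr_norm_ae
    exact ae_of_all _ fun x => by simp [hgc]
  set u : ℕ → E → ℂ := fun N x => (shellConv K g (-N) N x : ℂ) with hu
  have huc : ∀ N, u N = (fun x => (shell K (-N) N x : ℂ)) ⋆[ContinuousLinearMap.mul ℂ ℂ] gc := by
    intro N; ext x; exact (shellConv_ofReal K g _ _ x).symm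
  have hsi : ∀ N : ℕ, Integrable (fun x => (shell K (-N) N x : ℂ)) := fun N =>
    (hK.integrable_shell _ _).ofReal
  have hui : ∀ N, Integrable (u N) := by
    intro N
    rw [huc]
    exact (hsi N).integrable_convolution _ hgi
  have hub : ∀ N x, ‖u N x‖ ≤ (∫ z, ‖shell K (-N) N z‖) * M := by
    intro N x
    simp only [hu, Complex.norm_real, shellConv]
    rw [← integral_mul_const]
    refine norm_integral_le_of_norm_le ((hK.integrable_shell _ _).norm.mul_const _)
      (ae_of_all _ fun z => ?_)
    rw [norm_mul]
    exact mul_le_mul_of_nonneg_left (hM _) (norm_nonneg _)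
  have hu2 : ∀ N, MemLp (u N) 2 := fun N => memLp_two_of_bound (hui N) (hub N)
  have huF : ∀ N ξ, 𝓕 (u N) ξ = 𝓕 (fun x => (shell K (-N) N x : ℂ)) ξ * G ξ := by
    intro N ξ
    rw [huc]
    exact Real.fourier_mul_convolution_eq (hsi N) hgi ξ
  set w : E → ℂ := fun ξ => m ξ * G ξ with hw
  have hFm : ∀ N, AEStronglyMeasurable (𝓕 (u N)) volume := fun N =>
    (continuous_fourier (hui N)).aestronglyMeasurable
  have hlim : ∀ᵐ ξ, Tendsto (fun N => 𝓕 (u N) ξ) atTop (𝓝 (w ξ)) := by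
    filter_upwards [hm3] with ξ hξ
    simp_rw [huF]
    exact hξ.mul_const _
  have hwm : AEStronglyMeasurable w volume := aestronglyMeasurable_of_tendsto_ae _ hFm hlim
  have hGL : ∫⁻ ξ, ‖G ξ‖ₑ ^ 2 ≠ ∞ := by
    have := (hGn ▸ hgc2.2 : eLpNorm G 2 volume < ∞)
    rw [eLpNorm_lt_top_iff_lintegral_rpow_enorm_lt_top (by norm_num) (by norm_num)] at this
    simpa using this.ne
  have hwle : eLpNorm w 2 ≤ multBound K * eLpNorm g 2 := by
    rw [← hgcn, ← hGn]
    apply eLpNorm_le_mul_eLpNorm_of_ae_le_mul''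
    · exact hGc.aestronglyMeasurable
    filter_upwards [hm1] with ξ hξ
    rw [hw, enorm_mul]
    gcongr
  have hg2t : multBound K * eLpNorm g 2 < ∞ := ENNReal.mul_lt_top hK.multBound_lt_top hg2.2
  have hwL : MemLp w 2 := ⟨hwm, hwle.trans_lt hg2t⟩
  have hconv := tendsto_eLpNorm_two_of_dominated (b := fun ξ => multBound K * ‖G ξ‖ₑ) hFm hwm (by
      simp_rw [mul_pow]
      rw [lintegral_const_mul' _ _ (by simp [hK.multBound_lt_top.ne])]
      exact ENNReal.mul_ne_top (by simp [hK.multBound_lt_top.ne]) hGL) (by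
      intro N
      filter_upwards [hm2] with ξ hξ
      rw [huF, enorm_mul]
      gcongr
      exact hξ _ _) hlim
  set H : Lp (α := E) ℂ 2 := (Lp.fourierTransformₗᵢ E ℂ).symm hwL.toLp with hH
  have hFH : 𝓕 H = hwL.toLp := (Lp.fourierTransformₗᵢ E ℂ).apply_symm_apply _
  have hHn : eLpNorm (H : E → ℂ) 2 volume = eLpNorm w 2 volume := by
    rw [← eLpNorm_congr_ae hwL.coeFn_toLp, ← Lp.enorm_def, ← Lp.enorm_def, ← hFH]
    rw [← ofReal_norm, ← ofReal_norm, Lp.norm_fourier_eq]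
  have hdiff : ∀ N, eLpNorm (fun x => u N x - H x) 2 volume
      = eLpNorm (fun ξ => 𝓕 (u N) ξ - w ξ) 2 volume := by
    intro N
    have e1 : eLpNorm (fun x => u N x - H x) 2 volume = ‖(hu2 N).toLp - H‖ₑ := by
      rw [Lp.enorm_def]
      apply eLpNorm_congr_ae
      filter_upwards [Lp.coeFn_sub (hu2 N).toLp H, (hu2 N).coeFn_toLp] with x h1 h2
      rw [h1, Pi.sub_apply, h2]
    have e2 : eLpNorm (fun ξ => 𝓕 (u N) ξ - w ξ) 2 volume = ‖𝓕 (hu2 N).toLp - hwL.toLp‖ₑ := by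
      rw [Lp.enorm_def]
      apply eLpNorm_congr_ae
      filter_upwards [Lp.coeFn_sub (𝓕 (hu2 N).toLp) hwL.toLp, fourier_toLp_ae_eq (hui N) (hu2 N),
        hwL.coeFn_toLp] with x h1 h2 h3
      rw [h1, Pi.sub_apply, h2, h3]
    rw [e1, e2, ← hFH]
    have : 𝓕 (hu2 N).toLp - 𝓕 H = 𝓕 ((hu2 N).toLp - H) :=
      ((Lp.fourierTransformₗᵢ E ℂ).map_sub _ _).symm
    rw [this, ← ofReal_norm, ← ofReal_norm, Lp.norm_fourier_eq]
  have hHL : MemLp (H : E → ℂ) 2 := Lp.memLp H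
  refine ⟨fun x => (H x).re, hHL.re, ?_, ?_, ?_⟩
  · refine le_trans ?_ hwle
    rw [← hHn]
    exact eLpNorm_mono fun x => Complex.abs_re_le_norm _
  · intro N
    have := (hu2 N).re
    simpa [hu] using this
  · refine tendsto_of_tendsto_of_tendsto_of_le_of_le tendsto_const_nhds hconv (fun _ => zero_le) ?_
    intro N
    simp only
    rw [← hdiff]
    apply eLpNorm_mono
    intro x
    have : shellConv K g (-N) N x - (H x).re = (u N x - H x).re := by simp [hu]
    rw [this]
    exact Complex.abs_re_le_norm _

end Multiplier

section LebesguePoints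

variable {E : Type*} [NormedAddCommGroup E] [InnerProductSpace ℝ E] [FiniteDimensional ℝ E]
  [MeasurableSpace E] [BorelSpace E]

/-- `x` is a Lebesgue point of `g`. -/
def LebesguePoint (g : E → ℝ) (x : E) : Prop :=
  Tendsto (fun r : ℝ => ∫⁻ z in Metric.closedBall (0 : E) 1, ‖g (x - r • z) - g x‖ₑ)
    (𝓝[>] 0) (𝓝 0)

lemma setLIntegral_closedBall_scale (F : E → ℝ≥0∞) (x : E) {r : ℝ} (hr : 0 < r) :
    ∫⁻ y in Metric.closedBall x r, F y =
      ENNReal.ofReal (r ^ Module.finrank ℝ E) *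
        ∫⁻ z in Metric.closedBall (0 : E) 1, F (x - r • z) := by
  rw [← lintegral_indicator Metric.isClosed_closedBall.measurableSet,
    ← lintegral_indicator Metric.isClosed_closedBall.measurableSet,
    ← lintegral_sub_left_eq_self _ x, lintegral_comp_smul _ hr]
  congr 2 with z
  by_cases hz : z ∈ Metric.closedBall (0 : E) 1
  · rw [indicator_of_mem hz, indicator_of_mem]
    rw [mem_closedBall_zero_iff] at hz
    rw [Metric.mem_closedBall, dist_eq_norm, sub_sub_cancel_left, norm_neg, norm_smul,
      Real.norm_of_nonneg hr.le]
    nlinarith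
  · rw [indicator_of_notMem hz, indicator_of_notMem]
    rw [mem_closedBall_zero_iff] at hz
    rw [Metric.mem_closedBall, dist_eq_norm, sub_sub_cancel_left, norm_neg, norm_smul,
      Real.norm_of_nonneg hr.le]
    nlinarith

lemma volume_closedBall_eq (x : E) {r : ℝ} (hr : 0 < r) :
    volume (Metric.closedBall x r) = ENNReal.ofReal (r ^ Module.finrank ℝ E) *
      volume (Metric.closedBall (0 : E) 1) := by
  have := setLIntegral_closedBall_scale (fun _ => 1) x hr
  simpa using this

lemma ae_lebesguePoint {g : E → ℝ} (hg : LocallyIntegrable g) : ∀ᵐ x, LebesguePoint g x := by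
  filter_upwards [IsUnifLocDoublingMeasure.ae_tendsto_average_norm_sub (volume : Measure E) hg 1]
    with x hx
  have h1 := hx (l := 𝓝[>] (0 : ℝ)) (fun _ => x) (fun r => r) tendsto_id (by
    filter_upwards [self_mem_nhdsWithin] with r hr
    exact Metric.mem_closedBall_self (by rw [one_mul]; exact le_of_lt hr))
  set v := volume (Metric.closedBall (0 : E) 1) with hv
  have hvt : v ≠ ∞ := (isCompact_closedBall _ _).measure_lt_top.ne
  have hv0 : v ≠ 0 := (Metric.measure_closedBall_pos _ _ one_pos).ne'
  have h2 : Tendsto (fun r : ℝ => ENNReal.ofReal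
      ((⨍ y in Metric.closedBall x r, ‖g y - g x‖) * v.toReal)) (𝓝[>] 0) (𝓝 0) := by
    have := (ENNReal.continuous_ofReal.tendsto _).comp (h1.mul_const v.toReal)
    simpa [Function.comp_def] using this
  refine h2.congr' ?_
  filter_upwards [self_mem_nhdsWithin] with r hr
  have hr : 0 < r := hr
  have hint : IntegrableOn (fun y => g y - g x) (Metric.closedBall x r) :=
    ((hg.integrableOn_isCompact (isCompact_closedBall _ _))).sub
      (integrableOn_const (isCompact_closedBall _ _).measure_lt_top.ne)
  have e1 : ∫ y in Metric.closedBall x r, ‖g y - g x‖ =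
      (∫⁻ y in Metric.closedBall x r, ‖g y - g x‖ₑ).toReal := by
    rw [integral_norm_eq_lintegral_enorm hint.1]
  have hrd : 0 < r ^ Module.finrank ℝ E := by positivity
  have hfin : ∫⁻ z in Metric.closedBall (0 : E) 1, ‖g (x - r • z) - g x‖ₑ ≠ ∞ := by
    intro h
    have := hint.2
    rw [hasFiniteIntegral_iff_enorm, setLIntegral_closedBall_scale _ x hr, h,
      ENNReal.mul_top (by simpa using hrd)] at this
    exact lt_irrefl _ this
  rw [setAverage_eq, e1, setLIntegral_closedBall_scale _ x hr, Measure.real,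
    volume_closedBall_eq x hr, ENNReal.toReal_mul, ENNReal.toReal_mul, ENNReal.toReal_ofReal hrd.le,
    smul_eq_mul]
  have : v.toReal ≠ 0 := (ENNReal.toReal_pos hv0 hvt).ne'
  rw [← hv, show ∀ a b c : ℝ, a⁻¹ * b * c = b * (c * a⁻¹) by intros; ring]
  rw [mul_inv]
  convert ENNReal.ofReal_toReal hfin using 2
  field_simp

/-- At a Lebesgue point, averages against any integrable profile converge. -/
lemma LebesguePoint.tendsto {g : E → ℝ} {x : E} (hx : LebesguePoint g x) {M : ℝ}
    (hM : ∀ x, |g x| ≤ M) {J : E → ℝ≥0∞} (hJ : ∫⁻ z, J z ≠ ∞) (hJm : Measurable J) :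
    Tendsto (fun r : ℝ => ∫⁻ z, J z * ‖g (x - r • z) - g x‖ₑ) (𝓝[>] 0) (𝓝 0) := by
  set Cg : ℝ≥0∞ := ENNReal.ofReal (2 * M) with hCg
  have hbd : ∀ y, ‖g y - g x‖ₑ ≤ Cg := by
    intro y
    rw [← ofReal_norm]
    apply ENNReal.ofReal_le_ofReal
    rw [Real.norm_eq_abs]
    have := hM y; have := hM x
    calc _ ≤ |g y| + |g x| := abs_sub _ _
      _ ≤ _ := by linarith
  set S : ℕ → Set E := fun m => {z | J z ≤ m ∧ ‖z‖ ≤ m} with hS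
  have hSm : ∀ m, MeasurableSet (S m) := fun m =>
    (measurableSet_le hJm measurable_const).inter
      (measurableSet_le measurable_norm measurable_const)
  have hrem : Tendsto (fun m => ∫⁻ z in (S m)ᶜ, J z) atTop (𝓝 0) := by
    simp_rw [← lintegral_indicator (hSm _).compl]
    have : (0 : ℝ≥0∞) = ∫⁻ _ : E, 0 := by simp
    rw [this]
    apply tendsto_lintegral_of_dominated_convergence J
    · exact fun m => hJm.indicator (hSm m).compl
    · exact fun m => ae_of_all _ fun z => indicator_le_self _ _ _
    · exact hJ
    · filter_upwards [ae_lt_top hJm hJ] with z hz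
      apply tendsto_const_nhds.congr'
      obtain ⟨N1, hN1⟩ := ENNReal.exists_nat_gt hz.ne
      obtain ⟨N2, hN2⟩ := exists_nat_gt ‖z‖
      filter_upwards [eventually_ge_atTop (max N1 N2)] with m hm
      rw [indicator_of_notMem]
      rw [mem_compl_iff, not_not]
      have a1 : N1 ≤ m := (le_max_left _ _).trans hm
      have a2 : N2 ≤ m := (le_max_right _ _).trans hm
      exact ⟨hN1.le.trans (by exact_mod_cast a1), hN2.le.trans (by exact_mod_cast a2)⟩
  have hmain : ∀ m : ℕ, 0 < m → ∀ r : ℝ, 0 < r →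
      ∫⁻ z in S m, J z * ‖g (x - r • z) - g x‖ₑ ≤ (m : ℝ≥0∞) *
      (ENNReal.ofReal ((m : ℝ) ^ Module.finrank ℝ E) *
        ∫⁻ z in Metric.closedBall (0 : E) 1, ‖g (x - (m * r) • z) - g x‖ₑ) := by
    intro m hm r hr
    have hm' : (0 : ℝ) < m := by exact_mod_cast hm
    calc ∫⁻ z in S m, J z * ‖g (x - r • z) - g x‖ₑ
        ≤ ∫⁻ z in S m, (m : ℝ≥0∞) * ‖g (x - r • z) - g x‖ₑ := by
          refine setLIntegral_mono' (hSm m) fun z hz => ?_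
          gcongr
          exact hz.1
      _ = (m : ℝ≥0∞) * ∫⁻ z in S m, ‖g (x - r • z) - g x‖ₑ :=
          lintegral_const_mul' _ _ (by simp)
      _ ≤ (m : ℝ≥0∞) * ∫⁻ z in Metric.closedBall (0 : E) m, ‖g (x - r • z) - g x‖ₑ := by
          gcongr
          intro z hz
          rw [mem_closedBall_zero_iff]
          exact hz.2
      _ = _ := by
          rw [setLIntegral_closedBall_scale _ 0 hm']
          congr 2
          rw [← lintegral_indicator Metric.isClosed_closedBall.measurableSet,
            ← lintegral_indicator Metric.isClosed_closedBall.measurableSet,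
            ← lintegral_neg_eq_self]
          congr 1 with z
          by_cases hz : z ∈ Metric.closedBall (0 : E) 1
          · rw [indicator_of_mem hz, indicator_of_mem (by simpa using hz)]
            congr 3; module
          · rw [indicator_of_notMem hz, indicator_of_notMem (by simpa using hz)]
  rw [ENNReal.tendsto_nhds_zero]
  intro δ hδ
  have hδ2 : 0 < δ / 2 := ENNReal.half_pos hδ.ne'
  have hrem2 : Tendsto (fun m => Cg * ∫⁻ z in (S m)ᶜ, J z) atTop (𝓝 0) := by
    have := ENNReal.Tendsto.const_mul (a := Cg) hrem (Or.inr ENNReal.ofReal_ne_top)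
    simpa using this
  obtain ⟨m, hm1, hm2⟩ := ((ENNReal.tendsto_nhds_zero.1 hrem2 _ hδ2).and
    (eventually_gt_atTop 0)).exists
  have hm' : (0 : ℝ) < m := by exact_mod_cast hm2
  have hscale : Tendsto (fun r : ℝ => m * r) (𝓝[>] 0) (𝓝[>] 0) := by
    apply tendsto_nhdsWithin_of_tendsto_nhds_of_eventually_within
    · have : Tendsto (fun r : ℝ => m * r) (𝓝 0) (𝓝 (m * 0)) := tendsto_id.const_mul _
      rw [mul_zero] at this
      exact this.mono_left nhdsWithin_le_nhds
    · filter_upwards [self_mem_nhdsWithin] with r hr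
      exact mul_pos hm' hr
  have ht : Tendsto (fun r : ℝ => (m : ℝ≥0∞) *
      (ENNReal.ofReal ((m : ℝ) ^ Module.finrank ℝ E) *
        ∫⁻ z in Metric.closedBall (0 : E) 1, ‖g (x - (m * r) • z) - g x‖ₑ)) (𝓝[>] 0) (𝓝 0) := by
    have h1 := ENNReal.Tendsto.const_mul (a := ENNReal.ofReal ((m : ℝ) ^ Module.finrank ℝ E))
      (hx.comp hscale) (Or.inr ENNReal.ofReal_ne_top)
    have h2 := ENNReal.Tendsto.const_mul (a := (m : ℝ≥0∞)) h1 (Or.inr (by simp))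
    simpa [Function.comp_def] using h2
  filter_upwards [ENNReal.tendsto_nhds_zero.1 ht _ hδ2, self_mem_nhdsWithin] with r hr1 hr2
  rw [← lintegral_add_compl _ (hSm m), ← ENNReal.add_halves δ]
  refine add_le_add ((hmain m hm2 r hr2).trans hr1) (le_trans ?_ hm1)
  rw [← lintegral_const_mul' _ _ ENNReal.ofReal_ne_top]
  refine lintegral_mono fun z => ?_
  rw [mul_comm]
  gcongr
  exact hbd _

variable (E) in
/-- The closed unit ball. -/
abbrev unitBall : Set E := Metric.closedBall (0 : E) 1

lemma add_pow_sub_sub_pow_le {s : ℝ} (h0 : 0 ≤ s) (h1 : s ≤ 1) (d : ℕ) :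
    (1 + s) ^ d - (1 - s) ^ d ≤ 4 ^ d * s := by
  induction d with
  | zero => simpa using h0
  | succ d ih =>
    have hp : (1 - s) ^ d ≤ 1 := pow_le_one₀ (by linarith) (by linarith)
    have hq : (1 : ℝ) ≤ 4 ^ d := one_le_pow₀ (by norm_num)
    have hr : (1 - s) ^ d ≤ (1 + s) ^ d := by gcongr; linarith
    calc (1 + s) ^ (d + 1) - (1 - s) ^ (d + 1)
        = (1 + s) * ((1 + s) ^ d - (1 - s) ^ d) + 2 * s * (1 - s) ^ d := by ring
      _ ≤ 2 * ((1 + s) ^ d - (1 - s) ^ d) + 2 * s * 1 := by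
        gcongr; linarith
      _ ≤ 2 * (4 ^ d * s) + 2 * s * 4 ^ d := by gcongr
      _ = _ := by ring

lemma volume_annulus_le {s : ℝ} (h0 : 0 < s) (h1 : s ≤ 1) :
    volume (annulus E (1 - s) (1 + s)) ≤
      ENNReal.ofReal (4 ^ Module.finrank ℝ E * s) * volume (unitBall E) := by
  have hvt : volume (unitBall E) ≠ ∞ := (isCompact_closedBall _ _).measure_lt_top.ne
  rcases eq_or_lt_of_le h1 with rfl | h1
  · calc volume (annulus E (1 - 1) (1 + 1)) ≤ volume (Metric.closedBall (0 : E) 2) := by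
          gcongr
          intro x hx
          rw [mem_closedBall_zero_iff]
          exact hx.2.trans (by norm_num)
      _ = ENNReal.ofReal (2 ^ Module.finrank ℝ E) * volume (unitBall E) :=
          volume_closedBall_eq _ (by norm_num)
      _ ≤ _ := by
          gcongr ENNReal.ofReal ?_ * _
          rw [mul_one]; gcongr; norm_num
  have e : annulus E (1 - s) (1 + s) =
      Metric.closedBall (0 : E) (1 + s) \ Metric.closedBall (0 : E) (1 - s) := by
    ext x; simp [annulus, and_comm]
  rw [e, measure_sdiff (Metric.closedBall_subset_closedBall (by linarith))
    Metric.isClosed_closedBall.measurableSet.nullMeasurableSet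
    (isCompact_closedBall _ _).measure_lt_top.ne,
    volume_closedBall_eq _ (by linarith), volume_closedBall_eq _ (by linarith : 0 < 1 - s),
    ← ENNReal.sub_mul (fun _ _ => hvt), ← ENNReal.ofReal_sub _ (pow_nonneg (by linarith) _)]
  gcongr
  exact add_pow_sub_sub_pow_le h0.le h1.le _

lemma shiftDiff_unitBall_le {y : E} (hy : ‖y‖ ≤ 1) :
    shiftDiff ((unitBall E).indicator (fun _ => (1 : ℝ))) y ≤
      ENNReal.ofReal (4 ^ Module.finrank ℝ E * ‖y‖) * volume (unitBall E) := by
  rcases eq_or_ne y 0 with rfl | hy0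
  · simp [shiftDiff]
  refine le_trans ?_ (volume_annulus_le (norm_pos_iff.2 hy0) hy)
  rw [← lintegral_indicator_one (measurableSet_annulus _ _)]
  refine lintegral_mono fun x => ?_
  have t1 : ‖x‖ ≤ ‖x - y‖ + ‖y‖ := by simpa using norm_add_le (x - y) y
  have t2 : ‖x - y‖ ≤ ‖x‖ + ‖y‖ := norm_sub_le x y
  by_cases hx : x ∈ annulus E (1 - ‖y‖) (1 + ‖y‖)
  · rw [indicator_of_mem hx]
    simp only [Pi.one_apply]
    by_cases h1 : x ∈ unitBall E <;> by_cases h2 : x - y ∈ unitBall E <;>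
      simp [h1, h2, indicator_of_mem, indicator_of_notMem]
  · rw [indicator_of_notMem hx]
    by_cases h1 : x ∈ unitBall E <;> by_cases h2 : x - y ∈ unitBall E
    · simp [h1, h2, indicator_of_mem]
    · exfalso; apply hx
      rw [mem_closedBall_zero_iff] at h1 h2
      constructor <;> linarith
    · exfalso; apply hx
      rw [mem_closedBall_zero_iff] at h1 h2
      constructor <;> linarith
    · simp [h1, h2, indicator_of_notMem]

/-- The contribution of one dyadic piece to the difference between the mollified kernel and
the truncated kernel. -/
def pieceGap (K : E → ℝ) (j : ℤ) (z : E) : ℝ :=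
  ∫ t in unitBall E, (piece K j (z - t) - if 0 ≤ j then piece K j z else 0)

/-- Majorant of the difference between the mollified kernel and the truncated kernel. -/
def gapMajorant (K : E → ℝ) (z : E) : ℝ≥0∞ := ∑' j : ℤ, ‖pieceGap K j z‖ₑ

lemma DiniKernel.measurable_pieceGap {K : E → ℝ} (hK : DiniKernel K) (j : ℤ) :
    Measurable (pieceGap K j) := by
  apply StronglyMeasurable.measurable
  apply StronglyMeasurable.integral_prod_right (f := fun z t : E =>
    piece K j (z - t) - if 0 ≤ j then piece K j z else 0)
  apply Measurable.stronglyMeasurable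
  have := hK.measurable_piece j
  split_ifs <;> simp only [Function.uncurry_def] <;> fun_prop

lemma DiniKernel.measurable_gapMajorant {K : E → ℝ} (hK : DiniKernel K) :
    Measurable (gapMajorant K) :=
  Measurable.tsum fun j => (hK.measurable_pieceGap j).enorm

lemma DiniKernel.lintegral_pieceGap_nonneg {K : E → ℝ} (hK : DiniKernel K) (m : ℕ) :
    ∫⁻ z, ‖pieceGap K m z‖ₑ ≤ volume (unitBall E) * modulus K m := by
  have hm := hK.measurable_piece m
  calc ∫⁻ z, ‖pieceGap K m z‖ₑ
      ≤ ∫⁻ z, ∫⁻ t in unitBall E, ‖piece K m (z - t) - piece K m z‖ₑ := by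
        refine lintegral_mono fun z => ?_
        refine (enorm_integral_le_lintegral_enorm _).trans_eq ?_
        simp
    _ = ∫⁻ t in unitBall E, shiftDiff (piece K m) t := by
        rw [lintegral_lintegral_swap]
        · rfl
        · apply Measurable.aemeasurable
          simp only [Function.uncurry_def]
          fun_prop
    _ ≤ ∫⁻ t in unitBall E, modulus K m := by
        refine setLIntegral_mono' Metric.isClosed_closedBall.measurableSet fun t ht => ?_
        apply hK.shiftDiff_piece_le
        rw [mem_closedBall_zero_iff] at ht
        simpa using ht
    _ = _ := by simp [mul_comm]

lemma DiniKernel.lintegral_pieceGap_neg {K : E → ℝ} (hK : DiniKernel K) (m : ℕ) :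
    ∫⁻ z, ‖pieceGap K (-(m + 1 : ℤ)) z‖ₑ ≤
      ENNReal.ofReal (4 ^ Module.finrank ℝ E) * volume (unitBall E) *
        (∫⁻ x, ‖piece K 0 x‖ₑ) * (2⁻¹ : ℝ≥0∞) ^ m := by
  set k := piece K (-(m + 1 : ℤ)) with hk
  set χ := (unitBall E).indicator (fun _ => (1 : ℝ)) with hχ
  have hkm : Measurable k := hK.measurable_piece _
  have hki : Integrable k := hK.integrable_piece _
  have hχm : Measurable χ := measurable_const.indicator Metric.isClosed_closedBall.measurableSet
  have hχb : ∀ x, ‖χ x‖ ≤ 1 := by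
    intro x
    by_cases h : x ∈ unitBall E <;> simp [hχ, h, indicator_of_mem, indicator_of_notMem]
  have e : ∀ z, pieceGap K (-(m + 1 : ℤ)) z = ∫ y, k y * (χ (z - y) - χ z) := by
    intro z
    have hneg : ¬ (0 : ℤ) ≤ -(m + 1 : ℤ) := by omega
    have i1 : Integrable (fun y => k y * χ (z - y)) :=
      hki.mul_bdd (c := 1) ((hχm.comp (measurable_const.sub measurable_id)).aestronglyMeasurable)
        (ae_of_all _ fun _ => hχb _)
    simp_rw [mul_sub]
    rw [integral_sub i1 (hki.mul_const _), integral_mul_const, hK.integral_piece,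
      zero_mul, sub_zero]
    unfold pieceGap
    simp only [hneg, if_false, sub_zero]
    rw [← integral_indicator Metric.isClosed_closedBall.measurableSet,
      ← integral_sub_left_eq_self _ volume z]
    congr 1 with y
    by_cases h : z - y ∈ unitBall E
    · simp only [hχ, indicator_of_mem h, sub_sub_cancel, mul_one]
      rfl
    · simp only [hχ, indicator_of_notMem h, mul_zero]
  calc ∫⁻ z, ‖pieceGap K (-(m + 1 : ℤ)) z‖ₑ
      ≤ ∫⁻ z, ∫⁻ y, ‖k y‖ₑ * ‖χ (z - y) - χ z‖ₑ := by
        refine lintegral_mono fun z => ?_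
        rw [e]
        refine (enorm_integral_le_lintegral_enorm _).trans_eq ?_
        simp_rw [enorm_mul]
    _ = ∫⁻ y, ‖k y‖ₑ * shiftDiff χ y := by
        rw [lintegral_lintegral_swap]
        · congr 1 with y
          exact lintegral_const_mul' _ _ enorm_ne_top
        · apply Measurable.aemeasurable
          simp only [Function.uncurry_def]
          fun_prop
    _ ≤ ∫⁻ y, ‖k y‖ₑ * (ENNReal.ofReal (4 ^ Module.finrank ℝ E) * volume (unitBall E) *
          (2⁻¹ : ℝ≥0∞) ^ m) := by
        refine lintegral_mono fun y => ?_
        by_cases hy : k y = 0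
        · simp [hy]
        have hy2 := (piece_ne_zero hy).2
        have e2 : (2 : ℝ) ^ (-(m + 1 : ℤ) + 1) = 2⁻¹ ^ m := by
          rw [show (-(m + 1 : ℤ) + 1) = -(m : ℤ) by ring, zpow_neg, inv_pow]; norm_cast
        rw [e2] at hy2
        gcongr
        refine (shiftDiff_unitBall_le
          (hy2.trans (pow_le_one₀ (by norm_num) (by norm_num)))).trans ?_
        rw [ENNReal.ofReal_mul (by positivity), mul_right_comm]
        gcongr
        refine (ENNReal.ofReal_le_ofReal hy2).trans_eq ?_
        rw [ENNReal.ofReal_pow (by norm_num), ENNReal.ofReal_inv_of_pos (by norm_num)]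
        simp
    _ = _ := by
        rw [lintegral_mul_const _ hkm.enorm, hk, hK.lintegral_piece]
        ring

lemma DiniKernel.lintegral_gapMajorant {K : E → ℝ} (hK : DiniKernel K) :
    ∫⁻ z, gapMajorant K z < ∞ := by
  have hvt : volume (unitBall E) < ∞ := (isCompact_closedBall _ _).measure_lt_top
  unfold gapMajorant
  rw [lintegral_tsum fun j => (hK.measurable_pieceGap j).enorm.aemeasurable,
    tsum_of_nat_of_neg_add_one ENNReal.summable ENNReal.summable]
  refine ENNReal.add_lt_top.2 ⟨?_, ?_⟩
  · refine (ENNReal.tsum_le_tsum hK.lintegral_pieceGap_nonneg).trans_lt ?_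
    rw [ENNReal.tsum_mul_left]
    exact ENNReal.mul_lt_top hvt hK.dini
  · refine (ENNReal.tsum_le_tsum hK.lintegral_pieceGap_neg).trans_lt ?_
    rw [ENNReal.tsum_mul_left, ENNReal.tsum_geometric]
    refine ENNReal.mul_lt_top (ENNReal.mul_lt_top (ENNReal.mul_lt_top (by simp) hvt) ?_) ?_
    · exact hK.integrable.2
    · rw [ENNReal.one_sub_inv_two, inv_inv]; simp

/-- The mollified truncated kernel minus the truncated kernel. -/
def gapKernel (K : E → ℝ) (a b : ℤ) (z : E) : ℝ :=
  (∫ t in unitBall E, shell K a b (z - t)) - volume.real (unitBall E) * shell K 0 b z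

lemma DiniKernel.gapKernel_eq_sum {K : E → ℝ} (hK : DiniKernel K) {a : ℤ} (ha : a ≤ 0) (b : ℤ)
    (z : E) : gapKernel K a b z = ∑ j ∈ Finset.Ico a b, pieceGap K j z := by
  have hi : ∀ j, IntegrableOn (fun t => piece K j (z - t)) (unitBall E) := fun j =>
    ((hK.integrable_piece j).comp_sub_left z).integrableOn
  have hc : ∀ j, IntegrableOn (fun _ => if 0 ≤ j then piece K j z else 0) (unitBall E) := fun j =>
    integrableOn_const (isCompact_closedBall _ _).measure_lt_top.ne
  have e1 : ∀ j, pieceGap K j z = (∫ t in unitBall E, piece K j (z - t)) -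
      volume.real (unitBall E) * if 0 ≤ j then piece K j z else 0 := by
    intro j
    unfold pieceGap
    rw [integral_sub (hi j) (hc j), setIntegral_const, smul_eq_mul]
  simp_rw [e1]
  rw [Finset.sum_sub_distrib, ← Finset.mul_sum, ← Finset.sum_filter,
    ← integral_finsetSum _ fun j _ => hi j]
  unfold gapKernel
  simp_rw [shell_eq_sum]
  congr 4
  ext j
  simp only [Finset.mem_filter, Finset.mem_Ico]
  omega

lemma DiniKernel.enorm_gapKernel_le {K : E → ℝ} (hK : DiniKernel K) {a : ℤ} (ha : a ≤ 0) (b : ℤ)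
    (z : E) : ‖gapKernel K a b z‖ₑ ≤ gapMajorant K z := by
  rw [hK.gapKernel_eq_sum ha]
  exact (enorm_sum_le _ _).trans (ENNReal.sum_le_tsum _)

lemma DiniKernel.shell_smul {K : E → ℝ} (hK : DiniKernel K) (k a b : ℤ) (x : E) :
    shell K (k + a) (k + b) ((2 : ℝ) ^ k • x) =
      (((2 : ℝ) ^ k) ^ Module.finrank ℝ E)⁻¹ * shell K a b x := by
  rw [shell_eq_sum, shell_eq_sum, Finset.mul_sum]
  have : Finset.Ico (k + a) (k + b) = (Finset.Ico a b).map (addRightEmbedding k) := by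
    rw [Finset.map_add_right_Ico, add_comm k, add_comm k]
  rw [this, Finset.sum_map]
  refine Finset.sum_congr rfl fun j _ => ?_
  exact piece_smul hK k j x ▸ by rw [addRightEmbedding_apply, add_comm]

lemma DiniKernel.integral_shell {K : E → ℝ} (hK : DiniKernel K) (a b : ℤ) :
    ∫ z, shell K a b z = 0 := by
  simp_rw [shell_eq_sum]
  rw [integral_finsetSum _ fun j _ => hK.integrable_piece j]
  simp [hK.integral_piece]

lemma DiniKernel.shellConv_scale {K : E → ℝ} (hK : DiniKernel K) (g : E → ℝ) (k a b : ℤ) (x t : E) :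
    shellConv K g (k + a) (k + b) (x - (2 : ℝ) ^ k • t) =
      ∫ w, shell K a b (w - t) * g (x - (2 : ℝ) ^ k • w) := by
  have hr : 0 < (2 : ℝ) ^ k := by positivity
  unfold shellConv
  have h := Measure.integral_comp_smul volume
    (fun z => shell K (k + a) (k + b) z * g (x - (2 : ℝ) ^ k • t - z)) ((2 : ℝ) ^ k)
  have hp : 0 < ((2 : ℝ) ^ k) ^ Module.finrank ℝ E := by positivity
  rw [abs_of_pos (inv_pos.2 hp), smul_eq_mul, eq_comm, inv_mul_eq_iff_eq_mul₀ hp.ne'] at h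
  rw [h, ← integral_const_mul, ← integral_sub_right_eq_self _ t]
  congr 1 with w
  rw [hK.shell_smul, ← mul_assoc, mul_inv_cancel_left₀ hp.ne']
  congr 2
  rw [smul_sub]; abel

lemma DiniKernel.integrable_shell_prod {K g : E → ℝ} (hK : DiniKernel K)
    (hgm : Measurable g) {M : ℝ}
    (hM : ∀ x, |g x| ≤ M) (r : ℝ) (a b : ℤ) (x : E) :
    Integrable (Function.uncurry fun t w : E => shell K a b (w - t) * g (x - r • w))
      ((volume.restrict (unitBall E)).prod volume) := by
  have hs := hK.measurable_shell a b
  have : IsFiniteMeasure (volume.restrict (unitBall E)) :=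
    ⟨by simpa using (isCompact_closedBall (0 : E) 1).measure_lt_top⟩
  have h1 : Integrable (Function.uncurry fun t w : E => shell K a b (w - t))
      ((volume.restrict (unitBall E)).prod volume) := by
    rw [integrable_prod_iff]
    · refine ⟨ae_of_all _ fun t => (hK.integrable_shell a b).comp_sub_right t, ?_⟩
      simp only [Function.uncurry_apply_pair]
      simp_rw [integral_sub_right_eq_self (fun w => ‖shell K a b w‖)]
      exact integrable_const _
    · apply Measurable.aestronglyMeasurable
      simp only [Function.uncurry_def]
      fun_prop
  have h2 := h1.mul_bdd (c := M) (g := fun p : E × E => g (x - r • p.2))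
    (by apply Measurable.aestronglyMeasurable; fun_prop) (ae_of_all _ fun _ => hM _)
  exact h2

lemma DiniKernel.integral_gapKernel_mul {K g : E → ℝ} (hK : DiniKernel K)
    (hgm : Measurable g) {M : ℝ}
    (hM : ∀ x, |g x| ≤ M) (k a b : ℤ) (x : E) :
    (∫ t in unitBall E, shellConv K g (k + a) (k + b) (x - (2 : ℝ) ^ k • t)) -
        volume.real (unitBall E) * shellConv K g k (k + b) x =
      ∫ w, gapKernel K a b w * g (x - (2 : ℝ) ^ k • w) := by
  have hP := hK.integrable_shell_prod hgm hM ((2 : ℝ) ^ k) a b x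
  simp_rw [hK.shellConv_scale g k a b x]
  have e0 : shellConv K g k (k + b) x = ∫ w, shell K 0 b w * g (x - (2 : ℝ) ^ k • w) := by
    have := hK.shellConv_scale g k 0 b x 0
    simpa using this
  rw [integral_integral_swap hP, e0, ← integral_const_mul, ← integral_sub]
  · congr 1 with w
    rw [integral_mul_const]
    unfold gapKernel
    ring
  · exact hP.integral_prod_right
  · apply Integrable.const_mul
    exact (hK.integrable_shell 0 b).mul_bdd (c := M)
      (by apply Measurable.aestronglyMeasurable; fun_prop) (ae_of_all _ fun _ => hM _)

lemma DiniKernel.shellConv_sub_const {K g : E → ℝ} (hK : DiniKernel K) (hgm : Measurable g) {M : ℝ}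
    (hM : ∀ x, |g x| ≤ M) (c : ℝ) (a b : ℤ) (x : E) :
    shellConv K (fun y => g y - c) a b x = shellConv K g a b x := by
  unfold shellConv
  simp_rw [mul_sub]
  rw [integral_sub (hK.integrable_shell_mul hgm hM a b x) ((hK.integrable_shell a b).mul_const _),
    integral_mul_const, hK.integral_shell, zero_mul, sub_zero]

lemma DiniKernel.enorm_shellConv_gap_le {K g : E → ℝ} (hK : DiniKernel K)
    (hgm : Measurable g) {M : ℝ}
    (hM : ∀ x, |g x| ≤ M) {k a : ℤ} (hak : a ≤ k) (b : ℤ) (x : E) :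
    ‖(∫ t in unitBall E, shellConv K g a b (x - (2 : ℝ) ^ k • t)) -
        volume.real (unitBall E) * shellConv K g k b x‖ₑ ≤
      ∫⁻ w, gapMajorant K w * ‖g (x - (2 : ℝ) ^ k • w) - g x‖ₑ := by
  have hM' : ∀ y, |g y - g x| ≤ M + M := fun y =>
    (abs_sub _ _).trans (add_le_add (hM y) (hM x))
  have h := hK.integral_gapKernel_mul (g := fun y => g y - g x) (hgm.sub_const _) hM' k (a - k)
    (b - k) x
  simp_rw [hK.shellConv_sub_const hgm hM, add_sub_cancel] at h
  rw [h]
  refine (enorm_integral_le_lintegral_enorm _).trans (lintegral_mono fun w => ?_)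
  rw [enorm_mul]
  gcongr
  exact hK.enorm_gapKernel_le (by omega) _ _

/-- The truncated singular integral. -/
def truncInt (K g : E → ℝ) (x : E) (ε : ℝ) : ℝ := ∫ y in {y | ε < ‖x - y‖}, K (x - y) * g y

lemma measurableSet_lt_norm_sub (x : E) (ε : ℝ) : MeasurableSet {y : E | ε < ‖x - y‖} :=
  measurableSet_lt measurable_const (by fun_prop)

lemma DiniKernel.tendsto_shellConv {K g : E → ℝ} (hK : DiniKernel K) (hgm : Measurable g) {k : ℤ}
    {x : E} (hx : IntegrableOn (fun y => K (x - y) * g y) {y | (2 : ℝ) ^ k < ‖x - y‖}) :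
    Tendsto (fun N : ℕ => shellConv K g k N x) atTop (𝓝 (truncInt K g x (2 ^ k))) := by
  have e : ∀ N : ℕ, shellConv K g k N x =
      ∫ y in {y | (2 : ℝ) ^ k < ‖x - y‖}, shell K k N (x - y) * g y := by
    intro N
    unfold shellConv
    rw [← integral_sub_left_eq_self _ volume x,
      ← integral_indicator (measurableSet_lt_norm_sub _ _)]
    congr 1 with y
    rw [sub_sub_cancel]
    by_cases hy : (2 : ℝ) ^ k < ‖x - y‖
    · rw [indicator_of_mem (show y ∈ {y | (2 : ℝ) ^ k < ‖x - y‖} from hy)]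
    · rw [indicator_of_notMem (show y ∉ {y | (2 : ℝ) ^ k < ‖x - y‖} from hy), shell,
        indicator_of_notMem (fun h => hy h.1), zero_mul]
  simp_rw [e]
  have hd : ∀ N : ℕ, ∀ y, ‖shell K k N (x - y) * g y‖ ≤ ‖K (x - y) * g y‖ := by
    intro N y
    rw [norm_mul, norm_mul]
    gcongr
    exact norm_indicator_le_norm_self _ _
  refine tendsto_integral_of_dominated_convergence (fun y => ‖K (x - y) * g y‖) ?_ hx.norm
    (fun N => ae_of_all _ (hd N)) ?_
  · intro N
    have := hK.measurable_shell k N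
    apply Measurable.aestronglyMeasurable
    fun_prop
  · filter_upwards [ae_restrict_mem (measurableSet_lt_norm_sub _ _)] with y hy
    apply tendsto_const_nhds.congr'
    have ht : Tendsto (fun N : ℕ => (2 : ℝ) ^ (N : ℤ)) atTop atTop := by
      simpa using tendsto_pow_atTop_atTop_of_one_lt (one_lt_two (α := ℝ))
    filter_upwards [ht.eventually_ge_atTop ‖x - y‖] with N hN
    rw [shell, indicator_of_mem]
    exact ⟨hy, hN⟩

lemma integrableOn_unitBall_comp {h : E → ℝ} (hh : LocallyIntegrable h) (x : E) {r : ℝ}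
    (hr : 0 < r) : IntegrableOn (fun t => h (x - r • t)) (unitBall E) := by
  have h1 : Integrable ((Metric.closedBall x r).indicator h) :=
    (hh.integrableOn_isCompact (isCompact_closedBall _ _)).integrable_indicator
      Metric.isClosed_closedBall.measurableSet
  have h2 := ((h1.comp_sub_left x).comp_smul hr.ne').integrableOn (s := unitBall E)
  refine h2.congr_fun (fun t ht => ?_) Metric.isClosed_closedBall.measurableSet
  beta_reduce
  rw [indicator_of_mem]
  rw [mem_closedBall_zero_iff] at ht
  rw [Metric.mem_closedBall, dist_eq_norm, sub_sub_cancel_left, norm_neg, norm_smul,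
      Real.norm_of_nonneg hr.le]
  nlinarith

lemma tendsto_integral_unitBall {u : ℕ → E → ℝ} {h : E → ℝ} (hu : ∀ N, MemLp (u N) 2)
    (hh : MemLp h 2) (hlim : Tendsto (fun N => eLpNorm (fun x => u N x - h x) 2) atTop (𝓝 0))
    (x : E) {r : ℝ} (hr : 0 < r) :
    Tendsto (fun N => ∫ t in unitBall E, u N (x - r • t)) atTop
      (𝓝 (∫ t in unitBall E, h (x - r • t))) := by
  refine tendsto_integral_of_L1 _
    (integrableOn_unitBall_comp (hh.locallyIntegrable (by norm_num)) x hr).aestronglyMeasurable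
    (Eventually.of_forall fun N =>
      integrableOn_unitBall_comp ((hu N).locallyIntegrable (by norm_num)) x hr) ?_
  set V : ℝ≥0∞ := volume (Metric.closedBall x r) with hV
  have hVt : V ≠ ∞ := (isCompact_closedBall _ _).measure_lt_top.ne
  have hrd : 0 < r ^ Module.finrank ℝ E := by positivity
  set R := ENNReal.ofReal (r ^ Module.finrank ℝ E) with hR
  have hR0 : R ≠ 0 := by simpa [hR] using hrd
  have hRt : R ≠ ∞ := ENNReal.ofReal_ne_top
  have hb : ∀ N, ∫⁻ t in unitBall E, ‖u N (x - r • t) - h (x - r • t)‖ₑ ≤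
      R⁻¹ * V ^ (1 / 2 : ℝ) * eLpNorm (fun x => u N x - h x) 2 := by
    intro N
    have h1 := setLIntegral_closedBall_scale (fun y => ‖u N y - h y‖ₑ) x hr
    have hm : AEStronglyMeasurable (fun y => u N y - h y) volume := (hu N).1.sub hh.1
    have h2 := eLpNorm_le_eLpNorm_mul_rpow_measure_univ (p := 1) (q := 2) (by norm_num)
      (hm.restrict (s := Metric.closedBall x r))
    rw [eLpNorm_one_eq_lintegral_enorm, Measure.restrict_apply_univ, h1] at h2
    rw [mul_assoc, ← ENNReal.mul_le_iff_le_inv hR0 hRt]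
    refine h2.trans ?_
    rw [mul_comm]
    rw [show 1 / ENNReal.toReal 1 - 1 / ENNReal.toReal 2 = (1 / 2 : ℝ) by norm_num]
    gcongr
    exact Measure.restrict_le_self
  have hz := ENNReal.Tendsto.const_mul (a := R⁻¹ * V ^ (1 / 2 : ℝ)) hlim
    (Or.inr (ENNReal.mul_ne_top (ENNReal.inv_ne_top.2 hR0)
      (ENNReal.rpow_ne_top_of_nonneg (by norm_num) hVt)))
  rw [mul_zero] at hz
  exact tendsto_of_tendsto_of_tendsto_of_le_of_le tendsto_const_nhds hz (fun _ => zero_le) hb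

lemma DiniKernel.enorm_truncInt_sub_le {K g : E → ℝ} (hK : DiniKernel K)
    (hgm : Measurable g) {M : ℝ}
    (hM : ∀ x, |g x| ≤ M) {k : ℤ} {ε : ℝ} (h1 : (2 : ℝ) ^ k < ε) (h2 : ε ≤ 2 ^ (k + 1)) {x : E}
    (hx : IntegrableOn (fun y => K (x - y) * g y) {y | (2 : ℝ) ^ k < ‖x - y‖}) :
    ‖truncInt K g x (2 ^ k) - truncInt K g x ε‖ₑ ≤
      ∫⁻ w, ‖piece K 0 w‖ₑ * ‖g (x - (2 : ℝ) ^ k • w) - g x‖ₑ := by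
  have hk : 0 < (2 : ℝ) ^ k := by positivity
  have hi : IntegrableOn (fun z => K z * g (x - z)) (annulus E (2 ^ k) ε) := by
    have := (hK.integrableOn_annulus hk ε).mul_bdd (c := M) (g := fun z => g (x - z))
      (by apply Measurable.aestronglyMeasurable; fun_prop) (ae_of_all _ fun _ => hM _)
    exact this
  have e : truncInt K g x (2 ^ k) - truncInt K g x ε =
      ∫ z in annulus E (2 ^ k) ε, K z * (g (x - z) - g x) := by
    unfold truncInt
    rw [← setIntegral_sdiff (measurableSet_lt_norm_sub _ _) hx
      (fun y hy => h1.trans (show ε < ‖x - y‖ from hy))]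
    simp_rw [mul_sub]
    rw [integral_sub hi ((hK.integrableOn_annulus hk ε).mul_const _), integral_mul_const,
      hK.mean_zero _ _ hk, zero_mul, sub_zero,
      ← integral_indicator (measurableSet_annulus _ _), ← integral_indicator
        ((measurableSet_lt_norm_sub _ _).diff (measurableSet_lt_norm_sub _ _)),
      ← integral_sub_left_eq_self _ volume x]
    congr 1 with y
    simp only [indicator, Set.mem_sdiff, mem_ofPred_eq, not_lt, annulus, sub_sub_cancel]
    congr
  rw [e]
  refine (enorm_integral_le_lintegral_enorm _).trans ?_
  calc ∫⁻ z in annulus E (2 ^ k) ε, ‖K z * (g (x - z) - g x)‖ₑ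
      ≤ ∫⁻ z, ‖piece K k z‖ₑ * ‖g (x - z) - g x‖ₑ := by
        rw [← lintegral_indicator (measurableSet_annulus _ _)]
        refine lintegral_mono fun z => ?_
        by_cases hz : z ∈ annulus E (2 ^ k) ε
        · rw [indicator_of_mem hz, enorm_mul, piece, indicator_of_mem]
          exact ⟨hz.1, hz.2.trans h2⟩
        · rw [indicator_of_notMem hz]; exact zero_le
    _ = _ := by
        rw [lintegral_comp_smul _ hk, ← lintegral_const_mul' _ _ ENNReal.ofReal_ne_top]
        congr 1 with w
        have := piece_smul hK k 0 w
        rw [add_zero] at this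
        rw [this, ← mul_assoc, enorm_mul, ← mul_assoc]
        congr 1
        have hp : 0 < ((2 : ℝ) ^ k) ^ Module.finrank ℝ E := by positivity
        rw [← Real.enorm_of_nonneg hp.le, ← enorm_mul, mul_inv_cancel₀ hp.ne', enorm_one, one_mul]

/-- A.e. convergence of truncated singular integrals of bounded integrable functions. -/
theorem DiniKernel.exists_ae_limit {K : E → ℝ} (hK : DiniKernel K) {g : E → ℝ}
    (hg : Integrable g) (hgm : Measurable g) {M : ℝ} (hM : ∀ x, |g x| ≤ M) :
    ∃ h : E → ℝ, MemLp h 2 ∧ eLpNorm h 2 ≤ multBound K * eLpNorm g 2 ∧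
      ∀ᵐ x, Tendsto (truncInt K g x) (𝓝[>] 0) (𝓝 (h x)) := by
  obtain ⟨h, hh, hb, hu, hlim⟩ := hK.exists_L2_limit hg hM
  refine ⟨h, hh, hb, ?_⟩
  have hhl := hh.locallyIntegrable (by norm_num)
  filter_upwards [hK.ae_integrableOn hg hgm, ae_lebesguePoint hhl,
    ae_lebesguePoint hg.locallyIntegrable] with x hx hxh hxg
  set v := volume (unitBall E) with hv
  have hvt : v ≠ ∞ := (isCompact_closedBall _ _).measure_lt_top.ne
  have hv0 : v ≠ 0 := (Metric.measure_closedBall_pos _ _ one_pos).ne'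
  set φ₁ : ℝ → ℝ≥0∞ := fun r => ∫⁻ w, gapMajorant K w * ‖g (x - r • w) - g x‖ₑ
  set φ₂ : ℝ → ℝ≥0∞ := fun r => ∫⁻ w, ‖piece K 0 w‖ₑ * ‖g (x - r • w) - g x‖ₑ
  set φ₃ : ℝ → ℝ≥0∞ := fun r => ∫⁻ t in unitBall E, ‖h (x - r • t) - h x‖ₑ
  have l1 : Tendsto φ₁ (𝓝[>] 0) (𝓝 0) :=
    hxg.tendsto hM hK.lintegral_gapMajorant.ne hK.measurable_gapMajorant
  have l2 : Tendsto φ₂ (𝓝[>] 0) (𝓝 0) :=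
    hxg.tendsto hM hK.integrable.2.ne (hK.measurable_piece 0).enorm
  have l3 : Tendsto φ₃ (𝓝[>] 0) (𝓝 0) := hxh
  have key1 : ∀ k : ℤ, ‖(∫ t in unitBall E, h (x - (2 : ℝ) ^ k • t)) -
      volume.real (unitBall E) * truncInt K g x (2 ^ k)‖ₑ ≤ φ₁ (2 ^ k) := by
    intro k
    have t1 := tendsto_integral_unitBall hu hh hlim x (r := 2 ^ k) (by positivity)
    have t2 := hK.tendsto_shellConv hgm (hx ((2 : ℝ) ^ k) (by positivity))
    refine le_of_tendsto (continuous_enorm.continuousAt.tendsto.comp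
      (t1.sub (t2.const_mul (volume.real (unitBall E))))) ?_
    filter_upwards [eventually_ge_atTop (-k).toNat] with N hN
    exact hK.enorm_shellConv_gap_le hgm hM (by omega) N x
  have key3 : ∀ k : ℤ, ‖(∫ t in unitBall E, h (x - (2 : ℝ) ^ k • t)) -
      volume.real (unitBall E) * h x‖ₑ ≤ φ₃ (2 ^ k) := by
    intro k
    have : volume.real (unitBall E) * h x = ∫ t in unitBall E, h x := by simp
    rw [this, ← integral_sub (integrableOn_unitBall_comp hhl x (by positivity))
      (integrableOn_const hvt)]
    exact enorm_integral_le_lintegral_enorm _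
  have key : ∀ ε > 0, ∀ k : ℤ, (2 : ℝ) ^ k < ε → ε ≤ 2 ^ (k + 1) →
      ‖truncInt K g x ε - h x‖ₑ ≤ φ₂ (2 ^ k) + v⁻¹ * (φ₁ (2 ^ k) + φ₃ (2 ^ k)) := by
    intro ε hε k hk1 hk2
    have a1 := hK.enorm_truncInt_sub_le hgm hM hk1 hk2 (hx ((2 : ℝ) ^ k) (by positivity))
    have a2 : v * ‖truncInt K g x (2 ^ k) - h x‖ₑ ≤ φ₁ (2 ^ k) + φ₃ (2 ^ k) := by
      have : v = ‖volume.real (unitBall E)‖ₑ := by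
        rw [Real.enorm_of_nonneg measureReal_nonneg, ofReal_measureReal hvt]
      rw [this, ← enorm_mul]
      calc _ = ‖((∫ t in unitBall E, h (x - (2 : ℝ) ^ k • t)) - volume.real (unitBall E) * h x) -
            ((∫ t in unitBall E, h (x - (2 : ℝ) ^ k • t)) -
              volume.real (unitBall E) * truncInt K g x (2 ^ k))‖ₑ := by congr 1; ring
        _ ≤ _ := enorm_sub_le
        _ ≤ _ := by rw [add_comm]; exact add_le_add (key1 k) (key3 k)
    calc _ = ‖(truncInt K g x (2 ^ k) - h x) -
          (truncInt K g x (2 ^ k) - truncInt K g x ε)‖ₑ := by congr 1; ring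
      _ ≤ _ := enorm_sub_le
      _ ≤ _ := by
        rw [add_comm]
        refine add_le_add a1 ?_
        rwa [← ENNReal.mul_le_iff_le_inv hv0 hvt]
  have hsc : ∀ ε : ℝ, ∃ k : ℤ, 0 < ε → (2 : ℝ) ^ k < ε ∧ ε ≤ 2 ^ (k + 1) := by
    intro ε
    by_cases hε : 0 < ε
    · obtain ⟨k, hk⟩ := exists_mem_annulus hε
      exact ⟨k, fun _ => hk⟩
    · exact ⟨0, fun h => absurd h hε⟩
  choose κ hκ using hsc
  have hκt : Tendsto (fun ε => (2 : ℝ) ^ κ ε) (𝓝[>] 0) (𝓝[>] 0) := by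
    apply tendsto_nhdsWithin_of_tendsto_nhds_of_eventually_within
    · refine tendsto_of_tendsto_of_tendsto_of_le_of_le' tendsto_const_nhds
        (nhdsWithin_le_nhds (a := (0 : ℝ)) (s := Ioi 0)) ?_ ?_
      · exact Eventually.of_forall fun ε => by positivity
      · filter_upwards [self_mem_nhdsWithin] with ε hε
        exact (hκ ε hε).1.le
    · exact Eventually.of_forall fun ε => by simp only [mem_Ioi]; positivity
  rw [tendsto_iff_edist_tendsto_0]
  have hfin : Tendsto (fun ε => φ₂ (2 ^ κ ε) + v⁻¹ * (φ₁ (2 ^ κ ε) + φ₃ (2 ^ κ ε))) (𝓝[>] 0)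
      (𝓝 0) := by
    have := (l2.comp hκt).add (ENNReal.Tendsto.const_mul (a := v⁻¹)
      ((l1.comp hκt).add (l3.comp hκt)) (Or.inr (ENNReal.inv_ne_top.2 hv0)))
    simpa using this
  refine tendsto_of_tendsto_of_tendsto_of_le_of_le' tendsto_const_nhds hfin
    (Eventually.of_forall fun _ => zero_le) ?_
  filter_upwards [self_mem_nhdsWithin] with ε hε
  rw [edist_eq_enorm_sub]
  exact key ε hε _ (hκ ε hε).1 (hκ ε hε).2

end LebesguePoints

section Decomposition

/-- A Calderón–Zygmund family of `f` at height `lam`. -/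
structure CZDecomp {E : Type*} [NormedAddCommGroup E] [InnerProductSpace ℝ E]
    [FiniteDimensional ℝ E] [MeasurableSpace E] [BorelSpace E] (f : E → ℝ) (lam A : ℝ) where
  ι : Type
  countable : Countable ι
  Q : ι → Set E
  c : ι → E
  r : ι → ℝ
  measurableSet : ∀ i, MeasurableSet (Q i)
  disjoint : Pairwise (Function.onFun Disjoint Q)
  r_pos : ∀ i, 0 < r i
  subset : ∀ i, Q i ⊆ Metric.closedBall (c i) (r i)
  volume_le : ∀ i, volume.real (Metric.closedBall (c i) (r i)) ≤ A * volume.real (Q i)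
  lam_le : ∀ i, lam * volume.real (Q i) ≤ ∫ x in Q i, f x
  le_lam : ∀ i, ∫ x in Q i, f x ≤ A * lam * volume.real (Q i)
  ae_le : ∀ᵐ x, x ∉ ⋃ i, Q i → f x ≤ lam

section Dyadic

variable {n : ℕ}

/-- The index of the dyadic cube of generation `k` containing `x`. -/
def dyIndex (k : ℤ) (x : EuclideanSpace ℝ (Fin n)) : Fin n → ℤ := fun i => ⌊(2 : ℝ) ^ k * x i⌋

/-- Dyadic cubes. -/
def dyCube (k : ℤ) (m : Fin n → ℤ) : Set (EuclideanSpace ℝ (Fin n)) := {y | dyIndex k y = m}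

lemma measurable_dyIndex (k : ℤ) : Measurable (dyIndex (n := n) k) := by
  unfold dyIndex
  refine measurable_pi_lambda _ fun i => Int.measurable_floor.comp ?_
  fun_prop

lemma measurableSet_dyCube (k : ℤ) (m : Fin n → ℤ) : MeasurableSet (dyCube k m) :=
  measurable_dyIndex k (measurableSet_singleton m)

lemma dyIndex_eq_of_succ {k : ℤ} {x y : EuclideanSpace ℝ (Fin n)}
    (h : dyIndex (k + 1) x = dyIndex (k + 1) y) : dyIndex k x = dyIndex k y := by
  have e : ∀ z : EuclideanSpace ℝ (Fin n), ∀ i, dyIndex k z i = dyIndex (k + 1) z i / 2 := by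
    intro z i
    have := Int.floor_div_natCast ((2 : ℝ) ^ (k + 1) * z i) 2
    unfold dyIndex
    rw [show ((2 : ℤ)) = ((2 : ℕ) : ℤ) by norm_num, ← this, zpow_add_one₀ two_ne_zero]
    congr 1
    push_cast
    ring
  funext i
  rw [e, e, h]

lemma dyIndex_eq_of_le {k l : ℤ} (hkl : k ≤ l) {x y : EuclideanSpace ℝ (Fin n)}
    (h : dyIndex l x = dyIndex l y) : dyIndex k x = dyIndex k y := by
  induction l, hkl using Int.leInduction with
  | base => exact h
  | succ l _ ih => exact ih (dyIndex_eq_of_succ h)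

lemma volume_dyCube (k : ℤ) (m : Fin n → ℤ) :
    volume (dyCube k m) = ENNReal.ofReal (((2 : ℝ) ^ (-k)) ^ n) := by
  have hp : 0 < (2 : ℝ) ^ k := by positivity
  have e : dyCube k m = (WithLp.ofLp (p := 2)) ⁻¹' (pi univ fun i =>
      Ico ((2 : ℝ) ^ (-k) * m i) ((2 : ℝ) ^ (-k) * (m i + 1))) := by
    ext y
    simp only [dyCube, mem_ofPred_eq, funext_iff, dyIndex, Int.floor_eq_iff, mem_preimage,
      Set.mem_pi,
      mem_univ, true_implies, mem_Ico, zpow_neg, inv_mul_le_iff₀ hp, lt_inv_mul_iff₀ hp]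
  rw [e, (PiLp.volume_preserving_ofLp (Fin n)).measure_preimage
    (MeasurableSet.univ_pi fun i => measurableSet_Ico).nullMeasurableSet, Real.volume_pi_Ico,
    ENNReal.ofReal_pow (by positivity)]
  have : ∀ i, (2 : ℝ) ^ (-k) * (m i + 1) - (2 : ℝ) ^ (-k) * m i = (2 : ℝ) ^ (-k) := fun i => by ring
  simp only [this, Finset.prod_const, Finset.card_univ, Fintype.card_fin]

lemma volumeReal_dyCube (k : ℤ) (m : Fin n → ℤ) :
    volume.real (dyCube k m) = ((2 : ℝ) ^ (-k)) ^ n := by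
  rw [Measure.real, volume_dyCube, ENNReal.toReal_ofReal (by positivity)]

lemma dyCube_subset (k : ℤ) (x : EuclideanSpace ℝ (Fin n)) :
    dyCube k (dyIndex k x) ⊆ Metric.closedBall x ((n + 1) * (2 : ℝ) ^ (-k)) := by
  intro y hy
  have hp : 0 < (2 : ℝ) ^ k := by positivity
  have hi : ∀ i, |(y - x) i| ≤ (2 : ℝ) ^ (-k) := by
    intro i
    have h : ⌊(2 : ℝ) ^ k * y i⌋ = ⌊(2 : ℝ) ^ k * x i⌋ := congrFun hy i
    have := (Int.abs_sub_lt_one_of_floor_eq_floor h).le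
    rw [← mul_sub, abs_mul, abs_of_pos hp] at this
    rw [zpow_neg, PiLp.sub_apply, ← one_div, le_div_iff₀' hp]
    exact this
  rw [Metric.mem_closedBall, dist_eq_norm, EuclideanSpace.norm_eq]
  apply Real.sqrt_le_iff.2 ⟨by positivity, ?_⟩
  calc ∑ i, ‖(y - x) i‖ ^ 2 ≤ ∑ _i : Fin n, ((2 : ℝ) ^ (-k)) ^ 2 := by
        refine Finset.sum_le_sum fun i _ => ?_
        gcongr
        exact hi i
    _ = n * ((2 : ℝ) ^ (-k)) ^ 2 := by simp
    _ ≤ _ := by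
        rw [mul_pow]
        gcongr
        have : (0 : ℝ) ≤ n := Nat.cast_nonneg _
        nlinarith

lemma volumeReal_closedBall (x : EuclideanSpace ℝ (Fin n)) {r : ℝ} (hr : 0 < r) :
    volume.real (Metric.closedBall x r) =
      r ^ n * volume.real (unitBall (EuclideanSpace ℝ (Fin n))) := by
  rw [Measure.real, volume_closedBall_eq x hr, ENNReal.toReal_mul,
    ENNReal.toReal_ofReal (by positivity), finrank_euclideanSpace_fin]
  rfl

lemma LebesguePoint.le_of_dyCube {f : EuclideanSpace ℝ (Fin n) → ℝ} (hf : Integrable f)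
    {x : EuclideanSpace ℝ (Fin n)} (hx : LebesguePoint f x) {lam : ℝ}
    (h : ∀ k : ℤ, ∫ y in dyCube k (dyIndex k x), f y ≤ lam * volume.real (dyCube k (dyIndex k x))) :
    f x ≤ lam := by
  have hc : (0 : ℝ) < n + 1 := by positivity
  set D : ℝ≥0∞ := ENNReal.ofReal ((n + 1 : ℝ) ^ n) with hD
  have key : ∀ k : ℕ, ENNReal.ofReal (f x - lam) ≤ D *
      ∫⁻ z in Metric.closedBall (0 : EuclideanSpace ℝ (Fin n)) 1,
        ‖f (x - ((n + 1) * (2 : ℝ) ^ (-(k : ℤ))) • z) - f x‖ₑ := by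
    intro k
    set q := dyCube (k : ℤ) (dyIndex k x) with hq
    set s : ℝ := (2 : ℝ) ^ (-(k : ℤ)) with hs
    have hs0 : 0 < s := by positivity
    have hvq : volume q = ENNReal.ofReal (s ^ n) := volume_dyCube _ _
    have hvr : volume.real q = s ^ n := volumeReal_dyCube _ _
    have h1 : (f x - lam) * s ^ n ≤ ∫ y in q, (f x - f y) := by
      have hi : IntegrableOn (fun _ => f x) q :=
        integrableOn_const (by rw [hvq]; exact ENNReal.ofReal_ne_top)
      rw [integral_sub hi hf.integrableOn, setIntegral_const, hvr, smul_eq_mul]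
      have := h k
      rw [← hq, hvr] at this
      linarith
    have h2 : ENNReal.ofReal (f x - lam) * ENNReal.ofReal (s ^ n) ≤ ∫⁻ y in q, ‖f y - f x‖ₑ := by
      rw [← ENNReal.ofReal_mul' (by positivity)]
      refine (ENNReal.ofReal_le_ofReal (h1.trans (le_abs_self _))).trans ?_
      rw [← Real.norm_eq_abs, ofReal_norm]
      refine (enorm_integral_le_lintegral_enorm _).trans_eq ?_
      congr 1 with y
      rw [← enorm_neg, neg_sub]
    have h3 := h2.trans (lintegral_mono_set (dyCube_subset (k : ℤ) x))
    rw [setLIntegral_closedBall_scale _ _ (by positivity), finrank_euclideanSpace_fin, mul_pow,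
      ENNReal.ofReal_mul (by positivity)] at h3
    refine (ENNReal.mul_le_mul_iff_right (a := ENNReal.ofReal (s ^ n)) ?_
      ENNReal.ofReal_ne_top).1 (by rw [mul_comm]; exact h3.trans_eq (by rw [hD, hs]; ring))
    simpa using pow_pos hs0 n
  have hsc : Tendsto (fun k : ℕ => ((n + 1) * (2 : ℝ) ^ (-(k : ℤ)))) atTop (𝓝[>] 0) := by
    apply tendsto_nhdsWithin_of_tendsto_nhds_of_eventually_within
    · have := (tendsto_pow_atTop_nhds_zero_of_lt_one (r := (2⁻¹ : ℝ)) (by norm_num)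
        (by norm_num)).const_mul (n + 1 : ℝ)
      simpa using this
    · exact Eventually.of_forall fun k => by simp only [mem_Ioi]; positivity
  have ht := ENNReal.Tendsto.const_mul (a := D) (hx.comp hsc) (Or.inr ENNReal.ofReal_ne_top)
  rw [mul_zero] at ht
  have := ge_of_tendsto' ht key
  rw [nonpos_iff_eq_zero, ENNReal.ofReal_eq_zero] at this
  linarith

theorem exists_czDecomp (hn : 0 < n) : ∃ A : ℝ, 1 ≤ A ∧
    ∀ f : EuclideanSpace ℝ (Fin n) → ℝ, Integrable f → (∀ x, 0 ≤ f x) → ∀ lam > 0,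
      Nonempty (CZDecomp f lam A) := by
  set v := volume.real (unitBall (EuclideanSpace ℝ (Fin n))) with hv
  refine ⟨max ((n + 1 : ℝ) ^ n * v) (2 ^ n), le_max_of_le_right (one_le_pow₀ (by norm_num)), ?_⟩
  intro f hf hf0 lam hlam
  set bad : ℤ → (Fin n → ℤ) → Prop := fun k m =>
    lam * volume.real (dyCube k m) < ∫ y in dyCube k m, f y with hbad
  set sel : ℤ × (Fin n → ℤ) → Prop := fun p => bad p.1 p.2 ∧
    ∀ y ∈ dyCube p.1 p.2, ∀ k < p.1, ¬ bad k (dyIndex k y) with hsel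
  have hne : ∀ p, sel p → (dyCube p.1 p.2).Nonempty := by
    intro p hp
    by_contra h
    rw [not_nonempty_iff_eq_empty] at h
    have := hp.1
    simp only [hbad, h] at this
    simp at this
  have hbdd : ∃ b : ℤ, ∀ k, ∀ m, bad k m → b ≤ k := by
    obtain ⟨N, hN⟩ := pow_unbounded_of_one_lt ((∫ y, f y) / lam) (one_lt_two)
    refine ⟨-N, fun k m hk => ?_⟩
    by_contra! hlt
    have h1 : ∫ y in dyCube k m, f y ≤ ∫ y, f y :=
      setIntegral_le_integral hf (ae_of_all _ hf0)
    have h2 : (2 : ℝ) ^ N ≤ ((2 : ℝ) ^ (-k)) ^ n := by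
      calc (2 : ℝ) ^ N = (2 : ℝ) ^ (N : ℤ) := by simp
        _ ≤ (2 : ℝ) ^ (-k) := zpow_le_zpow_right₀ (by norm_num) (by omega)
        _ ≤ _ := le_self_pow₀ (one_le_zpow₀ (by norm_num) (by omega)) hn.ne'
    have h3 : lam * volume.real (dyCube k m) < ∫ y in dyCube k m, f y := hk
    rw [volumeReal_dyCube] at h3
    rw [div_lt_iff₀ hlam] at hN
    nlinarith
  obtain ⟨b, hb⟩ := hbdd
  refine ⟨⟨{p // sel p}, inferInstance, fun p => dyCube p.1.1 p.1.2, fun p => (hne p.1 p.2).some,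
    fun p => (n + 1) * (2 : ℝ) ^ (-p.1.1), fun p => measurableSet_dyCube _ _, ?_,
    fun p => by positivity, ?_, ?_, fun p => le_of_lt p.2.1, ?_, ?_⟩⟩
  · intro p q hpq
    rw [Function.onFun, Set.disjoint_left]
    intro y hyp hyq
    apply hpq
    have e1 : dyIndex p.1.1 y = p.1.2 := hyp
    have e2 : dyIndex q.1.1 y = q.1.2 := hyq
    rcases lt_trichotomy p.1.1 q.1.1 with h | h | h
    · exact absurd p.2.1 (e1 ▸ q.2.2 y hyq _ h)
    · apply Subtype.ext
      apply Prod.ext h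
      rw [← e1, ← e2, h]
    · exact absurd q.2.1 (e2 ▸ p.2.2 y hyp _ h)
  · intro p
    have h : dyIndex p.1.1 (hne p.1 p.2).some = p.1.2 := (hne p.1 p.2).some_mem
    have := dyCube_subset p.1.1 (hne p.1 p.2).some
    rwa [h] at this
  · intro p
    rw [volumeReal_closedBall _ (by positivity), volumeReal_dyCube, mul_pow, mul_right_comm]
    gcongr
    exact le_max_left _ _
  · intro p
    obtain ⟨y, hy⟩ := hne p.1 p.2
    have hy' : dyIndex p.1.1 y = p.1.2 := hy
    have h1 := p.2.2 y hy (p.1.1 - 1) (by omega)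
    simp only [hbad, not_lt, volumeReal_dyCube] at h1 ⊢
    have hsub : dyCube p.1.1 p.1.2 ⊆ dyCube (p.1.1 - 1) (dyIndex (p.1.1 - 1) y) := by
      intro z hz
      have hz' : dyIndex p.1.1 z = p.1.2 := hz
      exact dyIndex_eq_of_le (by omega : p.1.1 - 1 ≤ p.1.1) (hz'.trans hy'.symm)
    calc ∫ x in dyCube p.1.1 p.1.2, f x
        ≤ ∫ x in dyCube (p.1.1 - 1) (dyIndex (p.1.1 - 1) y), f x :=
          setIntegral_mono_set hf.integrableOn (ae_of_all _ hf0) hsub.eventuallyLE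
      _ ≤ lam * ((2 : ℝ) ^ (-(p.1.1 - 1))) ^ n := h1
      _ = 2 ^ n * lam * ((2 : ℝ) ^ (-p.1.1)) ^ n := by
          rw [show -(p.1.1 - 1) = -p.1.1 + 1 by ring, zpow_add_one₀ two_ne_zero, mul_pow]
          ring
      _ ≤ _ := by
          gcongr
          exact le_max_right _ _
  · filter_upwards [ae_lebesguePoint hf.locallyIntegrable] with x hx hxU
    apply hx.le_of_dyCube hf
    intro k
    by_contra! hk
    have hk : bad k (dyIndex k x) := hk
    obtain ⟨l, hl, hmin⟩ := Int.exists_least_of_bdd (P := fun k => bad k (dyIndex k x))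
      ⟨b, fun k hk => hb k _ hk⟩ ⟨k, hk⟩
    apply hxU
    rw [mem_iUnion]
    refine ⟨⟨(l, dyIndex l x), hl, ?_⟩, rfl⟩
    intro y hy j hj hbj
    have hy' : dyIndex l y = dyIndex l x := hy
    rw [dyIndex_eq_of_le hj.le hy'] at hbj
    exact absurd (hmin j hbj) (not_le.2 hj)

end Dyadic

end Decomposition

section WeakType

variable {E : Type*} [NormedAddCommGroup E] [InnerProductSpace ℝ E] [FiniteDimensional ℝ E]
  [MeasurableSpace E] [BorelSpace E]

attribute [instance] CZDecomp.countable

namespace CZDecomp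

variable {f : E → ℝ} {lam A : ℝ}

/-- The union of the cubes. -/
def U (D : CZDecomp f lam A) : Set E := ⋃ i, D.Q i

/-- The average of `f` over a cube. -/
def avg (D : CZDecomp f lam A) (i : D.ι) : ℝ := (∫ x in D.Q i, f x) / volume.real (D.Q i)

open Classical in
/-- The good part. -/
def good (D : CZDecomp f lam A) (x : E) : ℝ :=
  if x ∈ D.U then (∑' i, (D.Q i).indicator (fun _ => ENNReal.ofReal (D.avg i)) x).toReal
  else min (f x) lam

lemma measurableSet_U (D : CZDecomp f lam A) : MeasurableSet D.U :=
  MeasurableSet.iUnion D.measurableSet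

lemma volumeReal_pos (D : CZDecomp f lam A) (i : D.ι) : 0 < volume.real (D.Q i) := by
  have h1 : 0 < volume.real (Metric.closedBall (D.c i) (D.r i)) :=
    ENNReal.toReal_pos (Metric.measure_closedBall_pos _ _ (D.r_pos i)).ne'
      (isCompact_closedBall _ _).measure_lt_top.ne
  rcases measureReal_nonneg.eq_or_lt (a := 0) (b := volume.real (D.Q i)) with h | h
  · have := D.volume_le i
    rw [← h, mul_zero] at this
    linarith
  · exact h

lemma volume_ne_top (D : CZDecomp f lam A) (i : D.ι) : volume (D.Q i) ≠ ∞ := by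
  intro h
  have := D.volumeReal_pos i
  simp [Measure.real, h] at this

lemma lam_le_avg (D : CZDecomp f lam A) (i : D.ι) : lam ≤ D.avg i :=
  (le_div_iff₀ (D.volumeReal_pos i)).2 (D.lam_le i)

lemma avg_le (D : CZDecomp f lam A) (i : D.ι) : D.avg i ≤ A * lam :=
  (div_le_iff₀ (D.volumeReal_pos i)).2 (D.le_lam i)

lemma good_of_mem (D : CZDecomp f lam A) (hlam : 0 < lam) {i : D.ι} {x : E} (hx : x ∈ D.Q i) :
    D.good x = D.avg i := by
  rw [good, if_pos (show x ∈ D.U from mem_iUnion_of_mem i hx), tsum_eq_single i,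
    indicator_of_mem hx,
    ENNReal.toReal_ofReal (hlam.le.trans (D.lam_le_avg i))]
  intro j hj
  exact indicator_of_notMem (fun h => (Set.disjoint_left.1 (D.disjoint hj)) h hx) _

lemma good_of_notMem (D : CZDecomp f lam A) {x : E} (hx : x ∉ D.U) : D.good x = min (f x) lam :=
  if_neg hx

lemma measurable_good (D : CZDecomp f lam A) (hfm : Measurable f) : Measurable D.good := by
  refine Measurable.ite D.measurableSet_U ?_ (hfm.min measurable_const)
  exact (Measurable.tsum fun i => measurable_const.indicator (D.measurableSet i)).ennreal_toReal

lemma good_nonneg (D : CZDecomp f lam A) (hlam : 0 < lam) (hf0 : ∀ x, 0 ≤ f x) (x : E) :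
    0 ≤ D.good x := by
  unfold good
  split_ifs
  · exact ENNReal.toReal_nonneg
  · exact le_min (hf0 x) hlam.le

lemma good_le (D : CZDecomp f lam A) (hlam : 0 < lam) (hA : 1 ≤ A) (x : E) :
    D.good x ≤ A * lam := by
  by_cases hx : x ∈ D.U
  · obtain ⟨i, hi⟩ := mem_iUnion.1 hx
    rw [D.good_of_mem hlam hi]
    exact D.avg_le i
  · rw [D.good_of_notMem hx]
    exact (min_le_right _ _).trans (le_mul_of_one_le_left hlam.le hA)

lemma abs_good_le (D : CZDecomp f lam A) (hlam : 0 < lam) (hA : 1 ≤ A) (hf0 : ∀ x, 0 ≤ f x)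
    (x : E) : |D.good x| ≤ A * lam := by
  rw [abs_of_nonneg (D.good_nonneg hlam hf0 x)]
  exact D.good_le hlam hA x

lemma setLIntegral_good (D : CZDecomp f lam A) (hlam : 0 < lam) (hf : Integrable f)
    (hf0 : ∀ x, 0 ≤ f x) (i : D.ι) : ∫⁻ x in D.Q i, ‖D.good x‖ₑ = ∫⁻ x in D.Q i, ‖f x‖ₑ := by
  have h0 : 0 ≤ D.avg i := hlam.le.trans (D.lam_le_avg i)
  calc ∫⁻ x in D.Q i, ‖D.good x‖ₑ = ∫⁻ _ in D.Q i, ENNReal.ofReal (D.avg i) := by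
        refine setLIntegral_congr_fun (D.measurableSet i) fun x hx => ?_
        rw [D.good_of_mem hlam hx, Real.enorm_of_nonneg h0]
    _ = ENNReal.ofReal (D.avg i * volume.real (D.Q i)) := by
        rw [setLIntegral_const, ENNReal.ofReal_mul h0, ofReal_measureReal (D.volume_ne_top i)]
    _ = ENNReal.ofReal (∫ x in D.Q i, f x) := by
        rw [avg, div_mul_cancel₀ _ (D.volumeReal_pos i).ne']
    _ = _ := by
        rw [ofReal_integral_eq_lintegral_ofReal hf.integrableOn (ae_of_all _ hf0)]
        congr 1 with x
        rw [Real.enorm_of_nonneg (hf0 x)]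

lemma lintegral_good_le (D : CZDecomp f lam A) (hlam : 0 < lam) (hf : Integrable f)
    (hf0 : ∀ x, 0 ≤ f x) : ∫⁻ x, ‖D.good x‖ₑ ≤ ∫⁻ x, ‖f x‖ₑ := by
  rw [← lintegral_add_compl _ D.measurableSet_U, ← lintegral_add_compl (fun x => ‖f x‖ₑ)
    D.measurableSet_U]
  refine add_le_add (le_of_eq ?_) ?_
  · unfold U
    rw [lintegral_iUnion D.measurableSet D.disjoint, lintegral_iUnion D.measurableSet D.disjoint]
    exact tsum_congr fun i => D.setLIntegral_good hlam hf hf0 i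
  · refine setLIntegral_mono' D.measurableSet_U.compl fun x hx => ?_
    rw [Real.enorm_of_nonneg (hf0 x), Real.enorm_of_nonneg (D.good_nonneg hlam hf0 x),
      D.good_of_notMem hx]
    exact ENNReal.ofReal_le_ofReal (min_le_left _ _)

lemma integrable_good (D : CZDecomp f lam A) (hlam : 0 < lam) (hf : Integrable f)
    (hfm : Measurable f) (hf0 : ∀ x, 0 ≤ f x) : Integrable D.good :=
  ⟨(D.measurable_good hfm).aestronglyMeasurable, (D.lintegral_good_le hlam hf hf0).trans_lt hf.2⟩

lemma integral_sub_good (D : CZDecomp f lam A) (hlam : 0 < lam) (hf : Integrable f) (i : D.ι) :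
    ∫ x in D.Q i, (f x - D.good x) = 0 := by
  have e : EqOn (fun x => f x - D.good x) (fun x => f x - D.avg i) (D.Q i) := by
    intro x hx
    beta_reduce
    rw [D.good_of_mem hlam hx]
  rw [setIntegral_congr_fun (D.measurableSet i) e, integral_sub hf.integrableOn
    (integrableOn_const (D.volume_ne_top i)), setIntegral_const, smul_eq_mul, avg,
    mul_div_cancel₀ _ (D.volumeReal_pos i).ne', sub_self]

lemma ae_sub_good_eq_zero (D : CZDecomp f lam A) :
    ∀ᵐ x, x ∉ D.U → f x - D.good x = 0 := by
  filter_upwards [D.ae_le] with x hx hxU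
  rw [D.good_of_notMem hxU, min_eq_left (hx hxU), sub_self]

lemma tsum_volume_le (D : CZDecomp f lam A) (hf : Integrable f) (hf0 : ∀ x, 0 ≤ f x) :
    ENNReal.ofReal lam * ∑' i, volume (D.Q i) ≤ ∫⁻ x, ‖f x‖ₑ := by
  rw [← ENNReal.tsum_mul_left]
  calc ∑' i, ENNReal.ofReal lam * volume (D.Q i) ≤ ∑' i, ∫⁻ x in D.Q i, ‖f x‖ₑ := by
        refine ENNReal.tsum_le_tsum fun i => ?_
        rw [← ofReal_measureReal (D.volume_ne_top i), ← ENNReal.ofReal_mul' measureReal_nonneg]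
        refine (ENNReal.ofReal_le_ofReal (D.lam_le i)).trans_eq ?_
        rw [ofReal_integral_eq_lintegral_ofReal hf.integrableOn (ae_of_all _ hf0)]
        congr 1 with x
        rw [Real.enorm_of_nonneg (hf0 x)]
    _ = ∫⁻ x in D.U, ‖f x‖ₑ := (lintegral_iUnion D.measurableSet D.disjoint _).symm
    _ ≤ _ := setLIntegral_le_lintegral _ _

/-- The union of the dilated balls. -/
def Ustar (D : CZDecomp f lam A) : Set E := ⋃ i, Metric.ball (D.c i) (4 * D.r i)

lemma measurableSet_Ustar (D : CZDecomp f lam A) : MeasurableSet D.Ustar :=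
  MeasurableSet.iUnion fun _ => measurableSet_ball

lemma U_subset_Ustar (D : CZDecomp f lam A) : D.U ⊆ D.Ustar :=
  iUnion_mono fun i => (D.subset i).trans (Metric.closedBall_subset_ball (by
    have := D.r_pos i; linarith))

lemma volume_Ustar_le (D : CZDecomp f lam A) (hA : 1 ≤ A) (hf : Integrable f)
    (hf0 : ∀ x, 0 ≤ f x) :
    ENNReal.ofReal lam * volume D.Ustar ≤
      ENNReal.ofReal (4 ^ Module.finrank ℝ E * A) * ∫⁻ x, ‖f x‖ₑ := by
  have h1 : ∀ i, volume (Metric.ball (D.c i) (4 * D.r i)) ≤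
      ENNReal.ofReal (4 ^ Module.finrank ℝ E * A) * volume (D.Q i) := by
    intro i
    have hr := D.r_pos i
    have h2 : volume (Metric.closedBall (D.c i) (D.r i)) ≤ ENNReal.ofReal A * volume (D.Q i) := by
      rw [← ofReal_measureReal (D.volume_ne_top i), ← ENNReal.ofReal_mul (by linarith),
        ← ofReal_measureReal (isCompact_closedBall _ _).measure_lt_top.ne]
      exact ENNReal.ofReal_le_ofReal (D.volume_le i)
    calc _ ≤ volume (Metric.closedBall (D.c i) (4 * D.r i)) :=
          measure_mono Metric.ball_subset_closedBall
      _ = ENNReal.ofReal (4 ^ Module.finrank ℝ E) *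
          volume (Metric.closedBall (D.c i) (D.r i)) := by
          rw [volume_closedBall_eq _ (by positivity), volume_closedBall_eq _ hr, mul_pow,
            ENNReal.ofReal_mul (by positivity), mul_assoc]
      _ ≤ _ := by
          rw [ENNReal.ofReal_mul (by positivity), mul_assoc]
          gcongr
  calc ENNReal.ofReal lam * volume D.Ustar
      ≤ ENNReal.ofReal lam * ∑' i, ENNReal.ofReal (4 ^ Module.finrank ℝ E * A) *
          volume (D.Q i) := by
        gcongr
        exact (measure_iUnion_le _).trans (ENNReal.tsum_le_tsum h1)
    _ = ENNReal.ofReal (4 ^ Module.finrank ℝ E * A) *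
          (ENNReal.ofReal lam * ∑' i, volume (D.Q i)) := by
        rw [ENNReal.tsum_mul_left]; ring
    _ ≤ _ := by
        gcongr
        exact D.tsum_volume_le hf hf0

/-- The oscillation of the kernel against `f + good` on one cube. -/
def osc (D : CZDecomp f lam A) (K : E → ℝ) (x : E) (i : D.ι) : ℝ≥0∞ :=
  ∫⁻ y in D.Q i, ‖K (x - y) - K (x - D.c i)‖ₑ * (‖f y‖ₑ + ‖D.good y‖ₑ)

lemma measurable_osc (D : CZDecomp f lam A) {K : E → ℝ} (hK : DiniKernel K) (hfm : Measurable f)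
    (i : D.ι) : Measurable fun x => D.osc K x i := by
  have := hK.measurable
  have := D.measurable_good hfm
  refine Measurable.lintegral_prod_right' (f := fun p : E × E =>
    ‖K (p.1 - p.2) - K (p.1 - D.c i)‖ₑ * (‖f p.2‖ₑ + ‖D.good p.2‖ₑ)) ?_
  fun_prop

lemma lintegral_osc_le (D : CZDecomp f lam A) {K : E → ℝ} (hK : DiniKernel K) (hlam : 0 < lam)
    (hf : Integrable f) (hfm : Measurable f) (hf0 : ∀ x, 0 ≤ f x) :
    ∫⁻ x in D.Ustarᶜ, ∑' i, D.osc K x i ≤ 2 * diniTail K 0 * ∫⁻ x, ‖f x‖ₑ := by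
  have hKm := hK.measurable
  have hgm := D.measurable_good hfm
  rw [lintegral_tsum fun i => (D.measurable_osc hK hfm i).aemeasurable]
  have h1 : ∀ i, ∫⁻ x in D.Ustarᶜ, D.osc K x i ≤
      diniTail K 0 * (2 * ∫⁻ y in D.Q i, ‖f y‖ₑ) := by
    intro i
    calc ∫⁻ x in D.Ustarᶜ, D.osc K x i
        = ∫⁻ y in D.Q i, ∫⁻ x in D.Ustarᶜ,
            ‖K (x - y) - K (x - D.c i)‖ₑ * (‖f y‖ₑ + ‖D.good y‖ₑ) := by
          unfold osc
          rw [lintegral_lintegral_swap]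
          apply Measurable.aemeasurable
          simp only [Function.uncurry_def]
          fun_prop
      _ ≤ ∫⁻ y in D.Q i, diniTail K 0 * (‖f y‖ₑ + ‖D.good y‖ₑ) := by
          refine setLIntegral_mono' (D.measurableSet i) fun y hy => ?_
          rw [lintegral_mul_const' _ _ (by simp)]
          gcongr
          have hy' := D.subset i hy
          rw [Metric.mem_closedBall, dist_eq_norm] at hy'
          refine le_trans ?_ (hK.hormander 0 (y - D.c i))
          rw [← lintegral_indicator D.measurableSet_Ustar.compl,
            ← lintegral_indicator (measurableSet_le measurable_const measurable_norm)]
          conv_rhs => rw [← lintegral_sub_right_eq_self _ (D.c i)]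
          refine lintegral_mono fun x => ?_
          by_cases hx : x ∈ D.Ustarᶜ
          · rw [indicator_of_mem hx, indicator_of_mem]
            · rw [sub_sub_sub_cancel_right]
            · have : x ∉ Metric.ball (D.c i) (4 * D.r i) := fun h => hx (mem_iUnion_of_mem i h)
              rw [Metric.mem_ball, dist_eq_norm, not_lt] at this
              refine le_trans ?_ this
              norm_num
              linarith
          · rw [indicator_of_notMem hx]
            exact zero_le
      _ = _ := by
          rw [lintegral_const_mul _ (by fun_prop), lintegral_add_left hfm.enorm,
            D.setLIntegral_good hlam hf hf0, two_mul]
  calc _ ≤ ∑' i, diniTail K 0 * (2 * ∫⁻ y in D.Q i, ‖f y‖ₑ) := ENNReal.tsum_le_tsum h1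
    _ = 2 * diniTail K 0 * ∫⁻ x in D.U, ‖f x‖ₑ := by
        rw [ENNReal.tsum_mul_left, ENNReal.tsum_mul_left, U,
          lintegral_iUnion D.measurableSet D.disjoint]
        ring
    _ ≤ _ := by
        gcongr
        exact Measure.restrict_le_self

end CZDecomp

lemma DiniKernel.lintegral_annulus_translate {K : E → ℝ} (hK : DiniKernel K) (G : E → ℝ) (x : E)
    {ε : ℝ} (hε : 0 < ε) (a b : ℝ) :
    ∫⁻ y, (annulus E (a * ε) (b * ε)).indicator (fun z => ‖K z‖ₑ) (x - y) * ‖G y‖ₑ =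
      ∫⁻ w, (annulus E a b).indicator (fun z => ‖K z‖ₑ) w * ‖G (x - ε • w)‖ₑ := by
  rw [← lintegral_sub_left_eq_self _ x, lintegral_comp_smul _ hε,
    ← lintegral_const_mul' _ _ ENNReal.ofReal_ne_top]
  congr 1 with w
  rw [sub_sub_cancel, ← mul_assoc]
  congr 1
  have hp : 0 < ε ^ Module.finrank ℝ E := by positivity
  by_cases hw : w ∈ annulus E a b
  · rw [indicator_of_mem hw, indicator_of_mem, hK.homog ε hε, enorm_mul, ← mul_assoc,
      ← Real.enorm_of_nonneg hp.le, ← enorm_mul, mul_inv_cancel₀ hp.ne', enorm_one, one_mul]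
    constructor
    · rw [norm_smul, Real.norm_of_nonneg hε.le, mul_comm a]; exact mul_lt_mul_of_pos_left hw.1 hε
    · rw [norm_smul, Real.norm_of_nonneg hε.le, mul_comm b]
      exact mul_le_mul_of_nonneg_left hw.2 hε.le
  · rw [indicator_of_notMem hw, indicator_of_notMem, mul_zero]
    intro h
    apply hw
    have h1 := h.1
    have h2 := h.2
    rw [norm_smul, Real.norm_of_nonneg hε.le] at h1 h2
    exact ⟨lt_of_mul_lt_mul_left (by linarith) hε.le, le_of_mul_le_mul_left (by linarith) hε⟩

namespace CZDecomp

variable {f : E → ℝ} {lam A : ℝ}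

/-- The contribution of one cube to the limit of the bad part. -/
def badTerm (D : CZDecomp f lam A) (K : E → ℝ) (x : E) (i : D.ι) : ℝ :=
  ∫ y in D.Q i, (K (x - y) - K (x - D.c i)) * (f y - D.good y)

/-- The contribution of one cube to the truncated integral of the bad part. -/
def badTrunc (D : CZDecomp f lam A) (K : E → ℝ) (x : E) (ε : ℝ) (i : D.ι) : ℝ :=
  ∫ y in D.Q i ∩ {y | ε < ‖x - y‖}, K (x - y) * (f y - D.good y)

lemma enorm_badTerm_le (D : CZDecomp f lam A) (K : E → ℝ) (x : E) (i : D.ι) :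
    ‖D.badTerm K x i‖ₑ ≤ D.osc K x i := by
  refine (enorm_integral_le_lintegral_enorm _).trans (lintegral_mono fun y => ?_)
  rw [enorm_mul]
  gcongr
  exact enorm_sub_le

lemma norm_sub_center_le (D : CZDecomp f lam A) {x : E} (hx : x ∉ D.Ustar) (i : D.ι) :
    4 * D.r i ≤ ‖x - D.c i‖ := by
  have : x ∉ Metric.ball (D.c i) (4 * D.r i) := fun h => hx (mem_iUnion_of_mem i h)
  rwa [Metric.mem_ball, dist_eq_norm, not_lt] at this

lemma norm_sub_mem_le (D : CZDecomp f lam A) {i : D.ι} {y : E} (hy : y ∈ D.Q i) :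
    ‖y - D.c i‖ ≤ D.r i := by
  have := D.subset i hy
  rwa [Metric.mem_closedBall, dist_eq_norm] at this

lemma lintegral_kernel_le (D : CZDecomp f lam A) {K : E → ℝ} (hK : DiniKernel K) (hlam : 0 < lam)
    (hf : Integrable f) (hfm : Measurable f) (hf0 : ∀ x, 0 ≤ f x) (x : E) (i : D.ι) :
    ∫⁻ y in D.Q i, ‖K (x - y) * (f y - D.good y)‖ₑ ≤
      D.osc K x i + 2 * ∫⁻ y in D.Q i, ‖K (x - y)‖ₑ * ‖D.good y‖ₑ := by
  have hKm := hK.measurable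
  have hgm := D.measurable_good hfm
  set k := ‖K (x - D.c i)‖ₑ with hk
  have a1 : ∀ y, ‖K (x - y)‖ₑ ≤ ‖K (x - y) - K (x - D.c i)‖ₑ + k := fun y => by
    calc _ = ‖K (x - y) - K (x - D.c i) + K (x - D.c i)‖ₑ := by congr 1; ring
      _ ≤ _ := enorm_add_le _ _
  have a2 : ∀ y, k ≤ ‖K (x - y) - K (x - D.c i)‖ₑ + ‖K (x - y)‖ₑ := fun y => by
    calc _ = ‖K (x - y) - (K (x - y) - K (x - D.c i))‖ₑ := by rw [hk]; congr 1; ring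
      _ ≤ _ := enorm_sub_le
      _ = _ := add_comm _ _
  have b1 : k * ∫⁻ y in D.Q i, ‖f y‖ₑ ≤
      (∫⁻ y in D.Q i, ‖K (x - y) - K (x - D.c i)‖ₑ * ‖D.good y‖ₑ) +
        ∫⁻ y in D.Q i, ‖K (x - y)‖ₑ * ‖D.good y‖ₑ := by
    rw [← D.setLIntegral_good hlam hf hf0, ← lintegral_const_mul _ hgm.enorm,
      ← lintegral_add_left (by fun_prop)]
    refine lintegral_mono fun y => ?_
    rw [← add_mul]
    gcongr
    exact a2 y
  calc ∫⁻ y in D.Q i, ‖K (x - y) * (f y - D.good y)‖ₑ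
      ≤ ∫⁻ y in D.Q i, (‖K (x - y) - K (x - D.c i)‖ₑ * ‖f y‖ₑ + k * ‖f y‖ₑ +
          ‖K (x - y)‖ₑ * ‖D.good y‖ₑ) := by
        refine lintegral_mono fun y => ?_
        rw [enorm_mul, ← add_mul]
        calc _ ≤ ‖K (x - y)‖ₑ * (‖f y‖ₑ + ‖D.good y‖ₑ) := by gcongr; exact enorm_sub_le
          _ = ‖K (x - y)‖ₑ * ‖f y‖ₑ + ‖K (x - y)‖ₑ * ‖D.good y‖ₑ := mul_add _ _ _
          _ ≤ _ := by gcongr; exact a1 y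
    _ = (∫⁻ y in D.Q i, ‖K (x - y) - K (x - D.c i)‖ₑ * ‖f y‖ₑ) +
          k * (∫⁻ y in D.Q i, ‖f y‖ₑ) + ∫⁻ y in D.Q i, ‖K (x - y)‖ₑ * ‖D.good y‖ₑ := by
        rw [lintegral_add_left (by fun_prop), lintegral_add_left (by fun_prop),
          lintegral_const_mul _ hfm.enorm]
    _ ≤ (∫⁻ y in D.Q i, ‖K (x - y) - K (x - D.c i)‖ₑ * ‖f y‖ₑ) +
          ((∫⁻ y in D.Q i, ‖K (x - y) - K (x - D.c i)‖ₑ * ‖D.good y‖ₑ) +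
        ∫⁻ y in D.Q i, ‖K (x - y)‖ₑ * ‖D.good y‖ₑ) +
          ∫⁻ y in D.Q i, ‖K (x - y)‖ₑ * ‖D.good y‖ₑ := by gcongr
    _ = _ := by
        unfold osc
        simp_rw [mul_add]
        rw [lintegral_add_left (by fun_prop), two_mul]
        ring

lemma enorm_badTrunc_sub_le (D : CZDecomp f lam A) {K : E → ℝ} (hK : DiniKernel K) (hlam : 0 < lam)
    (hf : Integrable f) (hfm : Measurable f) (hf0 : ∀ x, 0 ≤ f x) {x : E} (hx : x ∉ D.Ustar)
    (hib : ∀ ε > 0, IntegrableOn (fun y => K (x - y) * (f y - D.good y)) {y | ε < ‖x - y‖})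
    {ε : ℝ} (hε : 0 < ε) (i : D.ι) :
    ‖D.badTrunc K x ε i - D.badTerm K x i‖ₑ ≤
      {i | ‖x - D.c i‖ ≤ 2 * ε}.indicator (fun i => 2 * D.osc K x i) i +
      2 * ∫⁻ y in D.Q i, (annulus E (1 / 3 * ε) (2 * ε)).indicator (fun z => ‖K z‖ₑ) (x - y) *
        ‖D.good y‖ₑ := by
  have hr := D.r_pos i
  have hc := D.norm_sub_center_le hx i
  have hxy : ∀ y ∈ D.Q i, ‖x - D.c i‖ - D.r i ≤ ‖x - y‖ ∧ ‖x - y‖ ≤ ‖x - D.c i‖ + D.r i := by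
    intro y hy
    have h1 := D.norm_sub_mem_le hy
    have h2 : ‖x - D.c i‖ ≤ ‖x - y‖ + ‖y - D.c i‖ := norm_sub_le_norm_sub_add_norm_sub ..
    have h3 : ‖x - y‖ ≤ ‖x - D.c i‖ + ‖y - D.c i‖ := by
      rw [norm_sub_rev y]; exact norm_sub_le_norm_sub_add_norm_sub ..
    constructor <;> linarith
  by_cases hA : ∀ y ∈ D.Q i, ε < ‖x - y‖
  · have hsub : D.Q i ⊆ {y | ε < ‖x - y‖} := hA
    have e : D.badTrunc K x ε i = D.badTerm K x i := by
      have hi : IntegrableOn (fun y => K (x - y) * (f y - D.good y)) (D.Q i) :=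
        (hib ε hε).mono_set hA
      have hi2 : IntegrableOn (fun y => K (x - D.c i) * (f y - D.good y)) (D.Q i) :=
        ((hf.sub (D.integrable_good hlam hf hfm hf0)).const_mul _).integrableOn
      unfold badTrunc badTerm
      simp_rw [sub_mul]
      rw [inter_eq_left.2 hsub, integral_sub hi hi2, integral_const_mul,
        D.integral_sub_good hlam hf, mul_zero, sub_zero]
    rw [e, sub_self, enorm_zero]
    exact zero_le
  push Not at hA
  obtain ⟨y₁, hy₁, hy₁ε⟩ := hA
  have hmem : i ∈ {i | ‖x - D.c i‖ ≤ 2 * ε} := by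
    have := (hxy y₁ hy₁).1
    show ‖x - D.c i‖ ≤ 2 * ε
    linarith
  rw [indicator_of_mem hmem]
  by_cases hB : ∀ y ∈ D.Q i, ‖x - y‖ ≤ ε
  · have e : D.badTrunc K x ε i = 0 := by
      unfold badTrunc
      rw [show D.Q i ∩ {y | ε < ‖x - y‖} = ∅ from ?_]
      · simp
      · ext y
        simp only [mem_inter_iff, mem_ofPred_eq, mem_empty_iff_false, iff_false, not_and, not_lt]
        exact hB y
    rw [e, zero_sub, enorm_neg]
    refine (D.enorm_badTerm_le K x i).trans (le_trans ?_ le_self_add)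
    rw [two_mul]
    exact le_self_add
  push Not at hB
  obtain ⟨y₂, hy₂, hy₂ε⟩ := hB
  have hann : ∀ y ∈ D.Q i, x - y ∈ annulus E (1 / 3 * ε) (2 * ε) := by
    intro y hy
    have h1 := hxy y hy
    have h2 := hxy y₁ hy₁
    have h3 := hxy y₂ hy₂
    constructor <;> linarith
  calc ‖D.badTrunc K x ε i - D.badTerm K x i‖ₑ
      ≤ ‖D.badTrunc K x ε i‖ₑ + ‖D.badTerm K x i‖ₑ := enorm_sub_le
    _ ≤ (D.osc K x i + 2 * ∫⁻ y in D.Q i, ‖K (x - y)‖ₑ * ‖D.good y‖ₑ) + D.osc K x i := by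
        refine add_le_add ?_ (D.enorm_badTerm_le K x i)
        refine (enorm_integral_le_lintegral_enorm _).trans ?_
        exact (lintegral_mono_set inter_subset_left).trans
          (D.lintegral_kernel_le hK hlam hf hfm hf0 x i)
    _ = 2 * D.osc K x i + 2 * ∫⁻ y in D.Q i, ‖K (x - y)‖ₑ * ‖D.good y‖ₑ := by ring
    _ = _ := by
        congr 2
        refine setLIntegral_congr_fun (D.measurableSet i) fun y hy => ?_
        rw [indicator_of_mem (hann y hy)]

lemma hasSum_badTrunc (D : CZDecomp f lam A) {K : E → ℝ} {x : E} {ε : ℝ}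
    (hif : IntegrableOn (fun y => K (x - y) * f y) {y | ε < ‖x - y‖})
    (hig : IntegrableOn (fun y => K (x - y) * D.good y) {y | ε < ‖x - y‖}) :
    HasSum (D.badTrunc K x ε) (truncInt K f x ε - truncInt K D.good x ε) := by
  have hS := measurableSet_lt_norm_sub x ε
  have hib : IntegrableOn (fun y => K (x - y) * (f y - D.good y)) {y | ε < ‖x - y‖} := by
    simp_rw [mul_sub]
    exact hif.sub hig
  have e : truncInt K f x ε - truncInt K D.good x ε =
      ∫ y in ⋃ i, D.Q i ∩ {y | ε < ‖x - y‖}, K (x - y) * (f y - D.good y) := by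
    unfold truncInt
    rw [← integral_sub hif hig, ← iUnion_inter]
    simp_rw [← mul_sub]
    refine setIntegral_eq_of_subset_of_ae_sdiff_eq_zero hS.nullMeasurableSet inter_subset_right ?_
    filter_upwards [D.ae_sub_good_eq_zero] with y hy hyd
    rw [hy fun h => hyd.2 ⟨h, hyd.1⟩, mul_zero]
  rw [e]
  refine hasSum_integral_iUnion (fun i => (D.measurableSet i).inter hS) ?_ (hib.mono_set ?_)
  · intro i j hij
    exact (D.disjoint hij).mono inter_subset_left inter_subset_left
  · rw [← iUnion_inter]
    exact inter_subset_right

theorem tendsto_bad (D : CZDecomp f lam A) {K : E → ℝ} (hK : DiniKernel K) (hlam : 0 < lam)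
    (hA : 1 ≤ A) (hf : Integrable f) (hfm : Measurable f) (hf0 : ∀ x, 0 ≤ f x) {x : E}
    (hx : x ∉ D.Ustar) (hosc : ∑' i, D.osc K x i ≠ ∞)
    (hL : LebesguePoint (D.U.indicator D.good) x)
    (hif : ∀ ε > 0, IntegrableOn (fun y => K (x - y) * f y) {y | ε < ‖x - y‖})
    (hig : ∀ ε > 0, IntegrableOn (fun y => K (x - y) * D.good y) {y | ε < ‖x - y‖}) :
    ∃ τ : ℝ, ‖τ‖ₑ ≤ ∑' i, D.osc K x i ∧
      Tendsto (fun ε => truncInt K f x ε - truncInt K D.good x ε) (𝓝[>] 0) (𝓝 τ) := by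
  have hib : ∀ ε > 0, IntegrableOn (fun y => K (x - y) * (f y - D.good y)) {y | ε < ‖x - y‖} := by
    intro ε hε
    simp_rw [mul_sub]
    exact (hif ε hε).sub (hig ε hε)
  have hoi : ∀ i, D.osc K x i ≠ ∞ := ENNReal.ne_top_of_tsum_ne_top hosc
  have hsum : Summable (D.badTerm K x) := by
    refine Summable.of_norm_bounded (ENNReal.summable_toReal hosc) fun i => ?_
    rw [← toReal_enorm]
    exact ENNReal.toReal_mono (hoi i) (D.enorm_badTerm_le K x i)
  refine ⟨∑' i, D.badTerm K x i, (enorm_tsum_le_tsum_enorm).trans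
    (ENNReal.tsum_le_tsum (D.enorm_badTerm_le K x)), ?_⟩
  set G := D.U.indicator D.good with hG
  have hG0 : G x = 0 := indicator_of_notMem (fun h => hx (D.U_subset_Ustar h)) _
  set J : E → ℝ≥0∞ := (annulus E (1 / 3) 2).indicator (fun z => ‖K z‖ₑ) with hJ
  have hJm : Measurable J := hK.measurable.enorm.indicator (measurableSet_annulus _ _)
  have hJi : ∫⁻ z, J z ≠ ∞ := by
    rw [hJ, lintegral_indicator (measurableSet_annulus _ _)]
    exact (hK.lintegral_annulus_lt_top (by norm_num) _).ne
  set φ : ℝ → ℝ≥0∞ := fun ε => ∑' i, {i | ‖x - D.c i‖ ≤ 2 * ε}.indicator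
    (fun i => 2 * D.osc K x i) i
  set ψ : ℝ → ℝ≥0∞ := fun ε => 2 * ∫⁻ w, J w * ‖G (x - ε • w) - G x‖ₑ
  have hφ : Tendsto φ (𝓝[>] 0) (𝓝 0) := by
    have h0 : (0 : ℝ≥0∞) = ∫⁻ _ : D.ι, 0 ∂(@Measure.count D.ι ⊤) := by simp
    let _ : MeasurableSpace D.ι := ⊤
    simp only [φ, ← lintegral_count]
    rw [h0]
    refine tendsto_lintegral_filter_of_dominated_convergence (fun i => 2 * D.osc K x i)
      (Eventually.of_forall fun _ => measurable_from_top)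
      (Eventually.of_forall fun ε => ae_of_all _ fun i => indicator_le_self _ _ _) ?_
      (ae_of_all _ fun i => ?_)
    · rw [lintegral_count, ENNReal.tsum_mul_left]
      exact ENNReal.mul_ne_top (by simp) hosc
    · apply tendsto_const_nhds.congr'
      have hpos : 0 < ‖x - D.c i‖ / 2 := by
        have := D.norm_sub_center_le hx i
        have := D.r_pos i
        linarith
      filter_upwards [nhdsWithin_le_nhds (Iio_mem_nhds hpos)] with ε hε
      rw [indicator_of_notMem]
      intro h
      have h : ‖x - D.c i‖ ≤ 2 * ε := h
      have hε : ε < ‖x - D.c i‖ / 2 := hε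
      linarith
  have hGb : ∀ y, |G y| ≤ A * lam := by
    intro y
    by_cases hy : y ∈ D.U
    · rw [hG, indicator_of_mem hy]; exact D.abs_good_le hlam hA hf0 y
    · rw [hG, indicator_of_notMem hy, abs_zero]; positivity
  have hψ : Tendsto ψ (𝓝[>] 0) (𝓝 0) := by
    have := ENNReal.Tendsto.const_mul (a := 2) (hL.tendsto hGb hJi hJm) (Or.inr (by simp))
    rwa [mul_zero] at this
  rw [tendsto_iff_edist_tendsto_0]
  have hlim : Tendsto (fun ε => φ ε + ψ ε) (𝓝[>] 0) (𝓝 0) := by simpa using hφ.add hψ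
  refine tendsto_of_tendsto_of_tendsto_of_le_of_le' tendsto_const_nhds hlim
    (Eventually.of_forall fun _ => zero_le) ?_
  filter_upwards [self_mem_nhdsWithin] with ε hε
  have hε : 0 < ε := hε
  rw [edist_eq_enorm_sub, ← (D.hasSum_badTrunc (hif ε hε) (hig ε hε)).tsum_eq,
    ← (D.hasSum_badTrunc (hif ε hε) (hig ε hε)).summable.tsum_sub hsum]
  refine enorm_tsum_le_tsum_enorm.trans ((ENNReal.tsum_le_tsum fun i =>
    D.enorm_badTrunc_sub_le hK hlam hf hfm hf0 hx hib hε i).trans_eq ?_)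
  rw [ENNReal.tsum_add, ENNReal.tsum_mul_left]
  congr 2
  rw [hG0, ← lintegral_iUnion D.measurableSet D.disjoint]
  simp_rw [sub_zero]
  change ∫⁻ y in D.U, _ = _
  rw [hJ, ← hK.lintegral_annulus_translate G x hε, ← lintegral_indicator D.measurableSet_U]
  congr 1 with y
  by_cases hy : y ∈ D.U
  · rw [indicator_of_mem hy, hG, indicator_of_mem hy]
  · rw [indicator_of_notMem hy, hG, indicator_of_notMem hy, enorm_zero, mul_zero]

end CZDecomp

/-- The points at which the principal value fails to exist or exceeds `lam` in absolute value. -/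
def exceptional (K f : E → ℝ) (lam : ℝ) : Set E :=
  {x | ¬ ∃ l : ℝ, Tendsto (truncInt K f x) (𝓝[>] 0) (𝓝 l) ∧ |l| ≤ lam}

/-- The constant in the weak type `(1, 1)` inequality. -/
def weakConst (K : E → ℝ) (A : ℝ) : ℝ≥0∞ :=
  ENNReal.ofReal (4 ^ Module.finrank ℝ E * A) + 4 * diniTail K 0 +
    4 * multBound K ^ 2 * ENNReal.ofReal A

lemma DiniKernel.weakConst_lt_top {K : E → ℝ} (hK : DiniKernel K) (A : ℝ) : weakConst K A < ∞ := by
  have h1 := hK.diniTail_lt_top 0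
  have h2 := hK.multBound_lt_top
  refine ENNReal.add_lt_top.2 ⟨ENNReal.add_lt_top.2 ⟨ENNReal.ofReal_lt_top, ?_⟩, ?_⟩
  · exact ENNReal.mul_lt_top (by simp) h1
  · exact ENNReal.mul_lt_top (ENNReal.mul_lt_top (by simp) (ENNReal.pow_lt_top h2))
      ENNReal.ofReal_lt_top

namespace CZDecomp
variable {f : E → ℝ} {lam A : ℝ}

lemma eLpNorm_good_sq_le (D : CZDecomp f lam A) (hlam : 0 < lam) (hA : 1 ≤ A)
    (hf : Integrable f) (hf0 : ∀ x, 0 ≤ f x) :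
    eLpNorm D.good 2 volume ^ 2 ≤ ENNReal.ofReal (A * lam) * ∫⁻ x, ‖f x‖ₑ := by
  have h := eLpNorm_nnreal_pow_eq_lintegral (f := D.good) (μ := volume) (p := 2) (by simp)
  simp only [ENNReal.coe_ofNat, NNReal.coe_ofNat, ENNReal.rpow_ofNat] at h
  rw [h]
  calc ∫⁻ x, ‖D.good x‖ₑ ^ 2 ≤ ∫⁻ x, ENNReal.ofReal (A * lam) * ‖D.good x‖ₑ := by
        refine lintegral_mono fun x => ?_
        rw [sq]
        gcongr
        rw [Real.enorm_eq_ofReal_abs]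
        exact ENNReal.ofReal_le_ofReal (D.abs_good_le hlam hA hf0 x)
    _ = ENNReal.ofReal (A * lam) * ∫⁻ x, ‖D.good x‖ₑ :=
        lintegral_const_mul' _ _ ENNReal.ofReal_ne_top
    _ ≤ _ := mul_le_mul_right (D.lintegral_good_le hlam hf hf0) _

theorem weak_type (D : CZDecomp f lam A) {K : E → ℝ} (hK : DiniKernel K) (hlam : 0 < lam)
    (hA : 1 ≤ A) (hf : Integrable f) (hfm : Measurable f) (hf0 : ∀ x, 0 ≤ f x) :
    ENNReal.ofReal lam * volume (exceptional K f lam) ≤ weakConst K A * ∫⁻ x, ‖f x‖ₑ := by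
  have hg := D.integrable_good hlam hf hfm hf0
  have hgm := D.measurable_good hfm
  obtain ⟨h, hh2, hhle, hhlim⟩ := hK.exists_ae_limit hg hgm (D.abs_good_le hlam hA hf0)
  have hosct : ∀ᵐ x, x ∈ D.Ustarᶜ → ∑' i, D.osc K x i ≠ ∞ := by
    rw [← ae_restrict_iff' D.measurableSet_Ustar.compl]
    have hm : Measurable fun x => ∑' i, D.osc K x i := by
      have := D.countable
      exact Measurable.tsum fun i => D.measurable_osc hK hfm i
    refine (ae_lt_top hm ?_).mono fun x hx => hx.ne
    refine ((D.lintegral_osc_le hK hlam hf hfm hf0).trans_lt ?_).ne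
    exact ENNReal.mul_lt_top (ENNReal.mul_lt_top (by simp) (hK.diniTail_lt_top 0)) hf.2
  have hleb : ∀ᵐ x, LebesguePoint (D.U.indicator D.good) x :=
    ae_lebesguePoint (hg.indicator D.measurableSet_U).locallyIntegrable
  set B1 := {x | ENNReal.ofReal (lam / 2) ≤ ∑' i, D.osc K x i} ∩ D.Ustarᶜ with hB1
  set B2 := {x | ENNReal.ofReal (lam / 2) ≤ ‖h x‖ₑ} with hB2
  have hsub : exceptional K f lam ≤ᵐ[volume] (D.Ustar ∪ B1 ∪ B2 : Set E) := by
    filter_upwards [hhlim, hosct, hleb, hK.ae_integrableOn hf hfm, hK.ae_integrableOn hg hgm]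
      with x h1 h2 h3 h4 h5 hx
    by_contra hcon
    have hc : x ∉ D.Ustar ∪ B1 ∪ B2 := hcon
    simp only [mem_union, not_or] at hc
    obtain ⟨⟨hU, hb1⟩, hb2⟩ := hc
    have hb1 : ∑' i, D.osc K x i < ENNReal.ofReal (lam / 2) := by
      by_contra hlt
      exact hb1 ⟨not_lt.1 hlt, hU⟩
    have hb2 : ‖h x‖ₑ < ENNReal.ofReal (lam / 2) := not_le.1 hb2
    obtain ⟨τ, hτ, hlim⟩ := D.tendsto_bad hK hlam hA hf hfm hf0 hU (h2 hU) h3 h4 h5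
    refine hx ⟨τ + h x, ?_, ?_⟩
    · simpa using hlim.add h1
    · have e1 := hτ.trans_lt hb1
      rw [Real.enorm_eq_ofReal_abs, ENNReal.ofReal_lt_ofReal_iff (by positivity)] at e1 hb2
      linarith [abs_add_le τ (h x)]
  have e1 : ENNReal.ofReal lam * volume B1 ≤ 4 * diniTail K 0 * ∫⁻ x, ‖f x‖ₑ := by
    have hm : Measurable fun x => ∑' i, D.osc K x i := by
      have := D.countable
      exact Measurable.tsum fun i => D.measurable_osc hK hfm i
    have := mul_meas_ge_le_lintegral₀ (μ := volume.restrict D.Ustarᶜ) hm.aemeasurable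
      (ENNReal.ofReal (lam / 2))
    rw [Measure.restrict_apply' D.measurableSet_Ustar.compl] at this
    calc ENNReal.ofReal lam * volume B1 = 2 * (ENNReal.ofReal (lam / 2) * volume B1) := by
          rw [← mul_assoc, ← ENNReal.ofReal_ofNat 2, ← ENNReal.ofReal_mul (by norm_num)]
          congr 2
          ring
      _ ≤ 2 * (2 * diniTail K 0 * ∫⁻ x, ‖f x‖ₑ) := by
          exact mul_le_mul_right (this.trans (D.lintegral_osc_le hK hlam hf hfm hf0)) _
      _ = _ := by ring
  have e2 : ENNReal.ofReal lam * volume B2 ≤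
      4 * multBound K ^ 2 * ENNReal.ofReal A * ∫⁻ x, ‖f x‖ₑ := by
    have := mul_meas_ge_le_pow_eLpNorm' (p := 2) volume (by simp) (by simp)
      hh2.aestronglyMeasurable (ENNReal.ofReal (lam / 2))
    simp only [ENNReal.toReal_ofNat, ENNReal.rpow_ofNat] at this
    have hl0 : ENNReal.ofReal lam ≠ 0 := by simpa using hlam
    rw [← ENNReal.mul_le_mul_iff_right hl0 ENNReal.ofReal_ne_top]
    calc ENNReal.ofReal lam * (ENNReal.ofReal lam * volume B2)
        = 4 * (ENNReal.ofReal (lam / 2) ^ 2 * volume B2) := by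
          rw [← mul_assoc, ← mul_assoc, ← ENNReal.ofReal_ofNat 4,
            ← ENNReal.ofReal_pow (by positivity),
            ← ENNReal.ofReal_mul (p := 4) (by norm_num), ← ENNReal.ofReal_mul hlam.le]
          congr 2
          ring
      _ ≤ 4 * (multBound K * eLpNorm D.good 2 volume) ^ 2 := by
          gcongr
          exact this.trans (by gcongr)
      _ = 4 * multBound K ^ 2 * eLpNorm D.good 2 volume ^ 2 := by rw [mul_pow]; ring
      _ ≤ 4 * multBound K ^ 2 * (ENNReal.ofReal (A * lam) * ∫⁻ x, ‖f x‖ₑ) := by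
          gcongr
          exact D.eLpNorm_good_sq_le hlam hA hf hf0
      _ = _ := by rw [ENNReal.ofReal_mul (by linarith)]; ring
  calc ENNReal.ofReal lam * volume (exceptional K f lam)
      ≤ ENNReal.ofReal lam * (volume D.Ustar + volume B1 + volume B2) := by
        gcongr
        exact (measure_mono_ae hsub).trans ((measure_union_le _ _).trans
          (by gcongr; exact measure_union_le _ _))
    _ ≤ _ := by
        rw [mul_add, mul_add, weakConst, add_mul, add_mul]
        exact add_le_add (add_le_add (D.volume_Ustar_le hA hf hf0) e1) e2

end CZDecomp

end WeakType

section SmallLevels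

variable {E : Type*} [NormedAddCommGroup E] [InnerProductSpace ℝ E] [FiniteDimensional ℝ E]
  [MeasurableSpace E] [BorelSpace E]

lemma DiniKernel.volume_superlevel {K : E → ℝ} (hK : DiniKernel K) (hd : 0 < Module.finrank ℝ E)
    {s : ℝ} (hs : 0 < s) :
    volume {x | s < |K x|} = ENNReal.ofReal s⁻¹ * volume {x | 1 < |K x|} := by
  set d := Module.finrank ℝ E
  set r : ℝ := (s⁻¹) ^ ((d : ℝ)⁻¹) with hr
  have hr0 : 0 < r := by positivity
  have hrd : r ^ d = s⁻¹ := Real.rpow_inv_natCast_pow (by positivity) hd.ne'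
  have hm : ∀ s : ℝ, MeasurableSet {x | s < |K x|} := fun s =>
    measurableSet_lt measurable_const (measurable_norm.comp hK.measurable)
  rw [← lintegral_indicator_one (hm s), ← lintegral_indicator_one (hm 1),
    lintegral_comp_smul _ hr0, hrd]
  congr 2 with x
  have key : s < |K (r • x)| ↔ 1 < |K x| := by
    rw [hK.homog r hr0, hrd, inv_inv, abs_mul, abs_of_pos hs]
    exact ⟨fun h => by nlinarith, fun h => by nlinarith⟩
  by_cases h : 1 < |K x|
  · rw [indicator_of_mem (show x ∈ {x | 1 < |K x|} from h),
      indicator_of_mem (show r • x ∈ {x | s < |K x|} from key.2 h)]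
    rfl
  · rw [indicator_of_notMem (show x ∉ {x | 1 < |K x|} from h),
      indicator_of_notMem (show r • x ∉ {x | s < |K x|} from fun h' => h (key.1 h'))]

lemma DiniKernel.mul_volume_superlevel {K : E → ℝ} (hK : DiniKernel K)
    (hd : 0 < Module.finrank ℝ E) {c lam I : ℝ} (hc : 0 < c) (hlam : 0 < lam) (hI : 0 ≤ I) :
    ENNReal.ofReal lam * volume {x | c * lam < |K x * I|} =
      ENNReal.ofReal (c⁻¹ * I) * volume {x | 1 < |K x|} := by
  rcases hI.eq_or_lt with rfl | hI
  · simp [show ¬ c * lam < 0 from not_lt.2 (by positivity)]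
  · have e : {x | c * lam < |K x * I|} = {x | c * lam / I < |K x|} := by
      ext x
      simp only [mem_ofPred_eq]
      rw [abs_mul, abs_of_pos hI, div_lt_iff₀ hI]
    rw [e, hK.volume_superlevel hd (by positivity), ← mul_assoc, ← ENNReal.ofReal_mul hlam.le]
    congr 2
    field_simp

/-- The error made when replacing `K (x - y)` by `K x` in the integral against `f`. -/
def shiftErr (K f : E → ℝ) (x : E) : ℝ≥0∞ := ∫⁻ y, ‖K (x - y) - K x‖ₑ * ‖f y‖ₑ

lemma DiniKernel.measurable_shiftErr {K f : E → ℝ} (hK : DiniKernel K) (hfm : Measurable f) :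
    Measurable (shiftErr K f) := by
  have hKm := hK.measurable
  unfold shiftErr
  exact Measurable.lintegral_prod_right' (f := fun q : E × E => ‖K (q.1 - q.2) - K q.1‖ₑ * ‖f q.2‖ₑ)
    (by fun_prop)

lemma DiniKernel.lintegral_shiftErr_le {K f : E → ℝ} (hK : DiniKernel K) (hfm : Measurable f)
    {r : ℝ} (hfr : ∀ y, r ≤ ‖y‖ → f y = 0) (p : ℕ) :
    ∫⁻ x in {x | 2 ^ (p + 2) * r ≤ ‖x‖}, shiftErr K f x ≤ diniTail K p * ∫⁻ y, ‖f y‖ₑ := by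
  have hKm := hK.measurable
  unfold shiftErr
  rw [lintegral_lintegral_swap (by fun_prop), ← lintegral_const_mul' _ _ (hK.diniTail_lt_top p).ne]
  refine lintegral_mono fun y => ?_
  rw [lintegral_mul_const _ (by fun_prop)]
  rcases le_or_gt r ‖y‖ with h | h
  · simp [hfr y h]
  · gcongr
    refine (lintegral_mono_set fun x hx => ?_).trans (hK.hormander p y)
    have hx : 2 ^ (p + 2) * r ≤ ‖x‖ := hx
    show 2 ^ (p + 2) * ‖y‖ ≤ ‖x‖
    exact le_trans (by gcongr) hx

/-- Away from the support of `f`, the singular integral of `f` is close to `K x * ∫ f`. -/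
lemma exists_tendsto_truncInt {K f : E → ℝ} (hK : DiniKernel K) (hf : Integrable f)
    (hfm : Measurable f) {r : ℝ} (hfr : ∀ y, r ≤ ‖y‖ → f y = 0) {x : E} (hx : r < ‖x‖)
    (herr : shiftErr K f x ≠ ∞) :
    ∃ l : ℝ, Tendsto (truncInt K f x) (𝓝[>] 0) (𝓝 l) ∧
      ‖l - K x * ∫ y, f y‖ₑ ≤ shiftErr K f x := by
  have hKm := hK.measurable
  have hi1 : Integrable (fun y => (K (x - y) - K x) * f y) := by
    refine ⟨by fun_prop, ?_⟩
    simp only [HasFiniteIntegral, enorm_mul]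
    exact lt_top_iff_ne_top.2 herr
  have hi2 : Integrable (fun y => K x * f y) := hf.const_mul _
  refine ⟨∫ y, K (x - y) * f y, ?_, ?_⟩
  · apply tendsto_const_nhds.congr'
    filter_upwards [nhdsWithin_le_nhds (Iio_mem_nhds (sub_pos.2 hx))] with ε hε
    have hε : ε < ‖x‖ - r := hε
    symm
    refine setIntegral_eq_integral_of_forall_compl_eq_zero fun y hy => ?_
    have hy : ¬ ε < ‖x - y‖ := hy
    rw [hfr y, mul_zero]
    have := norm_sub_norm_le x y
    linarith
  · rw [← integral_const_mul, ← integral_sub ?_ hi2]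
    · refine (enorm_integral_le_lintegral_enorm _).trans_eq ?_
      unfold shiftErr
      congr 1 with y
      rw [← sub_mul, enorm_mul]
    · refine (hi1.add hi2).congr (ae_of_all _ fun y => ?_)
      simp only [Pi.add_apply]
      ring

section Asymptotics
variable {K f : E → ℝ} {A : ℝ}

lemma ae_abs_limUnder_sub_le (hK : DiniKernel K) (hf : Integrable f)
    (hfm : Measurable f) {r : ℝ} (hr : 0 < r) (p : ℕ) {δ : ℝ} (hδ : 0 < δ) :
    ∀ᵐ x, x ∉ Metric.ball (0 : E) (2 ^ (p + 2) * r) ∪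
        ({x | ENNReal.ofReal δ ≤ shiftErr K ((Metric.ball 0 r).indicator f) x} ∩
          {x | 2 ^ (p + 2) * r ≤ ‖x‖}) ∪
        exceptional K ((Metric.ball 0 r)ᶜ.indicator f) δ →
      |limUnder (𝓝[>] 0) (truncInt K f x) - K x * ∫ y, (Metric.ball 0 r).indicator f y| ≤
        2 * δ := by
  have hb : MeasurableSet (Metric.ball (0 : E) r) := Metric.isOpen_ball.measurableSet
  set f1 := (Metric.ball 0 r).indicator f with hf1
  set f2 := (Metric.ball 0 r)ᶜ.indicator f with hf2
  have hfr : ∀ y, r ≤ ‖y‖ → f1 y = 0 := fun y hy =>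
    indicator_of_notMem (by simpa using hy) _
  have hadd : f = fun y => f1 y + f2 y := (indicator_self_add_compl _ _).symm
  have i1 : Integrable f1 := hf.indicator hb
  have i2 : Integrable f2 := hf.indicator hb.compl
  have m1 : Measurable f1 := hfm.indicator hb
  have m2 : Measurable f2 := hfm.indicator hb.compl
  filter_upwards [hK.ae_integrableOn i1 m1, hK.ae_integrableOn i2 m2] with x h1 h2 hx
  simp only [mem_union, not_or] at hx
  obtain ⟨⟨hxb, hxe⟩, hxx⟩ := hx
  have hxb : 2 ^ (p + 2) * r ≤ ‖x‖ := by simpa using hxb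
  have hxe : shiftErr K f1 x < ENNReal.ofReal δ := by
    by_contra hcon
    exact hxe ⟨not_lt.1 hcon, hxb⟩
  obtain ⟨l₂, hl₂, hle₂⟩ : ∃ l : ℝ, Tendsto (truncInt K f2 x) (𝓝[>] 0) (𝓝 l) ∧ |l| ≤ δ :=
    not_not.1 hxx
  have hp : (4 : ℝ) ≤ 2 ^ (p + 2) := by
    rw [pow_add]
    nlinarith [one_le_pow₀ (M₀ := ℝ) (n := p) one_le_two]
  obtain ⟨l₁, hl₁, hle₁⟩ := exists_tendsto_truncInt hK i1 m1 hfr (x := x) (by nlinarith)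
    (hxe.trans_le le_top).ne
  have hlim : Tendsto (truncInt K f x) (𝓝[>] 0) (𝓝 (l₁ + l₂)) := by
    refine (hl₁.add hl₂).congr' ?_
    filter_upwards [self_mem_nhdsWithin] with ε hε
    unfold truncInt
    rw [← integral_add (h1 ε hε) (h2 ε hε), hadd]
    simp_rw [mul_add]
  rw [hlim.limUnder_eq]
  have := hle₁.trans_lt hxe
  rw [Real.enorm_eq_ofReal_abs, ENNReal.ofReal_lt_ofReal_iff hδ] at this
  calc |l₁ + l₂ - K x * ∫ y, f1 y| = |(l₁ - K x * ∫ y, f1 y) + l₂| := by ring_nf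
    _ ≤ |l₁ - K x * ∫ y, f1 y| + |l₂| := abs_add_le _ _
    _ ≤ _ := by linarith

/-- The mass of the tails controlling the error terms. -/
def tailMass (K f : E → ℝ) (A : ℝ) (p : ℕ) : ℝ≥0∞ :=
  diniTail K p * (∫⁻ y, ‖f y‖ₑ) +
    weakConst K A * ∫⁻ y, ‖(Metric.ball (0 : E) (p + 1))ᶜ.indicator f y‖ₑ

lemma mul_volume_error_le (hK : DiniKernel K) (hA : 1 ≤ A)
    (hCZ : ∀ f : E → ℝ, Integrable f → (∀ x, 0 ≤ f x) → ∀ lam > 0, Nonempty (CZDecomp f lam A))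
    (hf : Integrable f) (hfm : Measurable f) (hf0 : ∀ x, 0 ≤ f x) (p : ℕ) {δ lam : ℝ} (hδ : 0 < δ)
    (hlam : 0 < lam) :
    ENNReal.ofReal lam * volume (Metric.ball (0 : E) (2 ^ (p + 2) * ((p : ℝ) + 1)) ∪
        ({x | ENNReal.ofReal (δ * lam) ≤ shiftErr K ((Metric.ball 0 ((p : ℝ) + 1)).indicator f) x} ∩
          {x | 2 ^ (p + 2) * ((p : ℝ) + 1) ≤ ‖x‖}) ∪
        exceptional K ((Metric.ball 0 ((p : ℝ) + 1))ᶜ.indicator f) (δ * lam)) ≤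
      ENNReal.ofReal lam * volume (Metric.ball (0 : E) (2 ^ (p + 2) * ((p : ℝ) + 1))) +
        ENNReal.ofReal δ⁻¹ * tailMass K f A p := by
  have hb : MeasurableSet (Metric.ball (0 : E) ((p : ℝ) + 1)) := Metric.isOpen_ball.measurableSet
  set f1 := (Metric.ball 0 ((p : ℝ) + 1)).indicator f with hf1
  set f2 := (Metric.ball 0 ((p : ℝ) + 1))ᶜ.indicator f with hf2
  have hfr : ∀ y, (p : ℝ) + 1 ≤ ‖y‖ → f1 y = 0 := fun y hy =>
    indicator_of_notMem (by simpa using hy) _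
  have i2 : Integrable f2 := hf.indicator hb.compl
  have m1 : Measurable f1 := hfm.indicator hb
  have m2 : Measurable f2 := hfm.indicator hb.compl
  have hf20 : ∀ x, 0 ≤ f2 x := fun x => indicator_nonneg (fun y _ => hf0 y) x
  obtain ⟨D⟩ := hCZ f2 i2 hf20 (δ * lam) (by positivity)
  have e2 := D.weak_type hK (by positivity) hA i2 m2 hf20
  have hm : MeasurableSet {x : E | 2 ^ (p + 2) * ((p : ℝ) + 1) ≤ ‖x‖} :=
    measurableSet_le measurable_const measurable_norm
  have e1 := mul_meas_ge_le_lintegral₀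
    (μ := volume.restrict {x : E | 2 ^ (p + 2) * ((p : ℝ) + 1) ≤ ‖x‖})
    (hK.measurable_shiftErr m1).aemeasurable (ENNReal.ofReal (δ * lam))
  rw [Measure.restrict_apply' hm] at e1
  have e1 := e1.trans (hK.lintegral_shiftErr_le m1 hfr p)
  have hle : ∫⁻ y, ‖f1 y‖ₑ ≤ ∫⁻ y, ‖f y‖ₑ :=
    lintegral_mono fun y => by
      rw [hf1, enorm_indicator_eq_indicator_enorm]
      exact indicator_le_self _ _ _
  have e1 := e1.trans (mul_le_mul_right hle _)
  have hsplit : ENNReal.ofReal lam = ENNReal.ofReal δ⁻¹ * ENNReal.ofReal (δ * lam) := by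
    rw [← ENNReal.ofReal_mul (by positivity)]
    congr 1
    field_simp
  refine (mul_le_mul_right ((measure_union_le _ _).trans
    (add_le_add_left (measure_union_le _ _) _)) _).trans ?_
  rw [add_assoc, mul_add]
  refine add_le_add_right ?_ _
  rw [hsplit, mul_assoc, tailMass, mul_add]
  exact mul_le_mul_right (add_le_add e1 e2) _

end Asymptotics

variable {K f : E → ℝ} {A : ℝ}

lemma mul_volume_limUnder_le (hK : DiniKernel K) (hd : 0 < Module.finrank ℝ E) (hA : 1 ≤ A)
    (hCZ : ∀ f : E → ℝ, Integrable f → (∀ x, 0 ≤ f x) → ∀ lam > 0, Nonempty (CZDecomp f lam A))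
    (hf : Integrable f) (hfm : Measurable f) (hf0 : ∀ x, 0 ≤ f x) (p : ℕ) {δ lam : ℝ} (hδ : 0 < δ)
    (hδ2 : 2 * δ < 1) (hlam : 0 < lam) :
    ENNReal.ofReal lam * volume {x | lam < |limUnder (𝓝[>] 0) (truncInt K f x)|} ≤
      ENNReal.ofReal ((1 - 2 * δ)⁻¹ * ∫ y, (Metric.ball 0 ((p : ℝ) + 1)).indicator f y) *
          volume {x | 1 < |K x|} +
        (ENNReal.ofReal lam * volume (Metric.ball (0 : E) (2 ^ (p + 2) * ((p : ℝ) + 1))) +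
        ENNReal.ofReal δ⁻¹ * tailMass K f A p) := by
  have hI : 0 ≤ ∫ y, (Metric.ball 0 ((p : ℝ) + 1)).indicator f y :=
    integral_nonneg fun y => indicator_nonneg (fun z _ => hf0 z) y
  rw [← hK.mul_volume_superlevel hd (by linarith) hlam hI]
  refine le_trans ?_ (add_le_add_right
    (mul_volume_error_le hK hA hCZ hf hfm hf0 p hδ hlam) _)
  rw [← mul_add]
  refine mul_le_mul_right ((measure_mono_ae ?_).trans (measure_union_le _ _)) _
  filter_upwards [ae_abs_limUnder_sub_le hK hf hfm (r := (p : ℝ) + 1) (by positivity) p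
    (δ := δ * lam) (by positivity)] with x hx hS
  by_contra hcon
  have hcon := not_or.1 hcon
  have h1 := hx hcon.2
  have h2 : |K x * ∫ y, (Metric.ball 0 ((p : ℝ) + 1)).indicator f y| ≤ (1 - 2 * δ) * lam :=
    not_lt.1 hcon.1
  have hS : lam < |limUnder (𝓝[>] 0) (truncInt K f x)| := hS
  have h3 := abs_sub_abs_le_abs_sub (limUnder (𝓝[>] 0) (truncInt K f x))
    (K x * ∫ y, (Metric.ball 0 ((p : ℝ) + 1)).indicator f y)
  nlinarith

lemma le_mul_volume_limUnder (hK : DiniKernel K) (hd : 0 < Module.finrank ℝ E) (hA : 1 ≤ A)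
    (hCZ : ∀ f : E → ℝ, Integrable f → (∀ x, 0 ≤ f x) → ∀ lam > 0, Nonempty (CZDecomp f lam A))
    (hf : Integrable f) (hfm : Measurable f) (hf0 : ∀ x, 0 ≤ f x) (p : ℕ) {δ lam : ℝ} (hδ : 0 < δ)
    (hlam : 0 < lam) :
    ENNReal.ofReal ((1 + 2 * δ)⁻¹ * ∫ y, (Metric.ball 0 ((p : ℝ) + 1)).indicator f y) *
          volume {x | 1 < |K x|} ≤
    ENNReal.ofReal lam * volume {x | lam < |limUnder (𝓝[>] 0) (truncInt K f x)|} +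
        (ENNReal.ofReal lam * volume (Metric.ball (0 : E) (2 ^ (p + 2) * ((p : ℝ) + 1))) +
        ENNReal.ofReal δ⁻¹ * tailMass K f A p) := by
  have hI : 0 ≤ ∫ y, (Metric.ball 0 ((p : ℝ) + 1)).indicator f y :=
    integral_nonneg fun y => indicator_nonneg (fun z _ => hf0 z) y
  rw [← hK.mul_volume_superlevel hd (by linarith) hlam hI]
  refine le_trans ?_ (add_le_add_right
    (mul_volume_error_le hK hA hCZ hf hfm hf0 p hδ hlam) _)
  rw [← mul_add]
  refine mul_le_mul_right ((measure_mono_ae ?_).trans (measure_union_le _ _)) _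
  filter_upwards [ae_abs_limUnder_sub_le hK hf hfm (r := (p : ℝ) + 1) (by positivity) p
    (δ := δ * lam) (by positivity)] with x hx hS
  by_contra hcon
  have hcon := not_or.1 hcon
  have h1 := hx hcon.2
  have hS : (1 + 2 * δ) * lam < |K x * ∫ y, (Metric.ball 0 ((p : ℝ) + 1)).indicator f y| := hS
  have h2 : |limUnder (𝓝[>] 0) (truncInt K f x)| ≤ lam := not_lt.1 hcon.1
  have h3 := abs_sub_abs_le_abs_sub
    (K x * ∫ y, (Metric.ball 0 ((p : ℝ) + 1)).indicator f y) (limUnder (𝓝[>] 0) (truncInt K f x))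
  rw [abs_sub_comm] at h3
  nlinarith

lemma eventually_mem_ball (x : E) : ∀ᶠ p : ℕ in atTop, x ∈ Metric.ball (0 : E) ((p : ℝ) + 1) := by
  obtain ⟨k, hk⟩ := exists_nat_gt ‖x‖
  filter_upwards [eventually_ge_atTop k] with p hp
  have : (k : ℝ) ≤ p := by exact_mod_cast hp
  simp only [mem_ball_zero_iff]
  linarith

lemma tendsto_integral_indicator_ball (hf : Integrable f) :
    Tendsto (fun p : ℕ => ∫ y, (Metric.ball 0 ((p : ℝ) + 1)).indicator f y) atTop
      (𝓝 (∫ y, f y)) := by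
  refine tendsto_integral_of_dominated_convergence (fun y => ‖f y‖)
    (fun p => hf.1.indicator Metric.isOpen_ball.measurableSet) hf.norm
    (fun p => ae_of_all _ fun y => norm_indicator_le_norm_self _ _) (ae_of_all _ fun y => ?_)
  apply tendsto_const_nhds.congr'
  filter_upwards [eventually_mem_ball y] with p hp
  rw [indicator_of_mem hp]

lemma tendsto_tailMass (hK : DiniKernel K) (hf : Integrable f) (hfm : Measurable f) :
    Tendsto (tailMass K f A) atTop (𝓝 0) := by
  have h1 : Tendsto (fun p : ℕ => diniTail K p * ∫⁻ y, ‖f y‖ₑ) atTop (𝓝 0) := by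
    simpa using ENNReal.Tendsto.mul_const hK.tendsto_diniTail (Or.inr hf.2.ne)
  have h2 : Tendsto (fun p : ℕ => ∫⁻ y, ‖(Metric.ball (0 : E) ((p : ℝ) + 1))ᶜ.indicator f y‖ₑ)
      atTop (𝓝 (∫⁻ _ : E, 0)) := by
    refine tendsto_lintegral_of_dominated_convergence (fun y => ‖f y‖ₑ)
      (fun p => (hfm.indicator Metric.isOpen_ball.measurableSet.compl).enorm)
      (fun p => ae_of_all _ fun y => ?_) hf.2.ne (ae_of_all _ fun y => ?_)
    · beta_reduce
      rw [enorm_indicator_eq_indicator_enorm]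
      exact indicator_le_self _ _ _
    · apply tendsto_const_nhds.congr'
      filter_upwards [eventually_mem_ball y] with p hp
      rw [indicator_of_notMem (not_not.2 hp), enorm_zero]
  rw [lintegral_zero] at h2
  have h3 := ENNReal.Tendsto.const_mul h2 (Or.inr (hK.weakConst_lt_top A).ne)
  have h4 := h1.add h3
  rw [mul_zero, add_zero] at h4
  exact h4

theorem tendsto_mul_volume_limUnder (hK : DiniKernel K) (hd : 0 < Module.finrank ℝ E) (hA : 1 ≤ A)
    (hCZ : ∀ f : E → ℝ, Integrable f → (∀ x, 0 ≤ f x) → ∀ lam > 0, Nonempty (CZDecomp f lam A))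
    (hV : volume {x | 1 < |K x|} ≠ ∞)
    (hf : Integrable f) (hfm : Measurable f) (hf0 : ∀ x, 0 ≤ f x) :
    Tendsto (fun lam : ℝ =>
      ENNReal.ofReal lam * volume {x | lam < |limUnder (𝓝[>] 0) (truncInt K f x)|}) (𝓝[>] 0)
      (𝓝 (ENNReal.ofReal (∫ y, f y) * volume {x | 1 < |K x|})) := by
  set V := volume {x | 1 < |K x|}
  set F : ℝ → ℝ≥0∞ := fun lam =>
    ENNReal.ofReal lam * volume {x | lam < |limUnder (𝓝[>] 0) (truncInt K f x)|}
  have hball : ∀ p : ℕ, Tendsto (fun lam : ℝ => ENNReal.ofReal lam *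
      volume (Metric.ball (0 : E) (2 ^ (p + 2) * ((p : ℝ) + 1)))) (𝓝[>] 0) (𝓝 0) := by
    intro p
    have h : Tendsto (fun lam : ℝ => ENNReal.ofReal lam) (𝓝[>] 0) (𝓝 0) := by
      have := (ENNReal.continuous_ofReal.tendsto 0).mono_left (nhdsWithin_le_nhds (s := Ioi 0))
      simpa using this
    simpa using ENNReal.Tendsto.mul_const h (Or.inr measure_ball_lt_top.ne)
  have hmain : ∀ c : ℝ, Tendsto (fun p : ℕ => ENNReal.ofReal (c *
      ∫ y, (Metric.ball 0 ((p : ℝ) + 1)).indicator f y) * V) atTop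
      (𝓝 (ENNReal.ofReal (c * ∫ y, f y) * V)) := fun c =>
    ENNReal.Tendsto.mul_const (ENNReal.tendsto_ofReal
      ((tendsto_integral_indicator_ball hf).const_mul c)) (Or.inr hV)
  have htail : ∀ δ : ℝ, Tendsto (fun p : ℕ => ENNReal.ofReal δ⁻¹ * tailMass K f A p) atTop
      (𝓝 0) := fun δ => by
    simpa using ENNReal.Tendsto.const_mul (tendsto_tailMass (A := A) hK hf hfm)
      (Or.inr (ENNReal.ofReal_ne_top (r := δ⁻¹)))
  have hup : ∀ δ : ℝ, 0 < δ → 2 * δ < 1 →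
      limsup F (𝓝[>] 0) ≤ ENNReal.ofReal ((1 - 2 * δ)⁻¹ * ∫ y, f y) * V := by
    intro δ hδ hδ2
    have h1 : ∀ p : ℕ, limsup F (𝓝[>] 0) ≤ ENNReal.ofReal ((1 - 2 * δ)⁻¹ *
        ∫ y, (Metric.ball 0 ((p : ℝ) + 1)).indicator f y) * V +
          (0 + ENNReal.ofReal δ⁻¹ * tailMass K f A p) := by
      intro p
      rw [← (tendsto_const_nhds.add ((hball p).add tendsto_const_nhds)).limsup_eq]
      refine limsup_le_limsup ?_
      filter_upwards [self_mem_nhdsWithin] with lam hlam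
      exact mul_volume_limUnder_le hK hd hA hCZ hf hfm hf0 p hδ hδ2 hlam
    simp_rw [zero_add] at h1
    simpa using ge_of_tendsto' ((hmain (1 - 2 * δ)⁻¹).add (htail δ)) h1
  have hlow : ∀ δ : ℝ, 0 < δ →
      ENNReal.ofReal ((1 + 2 * δ)⁻¹ * ∫ y, f y) * V ≤ liminf F (𝓝[>] 0) := by
    intro δ hδ
    have h1 : ∀ p : ℕ, ENNReal.ofReal ((1 + 2 * δ)⁻¹ *
        ∫ y, (Metric.ball 0 ((p : ℝ) + 1)).indicator f y) * V ≤ liminf F (𝓝[>] 0) +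
          ENNReal.ofReal δ⁻¹ * tailMass K f A p := by
      intro p
      refine ENNReal.le_of_forall_pos_le_add fun η hη _ => ?_
      rw [add_assoc]
      refine tsub_le_iff_right.1 ?_
      refine le_liminf_of_le (by isBoundedDefault) ?_
      filter_upwards [self_mem_nhdsWithin,
        (hball p).eventually_le_const (ENNReal.coe_pos.2 hη)] with lam hlam hb
      rw [tsub_le_iff_right, add_comm (ENNReal.ofReal δ⁻¹ * _)]
      refine (le_mul_volume_limUnder hK hd hA hCZ hf hfm hf0 p hδ hlam).trans ?_
      gcongr
    simpa using le_of_tendsto_of_tendsto' (hmain (1 + 2 * δ)⁻¹)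
      (tendsto_const_nhds.add (htail δ)) h1
  have hcont : ∀ s : ℝ, Tendsto (fun δ : ℝ => ENNReal.ofReal ((1 + s * δ)⁻¹ * ∫ y, f y) * V)
      (𝓝[>] 0) (𝓝 (ENNReal.ofReal (∫ y, f y) * V)) := by
    intro s
    refine ENNReal.Tendsto.mul_const (ENNReal.tendsto_ofReal ?_) (Or.inr hV)
    have : ContinuousAt (fun δ : ℝ => (1 + s * δ)⁻¹ * ∫ y, f y) 0 := by
      refine ContinuousAt.mul (ContinuousAt.inv₀ (by fun_prop) (by simp)) continuousAt_const
    simpa using this.tendsto.mono_left (nhdsWithin_le_nhds (s := Ioi 0))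
  refine tendsto_of_le_liminf_of_limsup_le ?_ ?_
  · refine le_of_tendsto (hcont 2) ?_
    filter_upwards [self_mem_nhdsWithin] with δ hδ
    exact hlow δ hδ
  · refine ge_of_tendsto (hcont (-2)) ?_
    filter_upwards [self_mem_nhdsWithin,
      nhdsWithin_le_nhds (Iio_mem_nhds (show (0 : ℝ) < 1 / 2 by norm_num))] with δ hδ hδ2
    have hδ2 : δ < 1 / 2 := hδ2
    have := hup δ hδ (by linarith)
    rwa [show 1 - 2 * δ = 1 + -2 * δ by ring] at this

end SmallLevels

section PolarCoordinates

variable {E : Type*} [NormedAddCommGroup E] [InnerProductSpace ℝ E] [FiniteDimensional ℝ E]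
  [MeasurableSpace E] [BorelSpace E]

section Polar
variable [Nontrivial E]

lemma lintegral_polar {h : E → ℝ≥0∞} (hh : Measurable h) :
    ∫⁻ x, h x = ∫⁻ θ : Metric.sphere (0 : E) 1, ∫⁻ r : Ioi (0 : ℝ), h (r.1 • θ.1)
      ∂(Measure.volumeIoiPow (Module.finrank ℝ E - 1)) ∂((volume : Measure E).toSphere) := by
  have hmp := (volume : Measure E).measurePreserving_homeomorphUnitSphereProd
  rw [← lintegral_prod (fun q : Metric.sphere (0 : E) 1 × Ioi (0 : ℝ) => h (q.2.1 • q.1.1))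
      (by fun_prop),
    ← hmp.lintegral_comp (f := fun q : Metric.sphere (0 : E) 1 × Ioi (0 : ℝ) => h (q.2.1 • q.1.1))
      (by fun_prop)]
  conv_lhs => rw [← restrict_compl_singleton (μ := volume) (0 : E)]
  rw [← lintegral_subtype_comap (measurableSet_singleton _).compl]
  congr 1 with x
  congr 1
  simp only [homeomorphUnitSphereProd_apply_snd_coe, homeomorphUnitSphereProd_apply_fst_coe]
  rw [smul_inv_smul₀ (norm_ne_zero_iff.2 x.2)]

lemma lintegral_polar_mul {G : E → ℝ≥0∞} (hG : Measurable G)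
    (hG0 : ∀ c : ℝ, 0 < c → ∀ x, x ≠ 0 → G (c • x) = G x) {w : ℝ → ℝ≥0∞} (hw : Measurable w) :
    ∫⁻ x, w ‖x‖ * G x = (∫⁻ r : Ioi (0 : ℝ), w r
      ∂(Measure.volumeIoiPow (Module.finrank ℝ E - 1))) *
      ∫⁻ θ : Metric.sphere (0 : E) 1, G θ ∂((volume : Measure E).toSphere) := by
  rw [lintegral_polar (by fun_prop), ← lintegral_const_mul _ (by fun_prop)]
  congr 1 with θ
  rw [← lintegral_mul_const _ (by fun_prop)]
  congr 1 with r
  have hθ : ‖(θ : E)‖ = 1 := by simp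
  have hr : 0 < r.1 := r.2
  rw [hG0 _ hr _ (fun h => by simp [h] at hθ), norm_smul, hθ, mul_one, Real.norm_eq_abs,
    abs_of_pos hr]

end Polar

lemma lintegral_volumeIoiPow (n : ℕ) {w : ℝ → ℝ≥0∞} (hw : Measurable w) :
    ∫⁻ r : Ioi (0 : ℝ), w r ∂(Measure.volumeIoiPow n) =
      ∫⁻ r in Ioi (0 : ℝ), ENNReal.ofReal (r ^ n) * w r := by
  rw [Measure.volumeIoiPow, lintegral_withDensity_eq_lintegral_mul _ (by fun_prop) (by fun_prop)]
  simp only [Pi.mul_apply]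
  exact lintegral_subtype_comap measurableSet_Ioi (fun r : ℝ => ENNReal.ofReal (r ^ n) * w r)

lemma lintegral_volumeIoiPow_le (n : ℕ) {w : ℝ → ℝ≥0∞} (hw : Measurable w) {b : ℝ}
    (hwb : ∀ r, b < r → w r = 0) :
    ∫⁻ r : Ioi (0 : ℝ), w r ∂(Measure.volumeIoiPow n) ≤ ENNReal.ofReal (b ^ n) * ∫⁻ r, w r := by
  rw [lintegral_volumeIoiPow n hw, ← lintegral_const_mul' _ _ ENNReal.ofReal_ne_top]
  refine (setLIntegral_mono' measurableSet_Ioi fun r hr => ?_).trans (setLIntegral_le_lintegral _ _)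
  rcases lt_or_ge b r with h | h
  · simp [hwb r h]
  · have hr : 0 < r := hr
    gcongr

/-- The mass of the radial interval `(a, b]`. -/
def radialMass (E : Type*) [NormedAddCommGroup E] [InnerProductSpace ℝ E] (a b : ℝ) : ℝ≥0∞ :=
  ∫⁻ r : Ioi (0 : ℝ), (Ioc a b).indicator 1 r.1 ∂(Measure.volumeIoiPow (Module.finrank ℝ E - 1))

lemma radialMass_lt_top (a b : ℝ) : radialMass E a b < ∞ := by
  refine (lintegral_volumeIoiPow_le _ (measurable_one.indicator measurableSet_Ioc) (b := b)
    fun r hr => indicator_of_notMem (fun h => absurd h.2 (not_le.2 hr)) _).trans_lt ?_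
  rw [lintegral_indicator_one measurableSet_Ioc, Real.volume_Ioc]
  exact ENNReal.mul_lt_top ENNReal.ofReal_lt_top ENNReal.ofReal_lt_top

section Polar
variable [Nontrivial E]

lemma lintegral_annulus_polar {G : E → ℝ≥0∞} (hG : Measurable G)
    (hG0 : ∀ c : ℝ, 0 < c → ∀ x, x ≠ 0 → G (c • x) = G x) (a b : ℝ) :
    ∫⁻ x in annulus E a b, G x = radialMass E a b *
      ∫⁻ θ : Metric.sphere (0 : E) 1, G θ ∂((volume : Measure E).toSphere) := by
  rw [radialMass, ← lintegral_polar_mul hG hG0 (measurable_one.indicator measurableSet_Ioc),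
    ← lintegral_indicator (measurableSet_annulus a b)]
  congr 1 with x
  by_cases h : x ∈ annulus E a b
  · rw [indicator_of_mem h, indicator_of_mem (show ‖x‖ ∈ Ioc a b from h), Pi.one_apply, one_mul]
  · rw [indicator_of_notMem h, indicator_of_notMem (show ‖x‖ ∉ Ioc a b from h), zero_mul]

lemma radialMass_one_two_ne_zero : radialMass E 1 2 ≠ 0 := by
  intro h0
  have h := lintegral_annulus_polar (E := E) (G := fun _ => 1) measurable_const
    (fun _ _ _ _ => rfl) 1 2
  rw [h0, zero_mul, setLIntegral_one] at h
  obtain ⟨e, he⟩ := exists_norm_eq E (show (0 : ℝ) ≤ 3 / 2 by norm_num)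
  have hsub : Metric.ball e (1 / 4) ⊆ annulus E 1 2 := by
    intro x hx
    have hx : ‖x - e‖ < 1 / 4 := by simpa [dist_eq_norm] using hx
    have h1 := abs_le.1 (abs_norm_sub_norm_le x e)
    constructor <;> linarith [h1.1, h1.2]
  exact (Metric.measure_ball_pos volume e (by norm_num : (0 : ℝ) < 1 / 4)).ne'
    (measure_mono_null hsub h)

/-- The volume of a superlevel set of a homogeneous kernel. -/
lemma volume_superlevel_polar {Ω : E → ℝ} (hΩ : Measurable Ω)
    (hhom : ∀ c : ℝ, 0 < c → ∀ x, x ≠ 0 → Ω (c • x) = Ω x) :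
    volume {x | 1 < |Ω x / ‖x‖ ^ Module.finrank ℝ E|} =
      ENNReal.ofReal (1 / Module.finrank ℝ E) *
        ∫⁻ θ : Metric.sphere (0 : E) 1, ‖Ω θ‖ₑ ∂((volume : Measure E).toSphere) := by
  have hd : 0 < Module.finrank ℝ E := Module.finrank_pos
  set d := Module.finrank ℝ E
  have hm : MeasurableSet {x : E | 1 < |Ω x / ‖x‖ ^ d|} := by
    refine measurableSet_lt measurable_const ?_
    exact measurable_norm.comp (hΩ.div (measurable_norm.pow_const d))
  rw [← lintegral_indicator_one hm, lintegral_polar (measurable_one.indicator hm),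
    ← lintegral_const_mul' _ _ ENNReal.ofReal_ne_top]
  congr 1 with θ
  have hθ : ‖(θ : E)‖ = 1 := by simp
  have key : ∀ r : Ioi (0 : ℝ), r.1 • (θ : E) ∈ {x : E | 1 < |Ω x / ‖x‖ ^ d|} ↔
      r.1 ^ d < |Ω θ| := by
    intro r
    have hr : 0 < r.1 := r.2
    show 1 < |Ω (r.1 • (θ : E)) / ‖r.1 • (θ : E)‖ ^ d| ↔ _
    rw [hhom _ hr _ (fun h => by simp [h] at hθ), norm_smul, hθ, mul_one, Real.norm_eq_abs,
      abs_of_pos hr, abs_div, abs_of_pos (pow_pos hr d), one_lt_div (pow_pos hr d)]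
  rcases eq_or_ne (Ω θ) 0 with h0 | h0
  · simp only [h0, abs_zero, enorm_zero, mul_zero] at key ⊢
    rw [lintegral_eq_zero_iff' (by fun_prop)]
    · refine ae_of_all _ fun r => indicator_of_notMem ?_ _
      rw [key]
      exact not_lt.2 (pow_pos r.2 d).le
  · have hpos : 0 < |Ω θ| := abs_pos.2 h0
    set R : ℝ := |Ω θ| ^ ((d : ℝ)⁻¹) with hR
    have hR0 : 0 < R := Real.rpow_pos_of_pos hpos _
    have hRd : R ^ d = |Ω θ| := Real.rpow_inv_natCast_pow hpos.le hd.ne'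
    have hset : (fun r : Ioi (0 : ℝ) =>
        ({x : E | 1 < |Ω x / ‖x‖ ^ d|}.indicator 1 (r.1 • (θ : E)) : ℝ≥0∞)) =
        (Iio (⟨R, hR0⟩ : Ioi (0 : ℝ))).indicator 1 := by
      ext r
      have e : r.1 • (θ : E) ∈ {x : E | 1 < |Ω x / ‖x‖ ^ d|} ↔
          r ∈ Iio (⟨R, hR0⟩ : Ioi (0 : ℝ)) := by
        rw [key, ← hRd, pow_lt_pow_iff_left₀ r.2.le hR0.le hd.ne']
        rfl
      by_cases h : r ∈ Iio (⟨R, hR0⟩ : Ioi (0 : ℝ))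
      · rw [indicator_of_mem h, indicator_of_mem (e.2 h)]; rfl
      · rw [indicator_of_notMem h, indicator_of_notMem (fun h' => h (e.1 h'))]
    rw [hset, lintegral_indicator_one measurableSet_Iio, Measure.volumeIoiPow_apply_Iio,
      Real.enorm_eq_ofReal_abs, ← ENNReal.ofReal_mul (by positivity), Nat.sub_add_cancel hd, hRd]
    congr 1
    rw [← Nat.cast_add_one, Nat.sub_add_cancel hd]
    ring

end Polar

end PolarCoordinates

section Rotations

open scoped RealInnerProductSpace

variable {E : Type*} [NormedAddCommGroup E] [InnerProductSpace ℝ E] [FiniteDimensional ℝ E]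
  [MeasurableSpace E] [BorelSpace E]

/-- The reflection in the hyperplane orthogonal to `a`. -/
def mirror (a : E) : E ≃ₗᵢ[ℝ] E := (ℝ ∙ a)ᗮ.reflection

lemma mirror_apply (a x : E) : mirror a x = x - (2 * (⟪a, x⟫ / ‖a‖ ^ 2)) • a := by
  rw [mirror, Submodule.reflection_orthogonal_apply, Submodule.reflection_singleton_apply, mul_smul,
    ofNat_smul_eq_nsmul ℝ 2]
  simp

lemma mirror_mirror (a x : E) : mirror a (mirror a x) = x :=
  Submodule.reflection_reflection _ x

lemma det_mirror {a : E} (ha : a ≠ 0) :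
    LinearMap.det ((mirror a).toLinearEquiv : E →ₗ[ℝ] E) = -1 := by
  have h := Submodule.det_reflection (𝕜 := ℝ) (ℝ ∙ a)ᗮ
  rw [Submodule.orthogonal_orthogonal, finrank_span_singleton ha, pow_one] at h
  exact h

lemma det_mirror_trans {a b : E} (ha : a ≠ 0) (hb : b ≠ 0) :
    LinearMap.det (((mirror a).trans (mirror b)).toLinearEquiv : E →ₗ[ℝ] E) = 1 := by
  have h : (((mirror a).trans (mirror b)).toLinearEquiv : E →ₗ[ℝ] E) =
      ((mirror b).toLinearEquiv : E →ₗ[ℝ] E) ∘ₗ ((mirror a).toLinearEquiv : E →ₗ[ℝ] E) := rfl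
  rw [h, LinearMap.det_comp, det_mirror ha, det_mirror hb]
  norm_num

lemma norm_normalize {a : E} (ha : a ≠ 0) : ‖‖a‖⁻¹ • a‖ = 1 := by
  rw [norm_smul, norm_inv, norm_norm, inv_mul_cancel₀ (norm_ne_zero_iff.2 ha)]

lemma norm_mul_norm_normalize_sub_le {a b : E} (ha : a ≠ 0) (hb : b ≠ 0) :
    ‖a‖ * ‖‖a‖⁻¹ • a - ‖b‖⁻¹ • b‖ ≤ 2 * ‖a - b‖ := by
  have ha' : ‖a‖ ≠ 0 := norm_ne_zero_iff.2 ha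
  have hb' : ‖b‖ ≠ 0 := norm_ne_zero_iff.2 hb
  have e : ‖a‖ • (‖a‖⁻¹ • a - ‖b‖⁻¹ • b) = (a - b) + (‖b‖ - ‖a‖) • (‖b‖⁻¹ • b) := by
    rw [smul_sub, smul_inv_smul₀ ha', sub_smul, smul_inv_smul₀ hb']
    abel
  have hu : ‖‖b‖⁻¹ • b‖ = 1 := norm_normalize hb
  calc ‖a‖ * ‖‖a‖⁻¹ • a - ‖b‖⁻¹ • b‖ = ‖‖a‖ • (‖a‖⁻¹ • a - ‖b‖⁻¹ • b)‖ := by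
        rw [norm_smul, norm_norm]
    _ ≤ ‖a - b‖ + |‖b‖ - ‖a‖| * 1 := by
        rw [e]
        refine (norm_add_le _ _).trans ?_
        rw [norm_smul, hu, Real.norm_eq_abs]
    _ ≤ _ := by
        have := abs_norm_sub_norm_le b a
        rw [norm_sub_rev] at this
        linarith

lemma mirror_apply_normalize {a : E} (ha : a ≠ 0) (x : E) :
    mirror a x = x - (2 * ⟪‖a‖⁻¹ • a, x⟫) • (‖a‖⁻¹ • a) := by
  have ha' : ‖a‖ ≠ 0 := norm_ne_zero_iff.2 ha
  rw [mirror_apply, real_inner_smul_left, smul_smul]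
  congr 2
  field_simp

lemma norm_mirror_sub_le {a b : E} (ha : a ≠ 0) (hb : b ≠ 0) (x : E) :
    ‖a‖ * ‖mirror a x - mirror b x‖ ≤ 8 * ‖a - b‖ * ‖x‖ := by
  have h := norm_mul_norm_normalize_sub_le ha hb
  have hua := norm_normalize ha
  have hub := norm_normalize hb
  rw [mirror_apply_normalize ha, mirror_apply_normalize hb]
  generalize ‖a‖⁻¹ • a = u at *
  generalize ‖b‖⁻¹ • b = v at *
  have e : x - (2 * ⟪u, x⟫) • u - (x - (2 * ⟪v, x⟫) • v) =
      -((2 * ⟪u - v, x⟫) • u + (2 * ⟪v, x⟫) • (u - v)) := by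
    rw [inner_sub_left]
    module
  have h1 : ‖x - (2 * ⟪u, x⟫) • u - (x - (2 * ⟪v, x⟫) • v)‖ ≤ 4 * ‖u - v‖ * ‖x‖ := by
    rw [e, norm_neg]
    refine (norm_add_le _ _).trans ?_
    rw [norm_smul, norm_smul, hua, norm_mul, norm_mul]
    have i1 := norm_inner_le_norm (𝕜 := ℝ) (u - v) x
    have i2 := norm_inner_le_norm (𝕜 := ℝ) v x
    rw [hub, one_mul] at i2
    have := mul_le_mul_of_nonneg_right i2 (norm_nonneg (u - v))
    have hn : ‖u - v‖ * ‖x‖ = ‖x‖ * ‖u - v‖ := mul_comm _ _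
    rw [Real.norm_ofNat]
    linarith
  have := mul_le_mul_of_nonneg_left h1 (norm_nonneg a)
  have := mul_le_mul_of_nonneg_right h (norm_nonneg x)
  nlinarith

/-- The normal vector of the reflection taking the direction of `z` to the direction of `y`. -/
def pole (z y : E) : E := ‖y‖ • (‖z‖⁻¹ • z) - y

/-- The cone of vectors pointing roughly opposite to `z`. -/
def oppositeCone (z : E) : Set E := {y | ‖y + ‖y‖ • (‖z‖⁻¹ • z)‖ ≤ ‖y‖ / 2}

lemma continuous_pole (z : E) : Continuous (pole z) := by
  unfold pole
  fun_prop

lemma measurableSet_oppositeCone : MeasurableSet {q : E × E | q.2 ∈ oppositeCone q.1} := by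
  unfold oppositeCone
  exact measurableSet_le (f := fun q : E × E => ‖q.2 + ‖q.2‖ • (‖q.1‖⁻¹ • q.1)‖) (by fun_prop)
    (by fun_prop)

lemma norm_pole_sub_le {z : E} (hz : z ≠ 0) (y y' : E) :
    ‖pole z y - pole z y'‖ ≤ 2 * ‖y - y'‖ := by
  have e : pole z y - pole z y' = (‖y‖ - ‖y'‖) • (‖z‖⁻¹ • z) - (y - y') := by
    unfold pole
    module
  rw [e]
  refine (norm_sub_le _ _).trans ?_
  rw [norm_smul, norm_normalize hz, Real.norm_eq_abs]
  linarith [abs_norm_sub_norm_le y y']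

lemma norm_sub_le_pole {z y y' : E} (hz : z ≠ 0) (hy : y ∈ oppositeCone z)
    (hy' : y' ∈ oppositeCone z) : ‖y - y'‖ ≤ 2 * ‖pole z y - pole z y'‖ := by
  have hy : ‖y + ‖y‖ • (‖z‖⁻¹ • z)‖ ≤ ‖y‖ / 2 := hy
  have hy' : ‖y' + ‖y'‖ • (‖z‖⁻¹ • z)‖ ≤ ‖y'‖ / 2 := hy'
  have hu := norm_normalize hz
  have e : pole z y - pole z y' = (‖y‖ - ‖y'‖) • (‖z‖⁻¹ • z) - (y - y') := by
    unfold pole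
    module
  rw [e]
  generalize ‖z‖⁻¹ • z = u at *
  set w := y - y' with hw
  set t := ‖y‖ - ‖y'‖ with ht
  set S := ‖y‖ + ‖y'‖ with hS
  have hS0 : 0 ≤ S := by positivity
  rcases hS0.eq_or_lt with h0 | hSpos
  · have h1 : y = 0 := norm_eq_zero.1 (by linarith [norm_nonneg y, norm_nonneg y'])
    have h2 : y' = 0 := norm_eq_zero.1 (by linarith [norm_nonneg y, norm_nonneg y'])
    rw [hw, h1, h2, sub_zero, norm_zero]
    positivity
  have htS : t * S = ⟪w, y + y'⟫ := by
    rw [hw, inner_sub_left, inner_add_right, inner_add_right, real_inner_self_eq_norm_sq,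
      real_inner_self_eq_norm_sq, real_inner_comm y y']
    ring
  have hq : (t + ⟪w, u⟫) * S = ⟪w, (y + ‖y‖ • u) + (y' + ‖y'‖ • u)⟫ := by
    clear_value w
    rw [add_mul, htS, inner_add_right, inner_add_right, inner_add_right, inner_add_right,
      inner_smul_right, inner_smul_right]
    ring
  have hq2 : |t + ⟪w, u⟫| * S ≤ ‖w‖ * (S / 2) := by
    rw [← abs_of_pos hSpos, ← abs_mul, abs_of_pos hSpos, hq]
    refine (abs_real_inner_le_norm _ _).trans ?_
    refine mul_le_mul_of_nonneg_left ((norm_add_le _ _).trans ?_) (norm_nonneg _)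
    linarith
  have hq3 : |t + ⟪w, u⟫| ≤ ‖w‖ / 2 := by
    refine le_of_mul_le_mul_right ?_ hSpos
    linarith
  have hsq : ‖t • u - w‖ ^ 2 = t ^ 2 - 2 * (t * ⟪w, u⟫) + ‖w‖ ^ 2 := by
    rw [norm_sub_sq_real, norm_smul, hu, real_inner_smul_left, real_inner_comm, mul_one,
      Real.norm_eq_abs, sq_abs]
  have hqs : (t + ⟪w, u⟫) ^ 2 ≤ (‖w‖ / 2) ^ 2 := sq_le_sq' (abs_le.1 hq3).1 (abs_le.1 hq3).2
  refine (sq_le_sq₀ (norm_nonneg _) (by positivity)).1 ?_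
  rw [mul_pow, hsq]
  nlinarith [sq_nonneg (3 * t - (t + ⟪w, u⟫)), sq_nonneg ‖w‖]

lemma norm_pole_bounds {z y : E} (hz : z ≠ 0) (hy : y ∈ oppositeCone z) :
    3 / 2 * ‖y‖ ≤ ‖pole z y‖ ∧ ‖pole z y‖ ≤ 2 * ‖y‖ := by
  have hy : ‖y + ‖y‖ • (‖z‖⁻¹ • z)‖ ≤ ‖y‖ / 2 := hy
  have hu := norm_normalize hz
  constructor
  · have h : ‖(2 : ℝ) • y‖ ≤ ‖y + ‖y‖ • (‖z‖⁻¹ • z)‖ + ‖pole z y‖ := by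
      rw [show (2 : ℝ) • y = (y + ‖y‖ • (‖z‖⁻¹ • z)) - pole z y by unfold pole; module]
      exact norm_sub_le _ _
    rw [norm_smul, Real.norm_ofNat] at h
    linarith
  · unfold pole
    refine (norm_sub_le _ _).trans ?_
    rw [norm_smul, hu, norm_norm]
    linarith

lemma mirror_pole {z y : E} (hz : z ≠ 0) (hy : y ≠ 0) :
    mirror (pole z y) z = (‖z‖ / ‖y‖) • y := by
  have hz' := norm_ne_zero_iff.2 hz
  have hy' := norm_ne_zero_iff.2 hy
  have h : mirror (pole z y) (‖y‖ • (‖z‖⁻¹ • z)) = y := by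
    unfold mirror pole
    exact Submodule.reflection_sub (by rw [norm_smul, norm_normalize hz, norm_norm, mul_one])
  rw [map_smul, map_smul, smul_smul] at h
  have h' := congrArg ((‖z‖ / ‖y‖) • ·) h
  simp only [smul_smul] at h'
  rw [← h', show ‖z‖ / ‖y‖ * (‖y‖ * ‖z‖⁻¹) = 1 by field_simp, one_smul]

lemma LipschitzOnWith.volume_image_le {L : ℝ≥0} {g : E → E} {s : Set E}
    (hg : LipschitzOnWith L g s) :
    volume (g '' s) ≤ (L : ℝ≥0∞) ^ Module.finrank ℝ E * volume s := by
  have h := hg.hausdorffMeasure_image_le (d := (Module.finrank ℝ E : ℝ)) (Nat.cast_nonneg _)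
  have e := Measure.isAddLeftInvariant_eq_smul (volume : Measure E)
    (μH[(Module.finrank ℝ E : ℝ)] : Measure E)
  rw [e]
  simp only [Measure.smul_apply, ENNReal.smul_def, smul_eq_mul]
  rw [← ENNReal.rpow_natCast, mul_left_comm]
  exact mul_le_mul_right h _

lemma volume_oppositeCone_inter_preimage_le {z : E} (hz : z ≠ 0) (s : Set E) :
    volume (oppositeCone z ∩ pole z ⁻¹' s) ≤ 2 ^ Module.finrank ℝ E * volume s := by
  have hL : ∀ y ∈ oppositeCone z, ∀ y' ∈ oppositeCone z,
      ‖y - y'‖ ≤ 2 * ‖pole z y - pole z y'‖ := fun y hy y' hy' => norm_sub_le_pole hz hy hy'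
  have hinj : InjOn (pole z) (oppositeCone z) := by
    intro y hy y' hy' h
    have := hL y hy y' hy'
    rw [h, sub_self, norm_zero, mul_zero] at this
    exact sub_eq_zero.1 (norm_le_zero_iff.1 this)
  have hinv := hinj.leftInvOn_invFunOn
  have hlip : LipschitzOnWith 2 (Function.invFunOn (pole z) (oppositeCone z))
      (pole z '' oppositeCone z) := by
    refine LipschitzOnWith.of_dist_le_mul ?_
    rintro _ ⟨y, hy, rfl⟩ _ ⟨y', hy', rfl⟩
    rw [hinv hy, hinv hy', dist_eq_norm, dist_eq_norm]
    exact hL y hy y' hy'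
  have hlip' := hlip.mono (inter_subset_left (t := s))
  have h := LipschitzOnWith.volume_image_le hlip'
  refine (measure_mono ?_).trans (h.trans ?_)
  · rintro y ⟨hy, hys⟩
    exact ⟨pole z y, ⟨mem_image_of_mem _ hy, hys⟩, hinv hy⟩
  · norm_num
    exact mul_le_mul_right (measure_mono inter_subset_right) _

lemma measurableSet_oppositeCone_apply (z : E) : MeasurableSet (oppositeCone z) :=
  measurable_prodMk_left (x := z) measurableSet_oppositeCone

lemma lintegral_oppositeCone_le {z : E} (hz : z ≠ 0) {H : E → ℝ≥0∞} (hH : Measurable H) :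
    ∫⁻ y in oppositeCone z, H (pole z y) ≤ 2 ^ Module.finrank ℝ E * ∫⁻ a, H a := by
  rw [← lintegral_map hH (continuous_pole z).measurable, ← smul_eq_mul, ← lintegral_smul_measure]
  refine lintegral_mono' ?_ le_rfl
  refine Measure.le_iff.2 fun s hs => ?_
  rw [Measure.map_apply (continuous_pole z).measurable hs,
    Measure.restrict_apply ((continuous_pole z).measurable hs), inter_comm]
  exact volume_oppositeCone_inter_preimage_le hz s

/-- `W` dominates the `L¹` modulus of continuity of `Ω` under rotations, measured on the
annulus between the radii `1` and `2`. -/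
def RotationModulus (Ω : E → ℝ) (W : ℝ → ℝ≥0∞) : Prop :=
  ∀ ρ : E ≃ₗᵢ[ℝ] E, LinearMap.det (ρ.toLinearEquiv : E →ₗ[ℝ] E) = 1 →
    ∀ δ : ℝ, (∀ x, ‖x‖ = 1 → ‖ρ x - x‖ ≤ δ) →
      ∫⁻ z in annulus E 1 2, ‖Ω (ρ z) - Ω z‖ₑ ≤ W δ

variable {Ω : E → ℝ} {W : ℝ → ℝ≥0∞}

lemma lintegral_annulus_mirror (a : E) {h : E → ℝ≥0∞} (r R : ℝ) :
    ∫⁻ z in annulus E r R, h (mirror a z) = ∫⁻ z in annulus E r R, h z := by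
  have hp := (mirror a).measurePreserving
  have := hp.setLIntegral_comp_preimage_emb (mirror a).toHomeomorph.measurableEmbedding h
    (annulus E r R)
  rw [← this]
  congr 2
  ext z
  simp [annulus]

lemma RotationModulus.lintegral_mirror_sub_le (hW : RotationModulus Ω W) {a b : E} {r : ℝ}
    (ha : 1 / 2 ≤ ‖a‖) (hb : b ≠ 0) (hab : ‖a - b‖ ≤ r) :
    ∫⁻ z in annulus E 1 2, ‖Ω (mirror a z) - Ω (mirror b z)‖ₑ ≤ W (16 * r) := by
  have ha0 : a ≠ 0 := norm_ne_zero_iff.1 (by linarith)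
  rw [← lintegral_annulus_mirror a]
  simp only [mirror_mirror]
  simp_rw [enorm_sub_rev (Ω _) (Ω (mirror b _))]
  refine hW ((mirror a).trans (mirror b)) (det_mirror_trans ha0 hb) _ fun x hx => ?_
  have h := norm_mirror_sub_le ha0 hb (mirror a x)
  rw [mirror_mirror, LinearIsometryEquiv.norm_map, hx, norm_sub_rev] at h
  change ‖mirror b (mirror a x) - x‖ ≤ _
  nlinarith [norm_nonneg (mirror b (mirror a x) - x)]

lemma mem_oppositeCone_of_norm_le {y z : E} (hy : y ≠ 0)
    (h : ‖‖y‖⁻¹ • y + ‖z‖⁻¹ • z‖ ≤ 1 / 2) : y ∈ oppositeCone z := by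
  have hy' := norm_ne_zero_iff.2 hy
  change ‖y + ‖y‖ • (‖z‖⁻¹ • z)‖ ≤ ‖y‖ / 2
  have e : y + ‖y‖ • (‖z‖⁻¹ • z) = ‖y‖ • (‖y‖⁻¹ • y + ‖z‖⁻¹ • z) := by
    rw [smul_add, smul_inv_smul₀ hy']
  rw [e, norm_smul, norm_norm]
  have := mul_le_mul_of_nonneg_left h (norm_nonneg y)
  linarith

lemma mem_oppositeCone_of_mem_ball {y y' z : E} (hy : 1 / 2 ≤ ‖y‖) (hyy : ‖y - y'‖ ≤ 1 / 16)
    (hz : z ∈ Metric.ball (-(3 / 2 : ℝ) • (‖y‖⁻¹ • y)) (1 / 8)) :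
    z ∈ annulus E 1 2 ∧ y' ≠ 0 ∧ y' ∈ oppositeCone z := by
  have hy0 : y ≠ 0 := norm_ne_zero_iff.1 (by linarith)
  have hy'0 : y' ≠ 0 := by
    rintro rfl
    rw [sub_zero] at hyy
    linarith
  have hu := norm_normalize hy0
  rw [Metric.mem_ball, dist_eq_norm] at hz
  have hn := norm_mul_norm_normalize_sub_le hy0 hy'0
  generalize ‖y‖⁻¹ • y = u at *
  set a := -(3 / 2 : ℝ) • u with hadef
  have ha : ‖a‖ = 3 / 2 := by
    rw [hadef, norm_smul, hu]
    norm_num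
  have ha0 : a ≠ 0 := norm_ne_zero_iff.1 (by rw [ha]; norm_num)
  have hz1 := abs_norm_sub_norm_le z a
  rw [ha] at hz1
  have hz2 := abs_le.1 (hz1.trans hz.le)
  have hz0 : z ≠ 0 := norm_ne_zero_iff.1 (by linarith)
  refine ⟨⟨by linarith, by linarith⟩, hy'0, mem_oppositeCone_of_norm_le hy'0 ?_⟩
  have h1 := norm_mul_norm_normalize_sub_le ha0 hz0
  have hau : ‖a‖⁻¹ • a = -u := by
    rw [ha, hadef, smul_smul]
    norm_num
  rw [hau, ha, norm_sub_rev a z] at h1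
  have e : ‖y'‖⁻¹ • y' + ‖z‖⁻¹ • z = -(u - ‖y'‖⁻¹ • y') - (-u - ‖z‖⁻¹ • z) := by abel
  rw [e]
  refine (norm_sub_le _ _).trans ?_
  rw [norm_neg]
  nlinarith [norm_nonneg (u - ‖y'‖⁻¹ • y')]

lemma apply_mirror_pole (hhom : ∀ c : ℝ, 0 < c → ∀ x : E, x ≠ 0 → Ω (c • x) = Ω x) {z y : E}
    (hz : z ≠ 0) (hy : y ≠ 0) : Ω (mirror (pole z y) z) = Ω y := by
  rw [mirror_pole hz hy]
  exact hhom _ (div_pos (norm_pos_iff.2 hz) (norm_pos_iff.2 hy)) _ hy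

/-- The triple `(z, a, b)` is such that `z` lies in the annulus, and `a`, `b` are nearby poles. -/
def poleTriples (E : Type*) [NormedAddCommGroup E] (r : ℝ) : Set (E × E × E) :=
  {q | q.1 ∈ annulus E 1 2 ∧ (3 / 4 ≤ ‖q.2.1‖ ∧ ‖q.2.1‖ ≤ 6) ∧ ‖q.2.1 - q.2.2‖ ≤ r}

lemma measurableSet_poleTriples (r : ℝ) : MeasurableSet (poleTriples E r) := by
  refine (measurable_fst (measurableSet_annulus 1 2)).inter ((MeasurableSet.inter ?_ ?_).inter ?_)
  · exact measurableSet_le (g := fun q : E × E × E => ‖q.2.1‖) measurable_const (by fun_prop)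
  · exact measurableSet_le (f := fun q : E × E × E => ‖q.2.1‖) (by fun_prop) measurable_const
  · exact measurableSet_le (f := fun q : E × E × E => ‖q.2.1 - q.2.2‖) (by fun_prop)
      measurable_const

/-- The integrand comparing the two reflections of `z`. -/
def poleIntegrand (Ω : E → ℝ) (r : ℝ) : E × E × E → ℝ≥0∞ :=
  (poleTriples E r).indicator fun q => ‖Ω (mirror q.2.1 q.1) - Ω (mirror q.2.2 q.1)‖ₑ

lemma measurable_poleIntegrand (hΩ : Measurable Ω) (r : ℝ) : Measurable (poleIntegrand Ω r) := by
  have h1 : Measurable fun q : E × E × E => mirror q.2.1 q.1 := by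
    simp_rw [mirror_apply]
    fun_prop
  have h2 : Measurable fun q : E × E × E => mirror q.2.2 q.1 := by
    simp_rw [mirror_apply]
    fun_prop
  have h3 : Measurable fun q : E × E × E => Ω (mirror q.2.1 q.1) := hΩ.comp h1
  have h4 : Measurable fun q : E × E × E => Ω (mirror q.2.2 q.1) := hΩ.comp h2
  exact (h3.sub h4).enorm.indicator (measurableSet_poleTriples r)

lemma lintegral_triple_swap {G : E × E × E → ℝ≥0∞} (hG : Measurable G) :
    ∫⁻ y, ∫⁻ y', ∫⁻ z, G (z, y, y') = ∫⁻ z, ∫⁻ y, ∫⁻ y', G (z, y, y') := by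
  have h1 : ∀ y, ∫⁻ y', ∫⁻ z, G (z, y, y') = ∫⁻ z, ∫⁻ y', G (z, y, y') := fun y =>
    lintegral_lintegral_swap (Measurable.aemeasurable (by fun_prop))
  simp_rw [h1]
  refine lintegral_lintegral_swap (Measurable.aemeasurable ?_)
  have hm : Measurable fun p : (E × E) × E => G (p.1.2, p.1.1, p.2) := by fun_prop
  exact hm.lintegral_prod_right'

/-- The pairs of vectors in the cone opposite to `z`. -/
def conePairs (E : Type*) [NormedAddCommGroup E] [InnerProductSpace ℝ E] : Set (E × E × E) :=
  {q | q.2.1 ∈ oppositeCone q.1 ∧ q.2.2 ∈ oppositeCone q.1}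

lemma measurableSet_conePairs : MeasurableSet (conePairs E) := by
  have h1 : Measurable fun q : E × E × E => (q.1, q.2.1) := by fun_prop
  have h2 : Measurable fun q : E × E × E => (q.1, q.2.2) := by fun_prop
  exact (h1 measurableSet_oppositeCone).inter (h2 measurableSet_oppositeCone)

/-- The pullback of `poleIntegrand` under the pole maps. -/
def coneIntegrand (Ω : E → ℝ) (r : ℝ) : E × E × E → ℝ≥0∞ :=
  (conePairs E).indicator fun q => poleIntegrand Ω r (q.1, pole q.1 q.2.1, pole q.1 q.2.2)

lemma measurable_coneIntegrand (hΩ : Measurable Ω) (r : ℝ) : Measurable (coneIntegrand Ω r) := by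
  have h : Measurable fun q : E × E × E => (q.1, pole q.1 q.2.1, pole q.1 q.2.2) := by
    unfold pole
    fun_prop
  exact ((measurable_poleIntegrand hΩ r).comp h).indicator measurableSet_conePairs

lemma lintegral_coneIntegrand_le (hΩ : Measurable Ω) (r : ℝ) (z : E) :
    ∫⁻ y, ∫⁻ y', coneIntegrand Ω r (z, y, y') ≤
      4 ^ Module.finrank ℝ E * ∫⁻ a, ∫⁻ b, poleIntegrand Ω r (z, a, b) := by
  have hP := measurable_poleIntegrand hΩ r
  rcases eq_or_ne z 0 with rfl | hz
  · have h : ∀ y y' : E, coneIntegrand Ω r (0, y, y') = 0 := by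
      intro y y'
      have h0 : ∀ p : E × E, ((0 : E), p) ∉ poleTriples E r := by
        intro p hp
        have h := hp.1.1
        change (1 : ℝ) < ‖(0 : E)‖ at h
        rw [norm_zero] at h
        linarith
      simp [coneIntegrand, poleIntegrand, indicator_of_notMem (h0 _)]
    simp [h]
  have hC := measurableSet_oppositeCone_apply z
  have h1 : ∀ y, ∫⁻ y', coneIntegrand Ω r (z, y, y') ≤
      (oppositeCone z).indicator (fun y => 2 ^ Module.finrank ℝ E *
        ∫⁻ b, poleIntegrand Ω r (z, pole z y, b)) y := by
    intro y
    by_cases hy : y ∈ oppositeCone z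
    · rw [indicator_of_mem hy]
      have e : (fun y' => coneIntegrand Ω r (z, y, y')) =
          (oppositeCone z).indicator fun y' => poleIntegrand Ω r (z, pole z y, pole z y') := by
        funext y'
        by_cases hy' : y' ∈ oppositeCone z
        · rw [indicator_of_mem hy']
          exact indicator_of_mem (s := conePairs E) ⟨hy, hy'⟩ _
        · rw [indicator_of_notMem hy']
          exact indicator_of_notMem (fun h => hy' h.2) _
      rw [e, lintegral_indicator hC]
      exact lintegral_oppositeCone_le hz (H := fun b => poleIntegrand Ω r (z, pole z y, b))
        (by fun_prop)
    · have e : (fun y' => coneIntegrand Ω r (z, y, y')) = fun _ => 0 := by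
        funext y'
        exact indicator_of_notMem (fun h => hy h.1) _
      rw [e, lintegral_zero]
      exact zero_le
  have hm : Measurable fun a => ∫⁻ b, poleIntegrand Ω r (z, a, b) := by
    have : Measurable fun p : E × E => poleIntegrand Ω r (z, p.1, p.2) := by fun_prop
    exact this.lintegral_prod_right'
  refine (lintegral_mono h1).trans ?_
  rw [lintegral_indicator hC, lintegral_const_mul' _ _ (by finiteness)]
  have h2 := lintegral_oppositeCone_le hz hm
  refine (mul_le_mul_right h2 _).trans ?_
  rw [← mul_assoc, ← mul_pow]
  norm_num

lemma lintegral_poleIntegrand_le (hW : RotationModulus Ω W) {r : ℝ} (hr : r ≤ 1 / 8) (a b : E) :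
    ∫⁻ z, poleIntegrand Ω r (z, a, b) ≤
      (Metric.closedBall (0 : E) 6).indicator (fun a =>
        (Metric.closedBall a r).indicator (fun _ => W (16 * r)) b) a := by
  by_cases h : (3 / 4 ≤ ‖a‖ ∧ ‖a‖ ≤ 6) ∧ ‖a - b‖ ≤ r
  · obtain ⟨⟨h1, h2⟩, h3⟩ := h
    have hb : b ≠ 0 := by
      rintro rfl
      rw [sub_zero] at h3
      linarith
    rw [indicator_of_mem (by simpa using h2), indicator_of_mem
      (by rw [Metric.mem_closedBall, dist_eq_norm, norm_sub_rev]; exact h3)]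
    have e : (fun z => poleIntegrand Ω r (z, a, b)) = (annulus E 1 2).indicator
        fun z => ‖Ω (mirror a z) - Ω (mirror b z)‖ₑ := by
      funext z
      by_cases hz : z ∈ annulus E 1 2
      · rw [indicator_of_mem hz]
        exact indicator_of_mem (s := poleTriples E r) ⟨hz, ⟨h1, h2⟩, h3⟩ _
      · rw [indicator_of_notMem hz]
        exact indicator_of_notMem (fun h => hz h.1) _
    rw [e, lintegral_indicator (measurableSet_annulus 1 2)]
    exact hW.lintegral_mirror_sub_le (by linarith) hb h3
  · have e : (fun z => poleIntegrand Ω r (z, a, b)) = fun _ => 0 := by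
      funext z
      exact indicator_of_notMem (fun hp => h hp.2) _
    rw [e, lintegral_zero]
    exact zero_le

lemma volume_mul_enorm_sub_le (hhom : ∀ c : ℝ, 0 < c → ∀ x : E, x ≠ 0 → Ω (c • x) = Ω x)
    {y y' : E} {ρ : ℝ} (hρ : ρ ≤ 1 / 16) (hy : y ∈ annulus E (1 / 2) 3) (hyy : ‖y - y'‖ ≤ ρ) :
    volume (Metric.ball (0 : E) (1 / 8)) * ‖Ω y - Ω y'‖ₑ ≤
      ∫⁻ z, coneIntegrand Ω (2 * ρ) (z, y, y') := by
  have hy1 : 1 / 2 < ‖y‖ := hy.1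
  have hy2 : ‖y‖ ≤ 3 := hy.2
  have hy0 : y ≠ 0 := norm_ne_zero_iff.1 (by linarith)
  have hρ0 : 0 ≤ ρ := (norm_nonneg _).trans hyy
  set B := Metric.ball (-(3 / 2 : ℝ) • (‖y‖⁻¹ • y)) (1 / 8) with hB
  have e : volume (Metric.ball (0 : E) (1 / 8)) = volume B := by
    rw [hB, Measure.addHaar_ball_center volume (-(3 / 2 : ℝ) • (‖y‖⁻¹ • y))]
  rw [e, mul_comm, ← setLIntegral_const, ← lintegral_indicator Metric.isOpen_ball.measurableSet]
  refine lintegral_mono fun z => ?_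
  by_cases hz : z ∈ B
  · rw [indicator_of_mem hz]
    obtain ⟨hza, hy'0, hy'C⟩ := mem_oppositeCone_of_mem_ball hy1.le (hyy.trans hρ) hz
    obtain ⟨-, -, hyC⟩ := mem_oppositeCone_of_mem_ball (y' := y) hy1.le (by simp) hz
    have hza1 : 1 < ‖z‖ := hza.1
    have hz0 : z ≠ 0 := norm_ne_zero_iff.1 (by linarith)
    have hb := norm_pole_bounds hz0 hyC
    have h1 : (z, y, y') ∈ conePairs E := ⟨hyC, hy'C⟩
    have h2 : (z, pole z y, pole z y') ∈ poleTriples E (2 * ρ) :=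
      ⟨hza, ⟨show 3 / 4 ≤ ‖pole z y‖ by linarith, show ‖pole z y‖ ≤ 6 by linarith⟩,
        (norm_pole_sub_le hz0 y y').trans (by linarith)⟩
    rw [coneIntegrand, indicator_of_mem h1, poleIntegrand, indicator_of_mem h2]
    dsimp only
    rw [apply_mirror_pole hhom hz0 hy0, apply_mirror_pole hhom hz0 hy'0]
  · rw [indicator_of_notMem hz]
    exact zero_le

/-- The oscillation of `Ω` over neighbouring points is controlled by its rotational modulus. -/
lemma volume_mul_lintegral_ball_sub_le (hΩ : Measurable Ω)
    (hhom : ∀ c : ℝ, 0 < c → ∀ x : E, x ≠ 0 → Ω (c • x) = Ω x) (hW : RotationModulus Ω W)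
    {ρ : ℝ} (hρ : ρ ≤ 1 / 16) :
    volume (Metric.ball (0 : E) (1 / 8)) *
        ∫⁻ y in annulus E (1 / 2) 3, ∫⁻ y' in Metric.ball y ρ, ‖Ω y - Ω y'‖ₑ ≤
      4 ^ Module.finrank ℝ E * (volume (Metric.closedBall (0 : E) 6) *
        (volume (Metric.closedBall (0 : E) (2 * ρ)) * W (32 * ρ))) := by
  have hcV : volume (Metric.ball (0 : E) (1 / 8)) ≠ ∞ := measure_ball_lt_top.ne
  rw [← lintegral_const_mul' _ _ hcV]
  have h1 : ∀ y ∈ annulus E (1 / 2) 3, volume (Metric.ball (0 : E) (1 / 8)) *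
      ∫⁻ y' in Metric.ball y ρ, ‖Ω y - Ω y'‖ₑ ≤
        ∫⁻ y', ∫⁻ z, coneIntegrand Ω (2 * ρ) (z, y, y') := by
    intro y hy
    rw [← lintegral_const_mul' _ _ hcV]
    refine (setLIntegral_mono' Metric.isOpen_ball.measurableSet fun y' hy' => ?_).trans
      (setLIntegral_le_lintegral _ _)
    rw [Metric.mem_ball, dist_eq_norm, norm_sub_rev] at hy'
    exact volume_mul_enorm_sub_le hhom hρ hy hy'.le
  refine ((setLIntegral_mono' (measurableSet_annulus _ _) h1).trans
    (setLIntegral_le_lintegral _ _)).trans ?_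
  rw [lintegral_triple_swap (measurable_coneIntegrand hΩ _)]
  refine (lintegral_mono fun z => lintegral_coneIntegrand_le hΩ _ z).trans ?_
  rw [lintegral_const_mul' _ _ (by finiteness),
    ← lintegral_triple_swap (measurable_poleIntegrand hΩ _)]
  refine mul_le_mul_right ?_ _
  refine (lintegral_mono fun a => lintegral_mono fun b =>
    lintegral_poleIntegrand_le hW (by linarith) a b).trans ?_
  have e : ∀ a : E, ∫⁻ b, (Metric.closedBall (0 : E) 6).indicator (fun a =>
      (Metric.closedBall a (2 * ρ)).indicator (fun _ => W (16 * (2 * ρ))) b) a =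
      (Metric.closedBall (0 : E) 6).indicator
        (fun _ => volume (Metric.closedBall (0 : E) (2 * ρ)) * W (32 * ρ)) a := by
    intro a
    by_cases ha : a ∈ Metric.closedBall (0 : E) 6
    · simp only [indicator_of_mem ha]
      rw [lintegral_indicator Metric.isClosed_closedBall.measurableSet, setLIntegral_const,
        Measure.addHaar_closedBall_center, mul_comm, show 16 * (2 * ρ) = 32 * ρ by ring]
    · simp only [indicator_of_notMem ha, lintegral_zero]
  simp_rw [e]
  rw [lintegral_indicator Metric.isClosed_closedBall.measurableSet, setLIntegral_const, mul_comm]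

/-- Translations move `Ω` in `L¹` of an annulus no more than small rotations do. -/
lemma exists_lintegral_translate_sub_le (hΩ : Measurable Ω)
    (hhom : ∀ c : ℝ, 0 < c → ∀ x : E, x ≠ 0 → Ω (c • x) = Ω x) (hW : RotationModulus Ω W) :
    ∃ C : ℝ≥0∞, C ≠ ∞ ∧ ∀ δ : ℝ, 0 < δ → δ ≤ 1 / 32 → ∀ t : E, ‖t‖ ≤ δ →
      ∫⁻ y in annulus E 1 2, ‖Ω y - Ω (y + t)‖ₑ ≤ C * W (64 * δ) := by
  set d := Module.finrank ℝ E with hd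
  set c₀ := volume (Metric.ball (0 : E) (1 / 8)) with hc₀
  set V := volume (Metric.closedBall (0 : E) 6) with hV
  have hc0 : c₀ ≠ 0 := (Metric.measure_ball_pos _ _ (by norm_num)).ne'
  have hct : c₀ ≠ ∞ := measure_ball_lt_top.ne
  have hVt : V ≠ ∞ := measure_closedBall_lt_top.ne
  refine ⟨2 * (c₀⁻¹ * (4 ^ d * (V * 4 ^ d))), by finiteness, fun δ hδ hδ' t ht => ?_⟩
  set b := volume (Metric.ball (0 : E) δ) with hb
  have hb0 : b ≠ 0 := (Metric.measure_ball_pos _ _ hδ).ne'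
  have hbt : b ≠ ∞ := measure_ball_lt_top.ne
  set j : E → ℝ≥0∞ := fun y => ∫⁻ y' in Metric.ball y (2 * δ), ‖Ω y - Ω y'‖ₑ with hj
  set J := ∫⁻ y in annulus E (1 / 2) 3, j y with hJ
  have hJle : J ≤ c₀⁻¹ * (4 ^ d * (V * 4 ^ d)) * b * W (64 * δ) := by
    have h := volume_mul_lintegral_ball_sub_le hΩ hhom hW (ρ := 2 * δ) (by linarith)
    have e : volume (Metric.closedBall (0 : E) (2 * (2 * δ))) = 4 ^ d * b := by
      rw [Measure.addHaar_closedBall _ _ (by positivity), hb,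
        Measure.addHaar_ball_of_pos _ _ hδ, ← mul_assoc, show 2 * 2 * δ = 4 * δ by ring,
        mul_pow, ENNReal.ofReal_mul (by positivity),
        ENNReal.ofReal_pow (by norm_num), ENNReal.ofReal_ofNat, mul_assoc]
    rw [e, show 32 * (2 * δ) = 64 * δ by ring] at h
    change c₀ * J ≤ 4 ^ d * (V * (4 ^ d * b * W (64 * δ))) at h
    calc J = c₀⁻¹ * (c₀ * J) := by rw [← mul_assoc, ENNReal.inv_mul_cancel hc0 hct, one_mul]
      _ ≤ _ := (mul_le_mul_right h _).trans (by ring_nf; rfl)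
  have hjm : Measurable j := by
    have hS : MeasurableSet {p : E × E | p.2 ∈ Metric.ball p.1 (2 * δ)} := by
      simp only [Metric.mem_ball]
      exact measurableSet_lt (f := fun p : E × E => dist p.2 p.1) (by fun_prop) measurable_const
    have hm : Measurable ({p : E × E | p.2 ∈ Metric.ball p.1 (2 * δ)}.indicator
        fun p => ‖Ω p.1 - Ω p.2‖ₑ) := Measurable.indicator (by fun_prop) hS
    have e : j = fun y => ∫⁻ y', {p : E × E | p.2 ∈ Metric.ball p.1 (2 * δ)}.indicator
        (fun p => ‖Ω p.1 - Ω p.2‖ₑ) (y, y') := by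
      funext y
      rw [hj]
      dsimp only
      rw [← lintegral_indicator Metric.isOpen_ball.measurableSet]
      rfl
    rw [e]
    exact hm.lintegral_prod_right'
  have hpt : ∀ y, b * ‖Ω y - Ω (y + t)‖ₑ ≤ j y + j (y + t) := by
    intro y
    have hbe : b = volume (Metric.ball y δ) := by rw [hb, Measure.addHaar_ball_center volume y]
    have s1 : Metric.ball y δ ⊆ Metric.ball y (2 * δ) := Metric.ball_subset_ball (by linarith)
    have s2 : Metric.ball y δ ⊆ Metric.ball (y + t) (2 * δ) := by
      refine Metric.ball_subset_ball' ?_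
      rw [dist_self_add_right]
      linarith
    rw [hbe, mul_comm, ← setLIntegral_const]
    calc _ ≤ ∫⁻ y' in Metric.ball y δ, (‖Ω y - Ω y'‖ₑ + ‖Ω (y + t) - Ω y'‖ₑ) := by
          refine lintegral_mono fun y' => ?_
          have e : Ω y - Ω (y + t) = (Ω y - Ω y') - (Ω (y + t) - Ω y') := by ring
          rw [e]
          exact enorm_sub_le
      _ = _ := lintegral_add_left (by fun_prop) _
      _ ≤ j y + j (y + t) := add_le_add (lintegral_mono_set s1) (lintegral_mono_set s2)
  have h1 : ∫⁻ y in annulus E 1 2, j y ≤ J := by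
    refine lintegral_mono_set fun y hy => ?_
    have h1 : 1 < ‖y‖ := hy.1
    have h2 : ‖y‖ ≤ 2 := hy.2
    exact ⟨by linarith, by linarith⟩
  have h2 : ∫⁻ y in annulus E 1 2, j (y + t) ≤ J := by
    rw [hJ, ← lintegral_indicator (measurableSet_annulus _ _),
      ← lintegral_indicator (measurableSet_annulus _ _),
      ← lintegral_add_right_eq_self ((annulus E (1 / 2) 3).indicator j) t]
    refine lintegral_mono fun y => ?_
    by_cases hy : y ∈ annulus E 1 2
    · have h1 : 1 < ‖y‖ := hy.1
      have h2 : ‖y‖ ≤ 2 := hy.2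
      have h3 := norm_add_le y t
      have h4 := norm_sub_le (y + t) t
      rw [add_sub_cancel_right] at h4
      have hyt : y + t ∈ annulus E (1 / 2) 3 :=
        ⟨show 1 / 2 < ‖y + t‖ by linarith, show ‖y + t‖ ≤ 3 by linarith⟩
      rw [indicator_of_mem hy, indicator_of_mem hyt]
    · rw [indicator_of_notMem hy]
      exact zero_le
  have h3 : b * ∫⁻ y in annulus E 1 2, ‖Ω y - Ω (y + t)‖ₑ ≤ 2 * J := by
    rw [← lintegral_const_mul' _ _ hbt]
    refine (lintegral_mono fun y => hpt y).trans ?_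
    rw [lintegral_add_left hjm, two_mul]
    exact add_le_add h1 h2
  calc ∫⁻ y in annulus E 1 2, ‖Ω y - Ω (y + t)‖ₑ
      = b⁻¹ * (b * ∫⁻ y in annulus E 1 2, ‖Ω y - Ω (y + t)‖ₑ) := by
        rw [← mul_assoc, ENNReal.inv_mul_cancel hb0 hbt, one_mul]
    _ ≤ b⁻¹ * (2 * (c₀⁻¹ * (4 ^ d * (V * 4 ^ d)) * b * W (64 * δ))) :=
        mul_le_mul_right (h3.trans (mul_le_mul_right hJle _)) _
    _ = (b⁻¹ * b) * (2 * (c₀⁻¹ * (4 ^ d * (V * 4 ^ d))) * W (64 * δ)) := by ring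
    _ = _ := by rw [ENNReal.inv_mul_cancel hb0 hbt, one_mul]

end Rotations

section Homogeneous

variable {E : Type*} [NormedAddCommGroup E] [InnerProductSpace ℝ E] [FiniteDimensional ℝ E]
  [MeasurableSpace E] [BorelSpace E]

/-- The radial profile of the unit dyadic piece of a homogeneous kernel. -/
def profile (d : ℕ) (r : ℝ) : ℝ := (Ioc (1 : ℝ) 2).indicator (fun r => (r ^ d)⁻¹) r

lemma measurable_profile (d : ℕ) : Measurable (profile d) :=
  Measurable.indicator (by fun_prop) measurableSet_Ioc

lemma profile_nonneg (d : ℕ) (r : ℝ) : 0 ≤ profile d r :=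
  indicator_nonneg (fun x hx => by have := hx.1; positivity) r

lemma profile_le_one (d : ℕ) (r : ℝ) : profile d r ≤ 1 :=
  indicator_le' (fun _ hx => inv_le_one_of_one_le₀ (one_le_pow₀ hx.1.le))
    (fun _ _ => zero_le_one) r

/-- A bound for the variation of the radial profile. -/
def profileVariation (d : ℕ) (δ : ℝ) (r : ℝ) : ℝ≥0∞ :=
  (Ioc (1 : ℝ) 2).indicator (fun _ => ENNReal.ofReal (d * δ)) r +
    ((Icc (1 - δ) (1 + δ)).indicator (fun _ => 1) r +
      (Icc (2 - δ) (2 + δ)).indicator (fun _ => 1) r)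

lemma measurable_profileVariation (d : ℕ) (δ : ℝ) : Measurable (profileVariation d δ) := by
  unfold profileVariation
  exact (measurable_const.indicator measurableSet_Ioc).add
    ((measurable_const.indicator measurableSet_Icc).add
      (measurable_const.indicator measurableSet_Icc))

lemma lintegral_profileVariation (d : ℕ) {δ : ℝ} (hδ : 0 ≤ δ) :
    ∫⁻ r, profileVariation d δ r = ENNReal.ofReal ((d + 4) * δ) := by
  unfold profileVariation
  rw [lintegral_add_left (measurable_const.indicator measurableSet_Ioc),
    lintegral_add_left (measurable_const.indicator measurableSet_Icc),
    lintegral_indicator measurableSet_Ioc, lintegral_indicator measurableSet_Icc,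
    lintegral_indicator measurableSet_Icc, setLIntegral_const, setLIntegral_const,
    setLIntegral_const, Real.volume_Ioc, Real.volume_Icc, Real.volume_Icc, one_mul, one_mul,
    ← ENNReal.ofReal_mul (by positivity), ← ENNReal.ofReal_add (by linarith) (by linarith),
    ← ENNReal.ofReal_add (by ring_nf; positivity) (by linarith)]
  congr 1
  ring

lemma profileVariation_eq_zero (d : ℕ) {δ r : ℝ} (hδ : δ ≤ 1) (hr : 3 < r) :
    profileVariation d δ r = 0 := by
  unfold profileVariation
  rw [indicator_of_notMem, indicator_of_notMem, indicator_of_notMem, add_zero, add_zero]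
  all_goals
    intro h
    linarith [h.2]

lemma enorm_profile_sub_le (d : ℕ) {δ r s : ℝ} (h : |s - r| ≤ δ) :
    ‖profile d s - profile d r‖ₑ ≤ profileVariation d δ r := by
  have hle : ‖profile d s - profile d r‖ₑ ≤ 1 := by
    rw [← ofReal_norm, ← ENNReal.ofReal_one]
    refine ENNReal.ofReal_le_ofReal (abs_le.2 ⟨?_, ?_⟩)
    · linarith [profile_nonneg d s, profile_le_one d r]
    · linarith [profile_nonneg d r, profile_le_one d s]
  obtain ⟨h1, h2⟩ := abs_le.1 h
  unfold profileVariation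
  by_cases hr1 : r ∈ Icc (1 - δ) (1 + δ)
  · rw [indicator_of_mem hr1]
    exact hle.trans (le_add_left (le_add_right le_rfl))
  by_cases hr2 : r ∈ Icc (2 - δ) (2 + δ)
  · rw [indicator_of_mem hr2]
    exact hle.trans (le_add_left (le_add_left le_rfl))
  have hδ : 0 ≤ δ := (abs_nonneg _).trans h
  by_cases hr : r ∈ Ioc (1 : ℝ) 2
  · have hs : s ∈ Ioc (1 : ℝ) 2 := by
      constructor
      · by_contra hs
        exact hr1 ⟨by linarith [hr.1], by linarith⟩
      · by_contra hs
        exact hr2 ⟨by linarith, by linarith [hr.2]⟩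
    rw [indicator_of_mem hr]
    refine le_add_right ?_
    rw [profile, profile, indicator_of_mem hr, indicator_of_mem hs, ← ofReal_norm]
    refine ENNReal.ofReal_le_ofReal ?_
    have hr0 : 0 < r := by linarith [hr.1]
    have hs0 : 0 < s := by linarith [hs.1]
    have hri : r⁻¹ ≤ 1 := inv_le_one_of_one_le₀ hr.1.le
    have hsi : s⁻¹ ≤ 1 := inv_le_one_of_one_le₀ hs.1.le
    have hinv : |s⁻¹ - r⁻¹| ≤ δ := by
      have e : s⁻¹ - r⁻¹ = (s⁻¹ * r⁻¹) * (r - s) := by field_simp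
      rw [e, abs_mul, abs_of_pos (by positivity), abs_sub_comm r s]
      have : s⁻¹ * r⁻¹ ≤ 1 := mul_le_one₀ hsi (by positivity) hri
      nlinarith [abs_nonneg (s - r)]
    rw [← inv_pow, ← inv_pow, Real.norm_eq_abs]
    refine (abs_pow_sub_pow_le _ _ _).trans ?_
    have hmax : max |s⁻¹| |r⁻¹| ^ (d - 1) ≤ 1 :=
      pow_le_one₀ (le_max_of_le_left (abs_nonneg _))
        (max_le (by rwa [abs_of_pos (by positivity)]) (by rwa [abs_of_pos (by positivity)]))
    calc |s⁻¹ - r⁻¹| * d * max |s⁻¹| |r⁻¹| ^ (d - 1) ≤ |s⁻¹ - r⁻¹| * d * 1 :=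
          mul_le_mul_of_nonneg_left hmax (by positivity)
      _ ≤ d * δ := by
          rw [mul_one, mul_comm]
          exact mul_le_mul_of_nonneg_left hinv (by positivity)
  · have hs : s ∉ Ioc (1 : ℝ) 2 := by
      intro hs
      refine hr ⟨?_, ?_⟩
      · by_contra hr'
        exact hr1 ⟨by linarith [hs.1], by linarith⟩
      · by_contra hr'
        exact hr2 ⟨by linarith, by linarith [hs.2]⟩
    rw [profile, profile, indicator_of_notMem hr, indicator_of_notMem hs, sub_zero, enorm_zero]
    exact zero_le

/-- The kernel `Ω(x) / ‖x‖ ^ d` associated with `Ω`. -/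
def roughKernel (Ω : E → ℝ) (x : E) : ℝ := Ω x / ‖x‖ ^ Module.finrank ℝ E

variable {Ω : E → ℝ} {W : ℝ → ℝ≥0∞}

lemma piece_roughKernel_zero (Ω : E → ℝ) (x : E) :
    piece (roughKernel Ω) 0 x = profile (Module.finrank ℝ E) ‖x‖ * Ω x := by
  unfold piece profile roughKernel
  by_cases hx : 1 < ‖x‖ ∧ ‖x‖ ≤ 2
  · rw [indicator_of_mem (show x ∈ annulus E _ _ by simpa [annulus] using hx),
      indicator_of_mem (show ‖x‖ ∈ Ioc (1 : ℝ) 2 from hx)]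
    ring
  · rw [indicator_of_notMem (show x ∉ annulus E _ _ by simpa [annulus] using hx),
      indicator_of_notMem (show ‖x‖ ∉ Ioc (1 : ℝ) 2 from hx), zero_mul]

lemma measurable_roughKernel (hΩ : Measurable Ω) : Measurable (roughKernel Ω) := by
  unfold roughKernel
  fun_prop

lemma enorm_profile_mul_le (d : ℕ) (x : E) (c : ℝ) :
    ‖profile d ‖x‖ * c‖ₑ ≤ (annulus E 1 2).indicator (fun _ => ‖c‖ₑ) x := by
  by_cases hx : x ∈ annulus E 1 2
  · rw [indicator_of_mem hx, enorm_mul]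
    refine mul_le_of_le_one_left' ?_
    rw [← ofReal_norm, ← ENNReal.ofReal_one, Real.norm_eq_abs, abs_of_nonneg (profile_nonneg _ _)]
    exact ENNReal.ofReal_le_ofReal (profile_le_one _ _)
  · rw [profile, indicator_of_notMem (show ‖x‖ ∉ Ioc (1 : ℝ) 2 from hx), zero_mul, enorm_zero]
    exact zero_le

lemma lintegral_enorm_piece_le (Ω : E → ℝ) :
    ∫⁻ x, ‖piece (roughKernel Ω) 0 x‖ₑ ≤ ∫⁻ x in annulus E 1 2, ‖Ω x‖ₑ := by
  rw [← lintegral_indicator (measurableSet_annulus 1 2)]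
  refine lintegral_mono fun x => ?_
  rw [piece_roughKernel_zero]
  refine (enorm_profile_mul_le _ x _).trans (le_of_eq ?_)
  by_cases hx : x ∈ annulus E 1 2 <;> simp [hx]

lemma shiftDiff_piece_le (hΩ : Measurable Ω) {δ : ℝ} {t : E} (ht : ‖t‖ ≤ δ) :
    shiftDiff (piece (roughKernel Ω) 0) t ≤
      (∫⁻ y in annulus E 1 2, ‖Ω y - Ω (y + t)‖ₑ) +
        ∫⁻ x, profileVariation (Module.finrank ℝ E) δ ‖x‖ * ‖Ω x‖ₑ := by
  set d := Module.finrank ℝ E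
  have hp := measurable_profile d
  have hpt : ∀ x : E, ‖piece (roughKernel Ω) 0 (x - t) - piece (roughKernel Ω) 0 x‖ₑ ≤
      ‖profile d ‖x - t‖ * (Ω (x - t) - Ω x)‖ₑ +
        profileVariation d δ ‖x‖ * ‖Ω x‖ₑ := by
    intro x
    rw [piece_roughKernel_zero, piece_roughKernel_zero]
    have e : profile d ‖x - t‖ * Ω (x - t) - profile d ‖x‖ * Ω x =
        profile d ‖x - t‖ * (Ω (x - t) - Ω x) + (profile d ‖x - t‖ - profile d ‖x‖) * Ω x := by
      ring
    rw [e]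
    refine (enorm_add_le _ _).trans (add_le_add le_rfl ?_)
    rw [enorm_mul]
    refine mul_le_mul_left (enorm_profile_sub_le d ?_) _
    refine (abs_norm_sub_norm_le _ _).trans ?_
    rw [sub_sub_cancel_left, norm_neg]
    exact ht
  refine (lintegral_mono hpt).trans ?_
  have hm : Measurable fun x : E => ‖profile d ‖x - t‖ * (Ω (x - t) - Ω x)‖ₑ := by fun_prop
  rw [lintegral_add_left hm]
  refine add_le_add ?_ le_rfl
  rw [← lintegral_add_right_eq_self _ t, ← lintegral_indicator (measurableSet_annulus 1 2)]
  refine lintegral_mono fun y => ?_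
  rw [add_sub_cancel_right]
  refine (enorm_profile_mul_le _ y _).trans (le_of_eq ?_)
  by_cases hy : y ∈ annulus E 1 2 <;> simp [hy]

lemma roughKernel_smul [Nontrivial E]
    (hhom : ∀ c : ℝ, 0 < c → ∀ x : E, x ≠ 0 → Ω (c • x) = Ω x) {s : ℝ} (hs : 0 < s) (x : E) :
    roughKernel Ω (s • x) = (s ^ Module.finrank ℝ E)⁻¹ * roughKernel Ω x := by
  have hd : Module.finrank ℝ E ≠ 0 := Module.finrank_pos.ne'
  unfold roughKernel
  rcases eq_or_ne x 0 with rfl | hx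
  · simp [hd]
  · rw [hhom s hs x hx, norm_smul, Real.norm_of_nonneg hs.le, mul_pow, div_mul_eq_div_div_swap]
    field_simp

lemma shiftDiff_le_two_mul (k : E → ℝ) (hk : Measurable k) (t : E) :
    shiftDiff k t ≤ 2 * ∫⁻ x, ‖k x‖ₑ := by
  calc shiftDiff k t ≤ ∫⁻ x, (‖k (x - t)‖ₑ + ‖k x‖ₑ) := lintegral_mono fun x => enorm_sub_le
    _ = (∫⁻ x, ‖k (x - t)‖ₑ) + ∫⁻ x, ‖k x‖ₑ := lintegral_add_right _ (by fun_prop)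
    _ = _ := by
      rw [lintegral_sub_right_eq_self (fun x => ‖k x‖ₑ) t, two_mul]

variable [Nontrivial E]

lemma lintegral_profileVariation_mul_le (hΩ : Measurable Ω)
    (hhom : ∀ c : ℝ, 0 < c → ∀ x : E, x ≠ 0 → Ω (c • x) = Ω x) {δ : ℝ} (hδ : 0 ≤ δ) (hδ1 : δ ≤ 1) :
    ∫⁻ x, profileVariation (Module.finrank ℝ E) δ ‖x‖ * ‖Ω x‖ₑ ≤
      ENNReal.ofReal (3 ^ (Module.finrank ℝ E - 1)) *
        ENNReal.ofReal ((Module.finrank ℝ E + 4) * δ) *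
        ∫⁻ θ : Metric.sphere (0 : E) 1, ‖Ω θ‖ₑ ∂((volume : Measure E).toSphere) := by
  rw [lintegral_polar_mul (G := fun x => ‖Ω x‖ₑ) hΩ.enorm
    (fun c hc x hx => by rw [hhom c hc x hx]) (measurable_profileVariation _ δ)]
  refine mul_le_mul_left ?_ _
  refine (lintegral_volumeIoiPow_le _ (measurable_profileVariation _ δ)
    (fun r hr => profileVariation_eq_zero _ hδ1 hr)).trans ?_
  rw [lintegral_profileVariation _ hδ]

lemma lintegral_annulus_enorm_lt_top (hΩ : Measurable Ω)
    (hhom : ∀ c : ℝ, 0 < c → ∀ x : E, x ≠ 0 → Ω (c • x) = Ω x)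
    (hint : ∫⁻ θ : Metric.sphere (0 : E) 1, ‖Ω θ‖ₑ ∂((volume : Measure E).toSphere) ≠ ∞) :
    ∫⁻ x in annulus E 1 2, ‖Ω x‖ₑ < ∞ := by
  rw [lintegral_annulus_polar (G := fun x => ‖Ω x‖ₑ) hΩ.enorm
    (fun c hc x hx => by rw [hhom c hc x hx])]
  exact ENNReal.mul_lt_top (radialMass_lt_top 1 2) hint.lt_top

lemma tsum_modulus_lt_top (hΩ : Measurable Ω)
    (hhom : ∀ c : ℝ, 0 < c → ∀ x : E, x ≠ 0 → Ω (c • x) = Ω x)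
    (hint : ∫⁻ θ : Metric.sphere (0 : E) 1, ‖Ω θ‖ₑ ∂((volume : Measure E).toSphere) ≠ ∞)
    (hW : RotationModulus Ω W) (hWsum : ∑' k : ℕ, W ((1 / 2) ^ (k + 1)) ≠ ∞) :
    ∑' m, modulus (roughKernel Ω) m < ∞ := by
  set d := Module.finrank ℝ E with hd
  set N := ∫⁻ θ : Metric.sphere (0 : E) 1, ‖Ω θ‖ₑ ∂((volume : Measure E).toSphere)
  have hfin := lintegral_annulus_enorm_lt_top hΩ hhom hint
  have hpm : Measurable (piece (roughKernel Ω) 0) :=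
    (measurable_roughKernel hΩ).indicator (measurableSet_annulus _ _)
  have h1 : ∀ m, modulus (roughKernel Ω) m ≠ ∞ := by
    intro m
    have : modulus (roughKernel Ω) m ≤ 2 * ∫⁻ x in annulus E 1 2, ‖Ω x‖ₑ :=
      iSup_le fun t => iSup_le fun _ => (shiftDiff_le_two_mul _ hpm t).trans
        (mul_le_mul_right (lintegral_enorm_piece_le Ω) _)
    exact (this.trans_lt (ENNReal.mul_lt_top (by finiteness) hfin)).ne
  obtain ⟨C, hC, hCb⟩ := exists_lintegral_translate_sub_le hΩ hhom hW
  have h2 : ∀ k : ℕ, modulus (roughKernel Ω) (k + 7) ≤ C * W ((1 / 2) ^ (k + 1)) +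
      ENNReal.ofReal (3 ^ (d - 1)) * N * ENNReal.ofReal ((d + 4) * (1 / 2) ^ k) := by
    intro k
    refine iSup_le fun t => iSup_le fun ht => ?_
    set δ : ℝ := (2 : ℝ) ^ (-((k + 7 : ℕ) : ℤ)) with hδ
    have e : δ = (1 / 2) ^ k / 128 := by
      rw [hδ, zpow_neg, zpow_natCast, pow_add, one_div, inv_pow]
      norm_num
      ring
    have hk0 : (0 : ℝ) < (1 / 2) ^ k := by positivity
    have hk1 : ((1 : ℝ) / 2) ^ k ≤ 1 := pow_le_one₀ (by norm_num) (by norm_num)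
    refine (shiftDiff_piece_le hΩ ht).trans (add_le_add ?_ ?_)
    · have := hCb δ (by linarith) (by linarith) t ht
      rwa [show 64 * δ = (1 / 2) ^ (k + 1) by rw [e, pow_succ]; ring] at this
    · refine (lintegral_profileVariation_mul_le hΩ hhom (by linarith) (by linarith)).trans ?_
      rw [mul_right_comm]
      refine mul_le_mul_right (ENNReal.ofReal_le_ofReal ?_) _
      exact mul_le_mul_of_nonneg_left (by linarith) (by positivity)
  have hgeo : Summable fun k : ℕ => ((d : ℝ) + 4) * (1 / 2) ^ k :=
    (summable_geometric_of_lt_one (by norm_num) (by norm_num)).mul_left _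
  rw [← (ENNReal.summable (f := fun k => modulus (roughKernel Ω) (k + 7))).sum_add_tsum_nat_add']
  refine ENNReal.add_lt_top.2 ⟨ENNReal.sum_lt_top.2 fun m _ => (h1 m).lt_top, ?_⟩
  refine (ENNReal.tsum_le_tsum h2).trans_lt ?_
  rw [ENNReal.tsum_add, ENNReal.tsum_mul_left, ENNReal.tsum_mul_left,
    ← ENNReal.ofReal_tsum_of_nonneg (fun k => by positivity) hgeo]
  exact ENNReal.add_lt_top.2 ⟨ENNReal.mul_lt_top hC.lt_top hWsum.lt_top,
    ENNReal.mul_lt_top (ENNReal.mul_lt_top ENNReal.ofReal_lt_top hint.lt_top)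
      ENNReal.ofReal_lt_top⟩

lemma setIntegral_annulus_roughKernel (hΩ : Measurable Ω)
    (hhom : ∀ c : ℝ, 0 < c → ∀ x : E, x ≠ 0 → Ω (c • x) = Ω x)
    (hint : Integrable (fun θ : Metric.sphere (0 : E) 1 => Ω θ) (volume : Measure E).toSphere)
    (hmean : ∫ θ : Metric.sphere (0 : E) 1, Ω θ ∂((volume : Measure E).toSphere) = 0) (a b : ℝ) :
    ∫ x in annulus E a b, roughKernel Ω x = 0 := by
  by_cases hK : IntegrableOn (roughKernel Ω) (annulus E a b)
  swap
  · exact integral_undef hK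
  set d := Module.finrank ℝ E with hd
  have hsph : ∫⁻ θ : Metric.sphere (0 : E) 1, ENNReal.ofReal (Ω θ)
        ∂((volume : Measure E).toSphere) =
      ∫⁻ θ : Metric.sphere (0 : E) 1, ENNReal.ofReal (-Ω θ) ∂((volume : Measure E).toSphere) := by
    rw [integral_eq_lintegral_pos_part_sub_lintegral_neg_part hint, sub_eq_zero] at hmean
    refine (ENNReal.toReal_eq_toReal_iff' ?_ ?_).1 hmean
    · exact (lintegral_ofReal_le_lintegral_enorm _).trans_lt hint.2 |>.ne
    · exact ((lintegral_ofReal_le_lintegral_enorm _).trans_lt hint.neg.2).ne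
  have hw : Measurable fun r : ℝ => (Ioc a b).indicator (fun r => ENNReal.ofReal (r ^ d)⁻¹) r :=
    Measurable.indicator (by fun_prop) measurableSet_Ioc
  have key : ∀ G : E → ℝ, Measurable G → (∀ c : ℝ, 0 < c → ∀ x : E, x ≠ 0 → G (c • x) = G x) →
      ∫⁻ x in annulus E a b, ENNReal.ofReal (G x / ‖x‖ ^ d) =
        (∫⁻ r : Ioi (0 : ℝ), (Ioc a b).indicator (fun r => ENNReal.ofReal (r ^ d)⁻¹) r.1
          ∂(Measure.volumeIoiPow (d - 1))) *
        ∫⁻ θ : Metric.sphere (0 : E) 1, ENNReal.ofReal (G θ) ∂((volume : Measure E).toSphere) := by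
    intro G hG hG0
    rw [← lintegral_polar_mul (G := fun x => ENNReal.ofReal (G x)) (by fun_prop)
      (fun c hc x hx => by rw [hG0 c hc x hx]) hw,
      ← lintegral_indicator (measurableSet_annulus a b)]
    refine lintegral_congr fun x => ?_
    by_cases hx : x ∈ annulus E a b
    · rw [indicator_of_mem hx, indicator_of_mem (show ‖x‖ ∈ Ioc a b from hx),
        ← ENNReal.ofReal_mul (by positivity), div_eq_inv_mul]
    · rw [indicator_of_notMem hx, indicator_of_notMem (show ‖x‖ ∉ Ioc a b from hx), zero_mul]
  rw [integral_eq_lintegral_pos_part_sub_lintegral_neg_part hK, sub_eq_zero]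
  have e1 := key Ω hΩ hhom
  have e2 := key (fun x => -Ω x) hΩ.neg (fun c hc x hx => by rw [hhom c hc x hx])
  simp_rw [neg_div] at e2
  unfold roughKernel
  rw [e1, e2, hsph]

lemma diniKernel_roughKernel (hΩ : Measurable Ω)
    (hhom : ∀ c : ℝ, 0 < c → ∀ x : E, x ≠ 0 → Ω (c • x) = Ω x)
    (hint : Integrable (fun θ : Metric.sphere (0 : E) 1 => Ω θ) (volume : Measure E).toSphere)
    (hmean : ∫ θ : Metric.sphere (0 : E) 1, Ω θ ∂((volume : Measure E).toSphere) = 0)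
    (hW : RotationModulus Ω W) (hWsum : ∑' k : ℕ, W ((1 / 2) ^ (k + 1)) ≠ ∞) :
    DiniKernel (roughKernel Ω) where
  measurable := measurable_roughKernel hΩ
  homog _ hs x := roughKernel_smul hhom hs x
  integrable := ⟨((measurable_roughKernel hΩ).indicator
    (measurableSet_annulus _ _)).aestronglyMeasurable, (lintegral_enorm_piece_le Ω).trans_lt
      (lintegral_annulus_enorm_lt_top hΩ hhom hint.2.ne)⟩
  mean_zero a b _ := setIntegral_annulus_roughKernel hΩ hhom hint hmean a b
  dini := tsum_modulus_lt_top hΩ hhom hint.2.ne hW hWsum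

end Homogeneous

section Sphere

variable {E : Type*} [NormedAddCommGroup E] [InnerProductSpace ℝ E] [FiniteDimensional ℝ E]
  [MeasurableSpace E] [BorelSpace E]

variable {Ω : E → ℝ} [Nontrivial E]

lemma lintegral_sphere_comp_isometry {G : E → ℝ≥0∞} (hG : Measurable G)
    (hG0 : ∀ c : ℝ, 0 < c → ∀ x, x ≠ 0 → G (c • x) = G x) (ρ : E ≃ₗᵢ[ℝ] E) :
    ∫⁻ θ : Metric.sphere (0 : E) 1, G (ρ θ) ∂((volume : Measure E).toSphere) =
      ∫⁻ θ : Metric.sphere (0 : E) 1, G θ ∂((volume : Measure E).toSphere) := by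
  have hGρ : Measurable fun x => G (ρ x) := hG.comp ρ.continuous.measurable
  have hGρ0 : ∀ c : ℝ, 0 < c → ∀ x, x ≠ 0 → G (ρ (c • x)) = G (ρ x) := fun c hc x hx => by
    rw [map_smul]
    exact hG0 c hc _ (by simpa using hx)
  have h1 := lintegral_annulus_polar hGρ hGρ0 1 2
  have h2 := lintegral_annulus_polar hG hG0 1 2
  have h3 : ∫⁻ x in annulus E 1 2, G (ρ x) = ∫⁻ x in annulus E 1 2, G x := by
    have := ρ.measurePreserving.setLIntegral_comp_preimage_emb
      ρ.toHomeomorph.measurableEmbedding G (annulus E 1 2)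
    rw [← this]
    congr 2
    ext z
    simp [annulus]
  rw [h1, h2] at h3
  exact (ENNReal.mul_right_inj radialMass_one_two_ne_zero (radialMass_lt_top 1 2).ne).1 h3

lemma exists_measurable_homogeneous_version
    (hhom : ∀ c : ℝ, 0 < c → ∀ x : E, x ≠ 0 → Ω (c • x) = Ω x)
    (hm : AEStronglyMeasurable (fun θ : Metric.sphere (0 : E) 1 => Ω θ)
      (volume : Measure E).toSphere) :
    ∃ Ω' : E → ℝ, Measurable Ω' ∧ (∀ c : ℝ, 0 < c → ∀ x : E, x ≠ 0 → Ω' (c • x) = Ω' x) ∧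
      (∀ᵐ x : E, Ω x = Ω' x) ∧
      ∀ ρ : E ≃ₗᵢ[ℝ] E, ∀ᵐ θ : Metric.sphere (0 : E) 1 ∂((volume : Measure E).toSphere),
        Ω (ρ θ) = Ω' (ρ θ) := by
  have hS : MeasurableSet (Metric.sphere (0 : E) 1) := Metric.isClosed_sphere.measurableSet
  obtain ⟨G, hG, hGe⟩ := (MeasurableEmbedding.subtype_coe hS).exists_measurable_extend
    hm.stronglyMeasurable_mk.measurable fun _ => inferInstance
  have hdir : ∀ c : ℝ, 0 < c → ∀ x : E, ‖c • x‖⁻¹ • (c • x) = ‖x‖⁻¹ • x := fun c hc x => by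
    rw [norm_smul, Real.norm_of_nonneg hc.le, mul_inv, smul_smul, mul_right_comm,
      inv_mul_cancel₀ hc.ne', one_mul]
  have hae : ∀ᵐ θ : Metric.sphere (0 : E) 1 ∂((volume : Measure E).toSphere), Ω θ = G θ := by
    filter_upwards [hm.ae_eq_mk] with θ hθ
    rw [hθ]
    exact (congrFun hGe θ).symm
  obtain ⟨s, hs, hsm, hs0⟩ := exists_measurable_superset_of_null (ae_iff.1 hae)
  have hT0 : MeasurableSet (Subtype.val '' s : Set E) := hS.subtype_image hsm
  set T : Set E := (fun x => ‖x‖⁻¹ • x) ⁻¹' (Subtype.val '' s) with hTdef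
  have hdm : Measurable fun x : E => ‖x‖⁻¹ • x := by fun_prop
  have hT : MeasurableSet T := hdm hT0
  set I : E → ℝ≥0∞ := T.indicator 1 with hI
  have hIm : Measurable I := measurable_one.indicator hT
  have hThom : ∀ c : ℝ, 0 < c → ∀ x : E, c • x ∈ T ↔ x ∈ T := fun c hc x => by
    rw [hTdef, mem_preimage, mem_preimage, hdir c hc x]
  have hIhom : ∀ c : ℝ, 0 < c → ∀ x, x ≠ 0 → I (c • x) = I x := fun c hc x _ => by
    by_cases hx : x ∈ T
    · rw [hI, indicator_of_mem hx, indicator_of_mem ((hThom c hc x).2 hx)]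
      rfl
    · rw [hI, indicator_of_notMem hx, indicator_of_notMem (mt (hThom c hc x).1 hx)]
  have hIs : ∫⁻ θ : Metric.sphere (0 : E) 1, I θ ∂((volume : Measure E).toSphere) = 0 := by
    have e : (fun θ : Metric.sphere (0 : E) 1 => I θ) = s.indicator 1 := by
      funext θ
      have h1 : ‖(θ : E)‖⁻¹ • (θ : E) = θ := by
        rw [norm_eq_of_mem_sphere θ, inv_one, one_smul]
      have h2 : (θ : E) ∈ T ↔ θ ∈ s := by
        rw [hTdef, mem_preimage, h1]
        exact Subtype.val_injective.mem_set_image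
      by_cases hθ : θ ∈ s
      · rw [hI, indicator_of_mem hθ, indicator_of_mem (h2.2 hθ)]
        rfl
      · rw [hI, indicator_of_notMem hθ, indicator_of_notMem (mt h2.1 hθ)]
    rw [e, lintegral_indicator_one hsm, hs0]
  have hTvol : volume T = 0 := by
    have h := lintegral_polar_mul hIm hIhom (w := fun _ => 1) measurable_const
    rw [hIs, mul_zero] at h
    simpa [hI, lintegral_indicator_one hT] using h
  have hTG : ∀ x, x ≠ 0 → x ∉ T → Ω x = G (‖x‖⁻¹ • x) := by
    intro x hx hxT
    have hn : ‖‖x‖⁻¹ • x‖ = 1 := norm_normalize hx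
    have hmem : ‖x‖⁻¹ • x ∈ Metric.sphere (0 : E) 1 := by simpa using hn
    rw [← hhom ‖x‖⁻¹ (inv_pos.2 (norm_pos_iff.2 hx)) x hx]
    by_contra hne
    exact hxT ⟨⟨_, hmem⟩, hs hne, rfl⟩
  refine ⟨fun x => G (‖x‖⁻¹ • x), hG.comp hdm, fun c hc x _ => congrArg G (hdir c hc x), ?_, ?_⟩
  · filter_upwards [measure_eq_zero_iff_ae_notMem.1 hTvol,
      measure_eq_zero_iff_ae_notMem.1 (measure_singleton (0 : E))] with x hx hx0
    exact hTG x hx0 hx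
  · intro ρ
    have h := lintegral_sphere_comp_isometry hIm hIhom ρ
    have hm' : Measurable fun θ : Metric.sphere (0 : E) 1 => I (ρ θ) :=
      (hIm.comp ρ.continuous.measurable).comp measurable_subtype_coe
    rw [hIs, lintegral_eq_zero_iff hm'] at h
    filter_upwards [h] with θ hθ
    refine hTG _ ?_ fun hmem => ?_
    · rw [ne_eq, LinearIsometryEquiv.map_eq_zero_iff]
      exact ne_zero_of_mem_unit_sphere θ
    · have h1 : I (ρ θ) = 0 := hθ
      rw [hI, indicator_of_mem hmem] at h1
      exact one_ne_zero h1

/-- A nonnegative function, monotone near zero, with finite Dini integral is summable along the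
dyadic scales. -/
lemma tsum_dyadic_le_lintegral {ω : ℝ → ℝ} (h0 : ∀ δ, 0 < δ → 0 ≤ ω δ)
    (hmono : ∀ δ δ', 0 < δ → δ ≤ δ' → ω δ ≤ ω δ') :
    ∑' k : ℕ, ENNReal.ofReal (ω ((1 / 2) ^ (k + 1))) ≤
      2 * ∫⁻ δ in Ioo (0 : ℝ) 1, ENNReal.ofReal (ω δ / δ) := by
  set a : ℕ → ℝ := fun k => (1 / 2) ^ k with ha
  have hanti : Antitone a := fun i j hij => pow_le_pow_of_le_one (by norm_num) (by norm_num) hij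
  have ha0 : ∀ k, 0 < a k := fun k => by positivity
  have hterm : ∀ k, ENNReal.ofReal (ω ((1 / 2) ^ (k + 1))) ≤
      2 * ∫⁻ δ in Ioo (a (k + 1)) (a k), ENNReal.ofReal (ω δ / δ) := by
    intro k
    change ENNReal.ofReal (ω (a (k + 1))) ≤ _
    have hk := ha0 (k + 1)
    have hs : a k = 2 * a (k + 1) := by
      simp only [ha, pow_succ]
      ring
    have hω := h0 _ hk
    have h1 : ∫⁻ δ in Ioo (a (k + 1)) (a k), ENNReal.ofReal (ω (a (k + 1)) / a k) ≤
        ∫⁻ δ in Ioo (a (k + 1)) (a k), ENNReal.ofReal (ω δ / δ) := by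
      refine setLIntegral_mono' measurableSet_Ioo fun δ hδ => ENNReal.ofReal_le_ofReal ?_
      have hδ0 : 0 < δ := hk.trans hδ.1
      exact div_le_div₀ (hω.trans (hmono _ _ hk hδ.1.le)) (hmono _ _ hk hδ.1.le) hδ0 hδ.2.le
    refine le_trans (le_of_eq ?_) (mul_le_mul_right h1 _)
    rw [setLIntegral_const, Real.volume_Ioo, ← ENNReal.ofReal_mul (div_nonneg hω (ha0 k).le),
      ← ENNReal.ofReal_ofNat, ← ENNReal.ofReal_mul (by norm_num), hs]
    congr 1
    field_simp
    ring
  refine (ENNReal.tsum_le_tsum hterm).trans ?_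
  rw [ENNReal.tsum_mul_left]
  refine mul_le_mul_right ?_ _
  have hdisj : Pairwise (Function.onFun Disjoint fun k => Ioo (a (k + 1)) (a k)) :=
    hanti.pairwise_disjoint_on_Ioo_succ
  rw [← lintegral_iUnion (fun _ => measurableSet_Ioo) hdisj]
  refine lintegral_mono_set (iUnion_subset fun k => Ioo_subset_Ioo (ha0 _).le ?_)
  exact pow_le_one₀ (by norm_num) (by norm_num)

end Sphere

section Modulus

variable {n : ℕ} {Ω Ω' : EuclideanSpace ℝ (Fin n) → ℝ}

lemma omegaRot_congr
    (h : ∀ ρ : EuclideanSpace ℝ (Fin n) ≃ₗᵢ[ℝ] EuclideanSpace ℝ (Fin n),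
      ∀ᵐ θ : unitSphere n ∂(sphereMeasure n), Ω (ρ θ) = Ω' (ρ θ)) (δ : ℝ) :
    omegaRot n Ω δ = omegaRot n Ω' δ := by
  have key : ∀ ρ : EuclideanSpace ℝ (Fin n) ≃ₗᵢ[ℝ] EuclideanSpace ℝ (Fin n),
      ∫ θ : unitSphere n, |Ω (ρ θ) - Ω θ| ∂(sphereMeasure n) =
        ∫ θ : unitSphere n, |Ω' (ρ θ) - Ω' θ| ∂(sphereMeasure n) := by
    intro ρ
    refine integral_congr_ae ?_
    filter_upwards [h ρ, h (LinearIsometryEquiv.refl ℝ _)] with θ h1 h2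
    simp only [LinearIsometryEquiv.coe_refl, id] at h2
    rw [h1, h2]
  unfold omegaRot
  simp only [key]

section Integrable

variable [Nontrivial (EuclideanSpace ℝ (Fin n))] (hΩ : Measurable Ω)
  (hhom : ∀ c : ℝ, 0 < c → ∀ x, x ≠ 0 → Ω (c • x) = Ω x)
  (hint : Integrable (fun θ : unitSphere n => Ω θ) (sphereMeasure n))

include hΩ hhom hint

lemma integrable_comp_isometry (ρ : EuclideanSpace ℝ (Fin n) ≃ₗᵢ[ℝ] EuclideanSpace ℝ (Fin n)) :
    Integrable (fun θ : unitSphere n => Ω (ρ θ)) (sphereMeasure n) := by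
  refine ⟨((hΩ.comp ρ.continuous.measurable).comp measurable_subtype_coe).aestronglyMeasurable, ?_⟩
  have h := lintegral_sphere_comp_isometry (G := fun x => ‖Ω x‖ₑ) hΩ.enorm
    (fun c hc x hx => by simp only [hhom c hc x hx]) ρ
  rw [HasFiniteIntegral]
  exact h.trans_lt hint.2

lemma integral_comp_isometry (ρ : EuclideanSpace ℝ (Fin n) ≃ₗᵢ[ℝ] EuclideanSpace ℝ (Fin n)) :
    ∫ θ : unitSphere n, |Ω (ρ θ)| ∂(sphereMeasure n) =
      ∫ θ : unitSphere n, |Ω θ| ∂(sphereMeasure n) := by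
  have h := lintegral_sphere_comp_isometry (G := fun x => ‖Ω x‖ₑ) hΩ.enorm
    (fun c hc x hx => by simp only [hhom c hc x hx]) ρ
  have h1 := integral_norm_eq_lintegral_enorm
    (integrable_comp_isometry hΩ hhom hint ρ).aestronglyMeasurable
  have h2 := integral_norm_eq_lintegral_enorm hint.aestronglyMeasurable
  simp only [Real.norm_eq_abs] at h1 h2
  rw [h1, h2]
  exact congrArg ENNReal.toReal h

lemma bddAbove_omegaRot (δ : ℝ) :
    BddAbove {I : ℝ | ∃ ρ : EuclideanSpace ℝ (Fin n) ≃ₗᵢ[ℝ] EuclideanSpace ℝ (Fin n),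
      LinearMap.det
        (ρ.toLinearEquiv : EuclideanSpace ℝ (Fin n) →ₗ[ℝ] EuclideanSpace ℝ (Fin n)) = 1 ∧
      (∀ x : EuclideanSpace ℝ (Fin n), ‖x‖ = 1 → ‖ρ x - x‖ ≤ δ) ∧
      I = ∫ θ : unitSphere n, |Ω (ρ θ) - Ω θ| ∂(sphereMeasure n)} := by
  refine ⟨2 * ∫ θ : unitSphere n, |Ω θ| ∂(sphereMeasure n), ?_⟩
  rintro _ ⟨ρ, -, -, rfl⟩
  have hρ := integrable_comp_isometry hΩ hhom hint ρ
  calc ∫ θ : unitSphere n, |Ω (ρ θ) - Ω θ| ∂(sphereMeasure n)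
      ≤ ∫ θ : unitSphere n, (|Ω (ρ θ)| + |Ω θ|) ∂(sphereMeasure n) :=
        integral_mono (hρ.sub hint).abs (hρ.abs.add hint.abs) fun θ => abs_sub _ _
    _ = 2 * ∫ θ : unitSphere n, |Ω θ| ∂(sphereMeasure n) := by
        rw [integral_add hρ.abs hint.abs, integral_comp_isometry hΩ hhom hint ρ, two_mul]

lemma integral_le_omegaRot {δ : ℝ}
    {ρ : EuclideanSpace ℝ (Fin n) ≃ₗᵢ[ℝ] EuclideanSpace ℝ (Fin n)}
    (hdet : LinearMap.det
      (ρ.toLinearEquiv : EuclideanSpace ℝ (Fin n) →ₗ[ℝ] EuclideanSpace ℝ (Fin n)) = 1)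
    (hρ : ∀ x : EuclideanSpace ℝ (Fin n), ‖x‖ = 1 → ‖ρ x - x‖ ≤ δ) :
    ∫ θ : unitSphere n, |Ω (ρ θ) - Ω θ| ∂(sphereMeasure n) ≤ omegaRot n Ω δ :=
  le_csSup (bddAbove_omegaRot hΩ hhom hint δ) ⟨ρ, hdet, hρ, rfl⟩

lemma omegaRot_nonneg {δ : ℝ} (hδ : 0 ≤ δ) : 0 ≤ omegaRot n Ω δ := by
  refine le_trans (integral_nonneg fun θ => abs_nonneg _)
    (integral_le_omegaRot hΩ hhom hint (ρ := LinearIsometryEquiv.refl ℝ _) ?_ ?_)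
  · exact LinearMap.det_id
  · intro x _
    simpa using hδ

lemma omegaRot_mono {δ δ' : ℝ} (hδ : 0 ≤ δ) (h : δ ≤ δ') : omegaRot n Ω δ ≤ omegaRot n Ω δ' := by
  refine csSup_le_csSup (bddAbove_omegaRot hΩ hhom hint δ') ?_ ?_
  · exact ⟨_, LinearIsometryEquiv.refl ℝ _, LinearMap.det_id, fun x _ => by simpa using hδ, rfl⟩
  · rintro _ ⟨ρ, hdet, hρ, rfl⟩
    exact ⟨ρ, hdet, fun x hx => (hρ x hx).trans h, rfl⟩

lemma rotationModulus_omegaRot :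
    RotationModulus Ω fun δ => radialMass (EuclideanSpace ℝ (Fin n)) 1 2 *
      ENNReal.ofReal (omegaRot n Ω δ) := by
  intro ρ hdet δ hδ
  have hG : Measurable fun z => ‖Ω (ρ z) - Ω z‖ₑ :=
    ((hΩ.comp ρ.continuous.measurable).sub hΩ).enorm
  rw [lintegral_annulus_polar hG]
  · refine mul_le_mul_right ?_ _
    have hi := (integrable_comp_isometry hΩ hhom hint ρ).sub hint
    have h := ofReal_integral_norm_eq_lintegral_enorm hi
    refine le_trans (le_of_eq h.symm) (ENNReal.ofReal_le_ofReal ?_)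
    exact integral_le_omegaRot hΩ hhom hint hdet hδ
  · intro c hc x hx
    have hx' : ρ x ≠ 0 := by simpa using hx
    simp only [map_smul, hhom c hc x hx, hhom c hc _ hx']

lemma tsum_modulus_ne_top
    (hdini : ∫⁻ δ in Ioo (0 : ℝ) 1, ENNReal.ofReal (omegaRot n Ω δ / δ) < ∞) :
    ∑' k : ℕ, radialMass (EuclideanSpace ℝ (Fin n)) 1 2 *
      ENNReal.ofReal (omegaRot n Ω ((1 / 2) ^ (k + 1))) ≠ ∞ := by
  rw [ENNReal.tsum_mul_left]
  refine ENNReal.mul_ne_top (radialMass_lt_top 1 2).ne (ne_top_of_le_ne_top ?_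
    (tsum_dyadic_le_lintegral (fun δ hδ => omegaRot_nonneg hΩ hhom hint hδ.le)
      fun δ δ' hδ h => omegaRot_mono hΩ hhom hint hδ.le h))
  exact ENNReal.mul_ne_top (by norm_num) hdini.ne

end Integrable

lemma TOmegaFun_congr {f f' : EuclideanSpace ℝ (Fin n) → ℝ} (hΩ : ∀ᵐ x, Ω x = Ω' x)
    (hf : f =ᵐ[volume] f') (x : EuclideanSpace ℝ (Fin n)) :
    TOmegaFun n Ω f x = limUnder (𝓝[>] 0) (truncInt (roughKernel Ω') f' x) := by
  unfold TOmegaFun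
  congr 1
  funext ε
  refine integral_congr_ae (ae_restrict_of_ae ?_)
  filter_upwards [hf,
    (Measure.measurePreserving_sub_left volume x).quasiMeasurePreserving.ae hΩ] with y h1 h2
  simp only [roughKernel, finrank_euclideanSpace_fin]
  rw [h1, h2]

end Modulus

end RoughKernel

/-- If `Ω` is homogeneous of degree zero, integrable with mean value zero on
`S^{n-1}` and satisfies the `L¹`-Dini condition, and `f ∈ L¹(ℝⁿ)` with `f ≥ 0`, then
`lim_{λ→0⁺} λ · m({x : |T_Ω f(x)| > λ}) = (1/n) ‖Ω‖_{L¹(S^{n-1})} ‖f‖_{L¹(ℝⁿ)}`. -/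
theorem limiting_behavior_singular_integral_function
    {n : ℕ} (hn : 0 < n) (Ω : EuclideanSpace ℝ (Fin n) → ℝ)
    (hhom : HomogeneousZero Ω)
    (hmean : ∫ θ : unitSphere n, Ω (θ : EuclideanSpace ℝ (Fin n)) ∂(sphereMeasure n) = 0)
    (hdini : L1Dini n Ω)
    (f : EuclideanSpace ℝ (Fin n) → ℝ)
    (hf : Integrable f (volume : Measure (EuclideanSpace ℝ (Fin n))))
    (hfpos : ∀ x, 0 ≤ f x) :
    Tendsto (fun lam : ℝ =>
        ENNReal.ofReal lam * volume {x : EuclideanSpace ℝ (Fin n) | lam < |TOmegaFun n Ω f x|})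
      (nhdsWithin 0 (Ioi 0))
      (nhds (ENNReal.ofReal ((1 / n) *
        (∫ θ : unitSphere n, |Ω (θ : EuclideanSpace ℝ (Fin n))| ∂(sphereMeasure n)) *
        (∫ y, |f y|)))) := by
  have : NeZero n := ⟨hn.ne'⟩
  have : Nontrivial (EuclideanSpace ℝ (Fin n)) :=
    Module.nontrivial_of_finrank_pos (R := ℝ) (by rwa [finrank_euclideanSpace_fin])
  obtain ⟨Ω', hΩm, hΩhom, hΩae, hΩrot⟩ :=
    RoughKernel.exists_measurable_homogeneous_version hhom hdini.1.aestronglyMeasurable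
  have hθ : (fun θ : unitSphere n => Ω θ) =ᵐ[sphereMeasure n] fun θ => Ω' θ :=
    hΩrot (LinearIsometryEquiv.refl ℝ _)
  have hint : Integrable (fun θ : unitSphere n => Ω' θ) (sphereMeasure n) := hdini.1.congr hθ
  have hmean' : ∫ θ : unitSphere n, Ω' θ ∂(sphereMeasure n) = 0 := by
    rw [← hmean]
    exact integral_congr_ae hθ.symm
  have hdini' := hdini.2
  simp only [RoughKernel.omegaRot_congr hΩrot] at hdini'
  have hK := RoughKernel.diniKernel_roughKernel hΩm hΩhom hint hmean'
    (RoughKernel.rotationModulus_omegaRot hΩm hΩhom hint)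
    (RoughKernel.tsum_modulus_ne_top hΩm hΩhom hint hdini')
  obtain ⟨A, hA, hCZ⟩ := RoughKernel.exists_czDecomp hn
  have hVeq := RoughKernel.volume_superlevel_polar hΩm hΩhom
  have hnorm : ∫⁻ θ : unitSphere n, ‖Ω' θ‖ₑ ∂(sphereMeasure n) =
      ENNReal.ofReal (∫ θ : unitSphere n, |Ω θ| ∂(sphereMeasure n)) := by
    rw [← ofReal_integral_norm_eq_lintegral_enorm hint]
    congr 1
    refine integral_congr_ae ?_
    filter_upwards [hθ] with θ h
    rw [Real.norm_eq_abs, h]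
  rw [finrank_euclideanSpace_fin] at hVeq
  change _ = _ * ∫⁻ θ : unitSphere n, ‖Ω' θ‖ₑ ∂(sphereMeasure n) at hVeq
  rw [hnorm, ← ENNReal.ofReal_mul (by positivity)] at hVeq
  have hV : volume {x | 1 < |RoughKernel.roughKernel Ω' x|} =
      ENNReal.ofReal (1 / n * ∫ θ : unitSphere n, |Ω θ| ∂(sphereMeasure n)) := by
    simpa only [RoughKernel.roughKernel, finrank_euclideanSpace_fin] using hVeq
  set f' : EuclideanSpace ℝ (Fin n) → ℝ := fun x => max (hf.1.mk f x) 0 with hf'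
  have hff' : f =ᵐ[volume] f' := by
    filter_upwards [hf.1.ae_eq_mk] with x hx
    rw [hf']
    dsimp only
    rw [← hx, max_eq_left (hfpos x)]
  have hlim := RoughKernel.tendsto_mul_volume_limUnder hK
    (by rwa [finrank_euclideanSpace_fin]) hA hCZ (hV ▸ ENNReal.ofReal_ne_top) (hf.congr hff')
    (hf.1.stronglyMeasurable_mk.measurable.max measurable_const) (fun x => le_max_right _ _)
  simp only [← RoughKernel.TOmegaFun_congr hΩae hff'] at hlim
  have hfint : ∫ y, |f y| = ∫ y, f' y :=
    integral_congr_ae (hff'.mono fun y h => by rw [← h]; exact abs_of_nonneg (hfpos y))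
  rw [hV, mul_comm, ← ENNReal.ofReal_mul (by positivity), ← hfint] at hlim
  exact hlim
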